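/- Let C ⊆ A^n be a smooth irreducible algebraic curve. Then deg(TC) = deg(C) + ω(C)·deg(Tan(C)). -/

import Mathlib

open MvPolynomial

/-- A subset of affine space is an algebraic set if it is the zero locus of an
ideal of polynomials. -/
def IsAlgebraicSet {K : Type} [Field K] {n : ℕ} (W : Set (Fin n → K)) : Prop :=
  ∃ I : Ideal (MvPolynomial (Fin n) K), W = zeroLocus K I

/-- An irreducible affine variety: an algebraic set whose vanishing ideal is prime. -/
def IsIrreducibleVariety {K : Type} [Field K] {n : ℕ} (W : Set (Fin n → K)) : Prop :=
  IsAlgebraicSet W ∧ (vanishingIdeal K W).IsPrime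

/-- The dimension of an affine algebraic set: the Krull dimension of its coordinate ring. -/
noncomputable def varDim {K : Type} [Field K] {n : ℕ} (W : Set (Fin n → K)) : ℕ :=
  ENat.toNat ((ringKrullDim (MvPolynomial (Fin n) K ⧸ vanishingIdeal K W)).unbotD 0)

/-- The (Zariski) tangent space of `W` at `p`:
all `y` with `∇f(p)·y = 0` for every `f ∈ I(W)`. -/
def tangentSpaceAt {K : Type} [Field K] {n : ℕ} (W : Set (Fin n → K)) (p : Fin n → K) :
    Set (Fin n → K) :=
  {y | ∀ f ∈ vanishingIdeal K W, ∑ i, eval p (pderiv i f) * y i = 0}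

/-- The dimension of the tangent space at a point. -/
noncomputable def tangentDimAt {K : Type} [Field K] {n : ℕ} (W : Set (Fin n → K))
    (p : Fin n → K) : ℕ :=
  Module.finrank K (Submodule.span K (tangentSpaceAt W p))

/-- A point of an (irreducible) variety is a smooth point when the tangent space has
the dimension of the variety. -/
def IsSmoothAt {K : Type} [Field K] {n : ℕ} (W : Set (Fin n → K)) (p : Fin n → K) : Prop :=
  tangentDimAt W p = varDim W

/-- A variety is smooth if it is smooth at each of its points. -/
def IsSmoothVariety {K : Type} [Field K] {n : ℕ} (W : Set (Fin n → K)) : Prop :=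
  ∀ p ∈ W, IsSmoothAt W p

/-- Projection `A^{2n} → A^n` to the first `n` coordinates. -/
def fstProj {K : Type} {n : ℕ} (z : Fin (n + n) → K) : Fin n → K :=
  fun i => z (Fin.castAdd n i)

/-- Projection `A^{2n} → A^n` to the last `n` coordinates. -/
def sndProj {K : Type} {n : ℕ} (z : Fin (n + n) → K) : Fin n → K :=
  fun i => z (Fin.natAdd n i)

/-- The tangent bundle `TW ⊆ A^{2n}`: pairs `(x, y)` with `x ∈ W` and `y ∈ T_x W`. -/
def tangentBundle {K : Type} [Field K] {n : ℕ} (W : Set (Fin n → K)) :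
    Set (Fin (n + n) → K) :=
  {z | fstProj z ∈ W ∧ sndProj z ∈ tangentSpaceAt W (fstProj z)}

/-- Zariski closure of a subset of affine space. -/
def zclosure {K : Type} [Field K] {n : ℕ} (W : Set (Fin n → K)) : Set (Fin n → K) :=
  zeroLocus K (vanishingIdeal K W)

/-- The tangential variety `Tan(W)`: the Zariski closure of `π₂(TW)`. -/
def tangentialVariety {K : Type} [Field K] {n : ℕ} (W : Set (Fin n → K)) :
    Set (Fin n → K) :=
  zclosure (sndProj '' tangentBundle W)

/-- The geometric degree of an (irreducible) affine algebraic set: the maximal finite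
number of points in an intersection with an affine-linear subspace of complementary
dimension. -/
noncomputable def geomDegree {K : Type} [Field K] {n : ℕ} (W : Set (Fin n → K)) : ℕ :=
  sSup {m | ∃ L : AffineSubspace K (Fin n → K),
    Module.finrank K L.direction = n - varDim W ∧
    (W ∩ (L : Set (Fin n → K))).Finite ∧ (W ∩ (L : Set (Fin n → K))).ncard = m}

/-- A linear variety: an affine-linear subspace of affine space. -/
def IsLinearVariety {K : Type} [Field K] {n : ℕ} (W : Set (Fin n → K)) : Prop :=
  ∃ L : AffineSubspace K (Fin n → K), W = (L : Set (Fin n → K))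

/-- A line: an affine-linear subspace of dimension 1. -/
def IsLine {K : Type} [Field K] {n : ℕ} (W : Set (Fin n → K)) : Prop :=
  ∃ L : AffineSubspace K (Fin n → K), W = (L : Set (Fin n → K)) ∧
    Module.finrank K L.direction = 1

open Classical in
/-- `ω(C)`: the number of points in the fiber of `π₂ : TC → Tan(C)` over a generic
point of `Tan(C)`; it is `0` when `C` is a line. -/
noncomputable def omegaCurve {K : Type} [Field K] {n : ℕ} (C : Set (Fin n → K)) : ℕ :=
  if IsLine C then 0
  else sInf {m | ∃ Z : Set (Fin n → K), IsAlgebraicSet Z ∧ ¬ tangentialVariety C ⊆ Z ∧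
    ∀ v ∈ tangentialVariety C \ Z,
      {z ∈ tangentBundle C | sndProj z = v}.ncard = m}

/-- A smooth irreducible algebraic curve. -/
def IsSmoothCurve {K : Type} [Field K] {n : ℕ} (C : Set (Fin n → K)) : Prop :=
  IsIrreducibleVariety C ∧ varDim C = 1 ∧ IsSmoothVariety C
theorem ringKrullDim_of_integral_inj {A B : Type*} [CommRing A] [CommRing B] [Algebra A B]
    [Algebra.IsIntegral A B] (hinj : Function.Injective (algebraMap A B)) :
    ringKrullDim B = ringKrullDim A := by
  apply le_antisymm
  · refine Order.krullDim_le_of_strictMono (PrimeSpectrum.comap (algebraMap A B)) ?_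
    intro p q hpq
    have h : p.asIdeal < q.asIdeal := hpq
    have := Ideal.IsIntegral.comap_lt_comap (R := A) h
    exact this
  · refine iSup_le fun l => ?_
    have : FaithfulSMul A B := (faithfulSMul_iff_algebraMap_injective _ _).2 hinj
    have hs := Algebra.IsIntegral.comap_surjective A B
    obtain ⟨q, hq⟩ := hs l.head
    have : q.asIdeal.LiesOver l.head.asIdeal := ⟨by rw [← hq]; rfl⟩
    obtain ⟨L, hL, -⟩ := Ideal.exists_ltSeries_of_hasGoingUp l q.asIdeal
    rw [← hL]
    exact le_iSup (fun l : LTSeries (PrimeSpectrum B) => (l.length : WithBot ℕ∞)) L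

theorem ringKrullDim_eq_of_trdeg (K : Type) [Field K] {B : Type} [CommRing B] [IsDomain B]
    [Algebra K B] [Algebra.FiniteType K B] {d : ℕ} :
    Algebra.trdeg K B = d ↔ ringKrullDim B = d := by
  obtain ⟨s, g, hinj, hintg⟩ := exists_integral_inj_algHom_of_fg K B
  let := g.toRingHom.toAlgebra
  have : IsScalarTower K (MvPolynomial (Fin s) K) B := .of_algebraMap_eq' g.comp_algebraMap.symm
  have : Algebra.IsIntegral (MvPolynomial (Fin s) K) B := ⟨hintg⟩
  have hi : Function.Injective (algebraMap (MvPolynomial (Fin s) K) B) := hinj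
  have h1 : ringKrullDim B = s := by
    rw [ringKrullDim_of_integral_inj hi, MvPolynomial.ringKrullDim_of_isNoetherianRing,
      ringKrullDim_eq_zero_of_field]
    simp
  have h2 : Algebra.trdeg K B = s := by
    have : FaithfulSMul (MvPolynomial (Fin s) K) B := (faithfulSMul_iff_algebraMap_injective _ _).2 hi
    have := trdeg_add_eq (R := K) (S := MvPolynomial (Fin s) K) (A := B)
    rw [← this, MvPolynomial.trdeg_of_isDomain, trdeg_eq_zero]
    simp
  rw [h1, h2]
  norm_cast

namespace Polynomial
open Polynomial in
theorem _root_.lemB_theta {A B k l : Type} [CommRing A] [IsDomain A] [CommRing B] [IsDomain B]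
    [Field k] [Field l] [CharZero k]
    [Algebra A B] [Algebra A k] [IsFractionRing A k] [Algebra B l] [IsFractionRing B l]
    [Algebra k l] [Algebra A l] [IsScalarTower A k l] [IsScalarTower A B l]
    [FiniteDimensional k l] :
    ∃ (θ : B) (F : A[X]), F.Monic ∧ F.map (algebraMap A k) = minpoly k (algebraMap B l θ) ∧
      F.natDegree = Module.finrank k l ∧ (IntermediateField.adjoin k {algebraMap B l θ} = ⊤) := by
  obtain ⟨α, hα⟩ := Field.exists_primitive_element k l
  have halg : Algebra.IsAlgebraic A B := by
    have h1 : Algebra.IsAlgebraic A l :=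
      (IsFractionRing.comap_isAlgebraic_iff (A := A) (K := k) (C := l)).2 inferInstance
    refine ⟨fun b => ?_⟩
    have := h1.isAlgebraic (algebraMap B l b)
    exact (isAlgebraic_algebraMap_iff (IsFractionRing.injective B l)).1 this
  have hAl : Function.Injective (algebraMap A l) := by
    rw [IsScalarTower.algebraMap_eq A k l]
    exact (algebraMap k l).injective.comp (IsFractionRing.injective A k)
  have hAB : Function.Injective (algebraMap A B) := by
    rw [IsScalarTower.algebraMap_eq A B l] at hAl
    exact Function.Injective.of_comp hAl
  have : FaithfulSMul A B := (faithfulSMul_iff_algebraMap_injective _ _).2 hAB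
  -- scale `α` into `B`
  obtain ⟨c, hc, θ0, hθ0⟩ : ∃ c : A, c ≠ 0 ∧ ∃ θ0 : B, algebraMap B l θ0 = algebraMap A l c * α := by
    obtain ⟨b, b', hb', rfl⟩ := IsFractionRing.div_surjective (A := B) α
    have hb0 : b' ≠ 0 := nonZeroDivisors.ne_zero hb'
    obtain ⟨c, hc, hdvd⟩ := (halg.isAlgebraic b').exists_nonzero_dvd hb'
    obtain ⟨e, he⟩ := hdvd
    refine ⟨c, hc, e * b, ?_⟩
    have hne : algebraMap B l b' ≠ 0 := by simpa using hb0
    rw [IsScalarTower.algebraMap_apply A B l, he, map_mul, map_mul]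
    field_simp
  have scal : ∀ (c : k) (β : l), c ≠ 0 → IntermediateField.adjoin k {β} = ⊤ →
      IntermediateField.adjoin k {algebraMap k l c * β} = ⊤ := by
    intro c β hc hβ
    rw [eq_top_iff, ← hβ, IntermediateField.adjoin_le_iff, Set.singleton_subset_iff]
    have h1 : algebraMap k l c * β ∈ IntermediateField.adjoin k {algebraMap k l c * β} :=
      IntermediateField.subset_adjoin k _ rfl
    have h2 := mul_mem (algebraMap_mem (IntermediateField.adjoin k {algebraMap k l c * β}) c⁻¹) h1
    have : algebraMap k l c ≠ 0 := by simpa using hc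
    simpa [this] using h2
  have hck : algebraMap A k c ≠ 0 := by
    simpa using hc
  have h0 : IntermediateField.adjoin k {algebraMap B l θ0} = ⊤ := by
    rw [hθ0, IsScalarTower.algebraMap_apply A k l]
    exact scal _ _ hck hα
  set β := algebraMap B l θ0 with hβ
  have hintg : IsIntegral k β := Algebra.IsIntegral.isIntegral β
  set p := minpoly k β with hp
  have hpm : p.Monic := minpoly.monic hintg
  set d := IsLocalization.commonDenom (nonZeroDivisors A) p.support p.coeff with hd
  have hdk : algebraMap A k d ≠ 0 := by simp
  have hl := IsLocalization.scaleRoots_commonDenom_mem_lifts (nonZeroDivisors A) p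
    (by rw [hpm.leadingCoeff]; exact one_mem _)
  obtain ⟨F, hF, hFdeg, hFm⟩ := lifts_and_natDegree_eq_and_monic hl
    ((monic_scaleRoots_iff _).2 hpm)
  have hfin : ∀ γ : l, IntermediateField.adjoin k {γ} = ⊤ →
      (minpoly k γ).natDegree = Module.finrank k l := by
    intro γ hγ
    rw [← IntermediateField.adjoin.finrank (Algebra.IsIntegral.isIntegral γ), hγ]
    exact IntermediateField.finrank_top'
  refine ⟨algebraMap A B d * θ0, F, hFm, ?_, ?_, ?_⟩
  · have e1 : algebraMap B l (algebraMap A B d * θ0) = algebraMap k l (algebraMap A k d) * β := by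
      rw [map_mul, ← IsScalarTower.algebraMap_apply, ← IsScalarTower.algebraMap_apply]
    rw [hF, e1]
    have hroot : aeval (algebraMap k l (algebraMap A k d) * β)
        (p.scaleRoots (algebraMap A k d)) = 0 :=
      scaleRoots_aeval_eq_zero (minpoly.aeval k β)
    have hdvd := minpoly.dvd k _ hroot
    symm
    refine (eq_of_monic_of_dvd_of_natDegree_le (minpoly.monic (Algebra.IsIntegral.isIntegral _))
      ((monic_scaleRoots_iff _).2 hpm) hdvd ?_).symm
    rw [natDegree_scaleRoots, hfin _ (scal _ _ hdk h0), hfin _ h0]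
  · rw [hFdeg, natDegree_scaleRoots, hfin _ h0]
  · have e1 : algebraMap B l (algebraMap A B d * θ0) = algebraMap k l (algebraMap A k d) * β := by
      rw [map_mul, ← IsScalarTower.algebraMap_apply, ← IsScalarTower.algebraMap_apply]
    rw [e1]; exact scal _ _ hdk h0

open Polynomial in
theorem _root_.lemB_core {K A B : Type} [Field K] [IsAlgClosed K] [CommRing A] [IsDomain A] [CommRing B]
    [IsDomain B] [Algebra K A] [Algebra K B] [Algebra A B] [IsScalarTower K A B]
    (θ : B) (F : A[X]) (hF : F.Monic) (a : A) (U V : A[X])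
    (hUV : U * F + V * derivative F = C a)
    (hker : ∀ G : A[X], aeval θ G = 0 → F ∣ G)
    (hFθ : aeval θ F = 0)
    (hB : ∀ b : B, ∃ (N : ℕ) (G : A[X]), algebraMap A B a ^ N * b = aeval θ G)
    (φ : A →ₐ[K] K) (hφ : φ a ≠ 0) :
    {ψ : B →ₐ[K] K | ∀ x, ψ (algebraMap A B x) = φ x}.ncard = F.natDegree := by
  set Fφ : K[X] := F.map (φ : A →+* K) with hFφ
  have hFφm : Fφ.Monic := hF.map _
  have hsep : Fφ.Separable := by
    refine ⟨C (φ a)⁻¹ * U.map (φ : A →+* K), C (φ a)⁻¹ * V.map (φ : A →+* K), ?_⟩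
    have := congrArg (Polynomial.map (φ : A →+* K)) hUV
    simp only [Polynomial.map_add, Polynomial.map_mul, Polynomial.map_C] at this
    rw [hFφ, derivative_map, mul_assoc, mul_assoc, ← mul_add, this, ← C_mul]
    simp [inv_mul_cancel₀ hφ]
  have hcard : {t : K | Fφ.eval t = 0}.ncard = F.natDegree := by
    have h1 : {t : K | Fφ.eval t = 0} = Fφ.rootSet K := by
      ext t
      simp [mem_rootSet, hFφm.ne_zero]
    rw [h1, ← Nat.card_coe_set_eq, Nat.card_eq_fintype_card,
      card_rootSet_eq_natDegree hsep (by simpa using IsAlgClosed.splits Fφ), hFφ,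
      hF.natDegree_map]
  have eval_hom : ∀ (ψ : B →ₐ[K] K), (∀ x, ψ (algebraMap A B x) = φ x) → ∀ G : A[X],
      ψ (aeval θ G) = (G.map (φ : A →+* K)).eval (ψ θ) := by
    intro ψ hψ G
    rw [aeval_def, ← AlgHom.coe_toRingHom, hom_eval₂, eval_map]
    congr 1
    ext x; exact hψ x
  rw [← hcard]
  refine Set.ncard_congr (fun ψ _ => ψ θ) ?_ ?_ ?_
  · intro ψ hψ
    have := eval_hom ψ hψ F
    rw [hFθ, map_zero] at this
    exact this.symm
  · intro ψ ψ' hψ hψ' h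
    ext b
    obtain ⟨N, G, hG⟩ := hB b
    have h1 := congrArg ψ hG
    have h2 := congrArg ψ' hG
    rw [eval_hom ψ hψ, map_mul, map_pow, hψ] at h1
    rw [eval_hom ψ' hψ', map_mul, map_pow, hψ', ← h, ← h1] at h2
    exact (mul_left_cancel₀ (pow_ne_zero _ hφ) h2).symm
  · intro t ht
    have ht0 : Fφ.eval t = 0 := ht
    have hz : ∀ G : A[X], aeval θ G = 0 → (G.map (φ : A →+* K)).eval t = 0 := by
      intro G hG
      obtain ⟨H, rfl⟩ := hker G hG
      rw [Polynomial.map_mul, eval_mul, ← hFφ, ht0, zero_mul]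
    have heq : ∀ G H : A[X], aeval θ G = aeval θ H →
        (G.map (φ : A →+* K)).eval t = (H.map (φ : A →+* K)).eval t := by
      intro G H h
      have := hz (G - H) (by rw [map_sub, h, sub_self])
      rwa [Polynomial.map_sub, eval_sub, sub_eq_zero] at this
    choose N G hG using hB
    let f : B → K := fun b => ((G b).map (φ : A →+* K)).eval t / φ a ^ N b
    have key : ∀ (b : B) (M : ℕ) (H : A[X]), algebraMap A B a ^ M * b = aeval θ H →
        f b = (H.map (φ : A →+* K)).eval t / φ a ^ M := by
      intro b M H h
      have e := heq (C (a ^ M) * G b) (C (a ^ N b) * H) (by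
        rw [map_mul, map_mul, ← hG, ← h, aeval_C, aeval_C, map_pow, map_pow]; ring)
      simp only [Polynomial.map_mul, Polynomial.map_C, eval_mul, eval_C] at e
      simp only [f]
      rw [div_eq_div_iff (pow_ne_zero _ hφ) (pow_ne_zero _ hφ)]
      simp only [RingHom.coe_coe, map_pow] at e
      linear_combination e
    have fA : ∀ x : A, f (algebraMap A B x) = φ x := by
      intro x
      rw [key _ 0 (C x) (by simp)]
      simp
    have fadd : ∀ b c, f (b + c) = f b + f c := by
      intro b c
      rw [key (b + c) (N b + N c) (C (a ^ N c) * G b + C (a ^ N b) * G c) (by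
        rw [map_add, map_mul, map_mul, ← hG, ← hG, aeval_C, aeval_C, map_pow, map_pow]; ring)]
      simp only [f, Polynomial.map_add, Polynomial.map_mul, Polynomial.map_C, eval_mul, eval_C,
        eval_add, RingHom.coe_coe, map_pow, Polynomial.map_pow, eval_pow]
      field_simp
      ring
    have fmul : ∀ b c, f (b * c) = f b * f c := by
      intro b c
      rw [key (b * c) (N b + N c) (G b * G c) (by
        rw [map_mul, ← hG, ← hG]; ring)]
      simp only [f, Polynomial.map_mul, eval_mul]
      field_simp
      ring
    let ψ : B →ₐ[K] K :=
      { toFun := f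
        map_one' := by simpa using fA 1
        map_zero' := by simpa using fA 0
        map_add' := fadd
        map_mul' := fmul
        commutes' := fun r => by
          rw [IsScalarTower.algebraMap_apply K A B, fA, φ.commutes] }
    refine ⟨ψ, fA, ?_⟩
    change f θ = t
    rw [key θ 0 X (by simp)]
    simp

open Polynomial in
theorem _root_.lemB {K A B : Type} [Field K] [IsAlgClosed K] [CommRing A] [IsDomain A] [CommRing B]
    [IsDomain B] [Algebra K A] [Algebra K B] [Algebra A B] [IsScalarTower K A B]
    [hfin : Algebra.FiniteType K B] (k l : Type)
    [Field k] [Field l] [CharZero k]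
    [Algebra A k] [IsFractionRing A k] [Algebra B l] [IsFractionRing B l]
    [Algebra k l] [Algebra A l] [IsScalarTower A k l] [IsScalarTower A B l]
    [FiniteDimensional k l] :
    ∃ a : A, a ≠ 0 ∧ ∀ φ : A →ₐ[K] K, φ a ≠ 0 →
      {ψ : B →ₐ[K] K | ∀ x, ψ (algebraMap A B x) = φ x}.ncard = Module.finrank k l := by
  obtain ⟨θ, F, hFm, hF, hdeg, htop⟩ := lemB_theta (A := A) (B := B) (k := k) (l := l)
  set β := algebraMap B l θ with hβ
  have hBl := IsFractionRing.injective B l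
  have hAk := IsFractionRing.injective A k
  have hav : ∀ G : A[X], algebraMap B l (aeval θ G) = aeval β (G.map (algebraMap A k)) := by
    intro G
    rw [aeval_map_algebraMap, hβ, aeval_algebraMap_apply]
  have hFθ : aeval θ F = 0 := by
    apply hBl
    rw [hav, hF, minpoly.aeval, map_zero]
  have hker : ∀ G : A[X], aeval θ G = 0 → F ∣ G := by
    intro G hG
    have h1 : minpoly k β ∣ G.map (algebraMap A k) := by
      apply minpoly.dvd
      rw [← hav, hG, map_zero]
    rw [← hF] at h1
    exact (map_dvd_map _ hAk hFm).1 h1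
  -- Bezout
  obtain ⟨a3, ha3, U, V, hUV⟩ : ∃ a3 : A, a3 ≠ 0 ∧ ∃ U V : A[X],
      U * F + V * derivative F = C a3 := by
    have hsep : (minpoly k β).Separable := Algebra.IsSeparable.isSeparable k β
    obtain ⟨u, v, huv⟩ := hsep
    obtain ⟨b1, hb1, e1⟩ := IsLocalization.integerNormalization_spec (nonZeroDivisors A) u
    obtain ⟨b2, hb2, e2⟩ := IsLocalization.integerNormalization_spec (nonZeroDivisors A) v
    refine ⟨b1 * b2, mul_ne_zero (nonZeroDivisors.ne_zero hb1) (nonZeroDivisors.ne_zero hb2), C b2 * IsLocalization.integerNormalization (nonZeroDivisors A) u,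
      C b1 * IsLocalization.integerNormalization (nonZeroDivisors A) v, ?_⟩
    apply Polynomial.map_injective _ hAk
    simp only [Polynomial.map_add, Polynomial.map_mul, Polynomial.map_C, ← derivative_map, e1, e2, hF]
    simp only [map_mul, Algebra.smul_def, Polynomial.algebraMap_apply]
    linear_combination (C ((algebraMap A k) b1) * C ((algebraMap A k) b2)) * huv
  have hb : ∀ b : B, ∃ c : A, c ≠ 0 ∧ ∃ G : A[X], algebraMap A B c * b = aeval θ G := by
    intro b
    have h1 : algebraMap B l b ∈ IntermediateField.adjoin k {β} := by rw [htop]; trivial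
    rw [← IntermediateField.mem_toSubalgebra,
      IntermediateField.adjoin_simple_toSubalgebra_of_isAlgebraic
        (Algebra.IsAlgebraic.isAlgebraic β), Algebra.adjoin_singleton_eq_range_aeval] at h1
    obtain ⟨g, hg⟩ := h1
    obtain ⟨b1, hb1, e1⟩ := IsLocalization.integerNormalization_spec (nonZeroDivisors A) g
    refine ⟨b1, nonZeroDivisors.ne_zero hb1, IsLocalization.integerNormalization (nonZeroDivisors A) g, ?_⟩
    apply hBl
    rw [hav, e1, map_mul, ← hg]
    rw [← IsScalarTower.algebraMap_apply]
    change _ * aeval β g = _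
    rw [← algebraMap_smul k b1 g, map_smul, Algebra.smul_def, ← IsScalarTower.algebraMap_apply]
  classical
  obtain ⟨s, hs⟩ := hfin.out
  choose c hc G hG using hb
  set a2 := ∏ b ∈ s, c b with ha2
  refine ⟨a2 * a3, mul_ne_zero (Finset.prod_ne_zero_iff.2 fun b _ => hc b) ha3, fun φ hφ => ?_⟩
  rw [← hdeg]
  refine lemB_core θ F hFm (a2 * a3) (C a2 * U) (C a2 * V) ?_ hker hFθ ?_ φ hφ
  · rw [C_mul, ← hUV]; ring
  intro b
  have hbt : b ∈ Algebra.adjoin K (s : Set B) := by rw [hs]; trivial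
  induction hbt using Algebra.adjoin_induction with
  | mem x hx =>
    refine ⟨1, C a3 * C (∏ b ∈ s.erase x, c b) * G x, ?_⟩
    rw [map_mul (aeval θ), map_mul (aeval θ), ← hG, aeval_C, aeval_C, pow_one, ha2,
      ← Finset.mul_prod_erase s c hx, map_mul, map_mul]
    ring
  | algebraMap r =>
    exact ⟨0, C (algebraMap K A r), by rw [aeval_C, ← IsScalarTower.algebraMap_apply]; simp⟩
  | add x y _ _ hx hy =>
    obtain ⟨N, G, h⟩ := hx
    obtain ⟨M, H, h'⟩ := hy
    refine ⟨N + M, C ((a2 * a3) ^ M) * G + C ((a2 * a3) ^ N) * H, ?_⟩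
    simp only [map_add, map_mul (aeval θ), ← h, ← h', aeval_C, map_pow]; ring
  | mul x y _ _ hx hy =>
    obtain ⟨N, G, h⟩ := hx
    obtain ⟨M, H, h'⟩ := hy
    refine ⟨N + M, G * H, ?_⟩
    rw [map_mul (aeval θ), ← h, ← h']; ring
end Polynomial

section
open IntermediateField IntermediateField.algebraAdjoinAdjoin

theorem adjoin_field_le {K M : Type} [Field K] [Field M] [Algebra K M] {S T : Set M}
    (hST : S ⊆ Algebra.adjoin K T) : IntermediateField.adjoin K S ≤ IntermediateField.adjoin K T := by
  rw [IntermediateField.adjoin_le_iff]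
  exact fun x hx => IntermediateField.algebra_adjoin_le_adjoin K T (hST hx)

theorem lemB_sub {K M : Type} [Field K] [IsAlgClosed K] [CharZero K] [Field M] [Algebra K M]
    (S T : Set M) (hT : T.Finite) (hST : S ⊆ Algebra.adjoin K T)
    (hpos : 0 < relfinrank (IntermediateField.adjoin K S) (IntermediateField.adjoin K T)) :
    ∃ a : Algebra.adjoin K S, a ≠ 0 ∧ ∀ φ : Algebra.adjoin K S →ₐ[K] K, φ a ≠ 0 →
      {ψ : Algebra.adjoin K T →ₐ[K] K | ∀ x : Algebra.adjoin K S,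
        ψ (Subalgebra.inclusion (Algebra.adjoin_le hST) x) = φ x}.ncard =
      relfinrank (IntermediateField.adjoin K S) (IntermediateField.adjoin K T) := by
  have hle := adjoin_field_le hST
  have hfg : Algebra.FiniteType K (Algebra.adjoin K T) :=
    (Subalgebra.fg_iff_finiteType _).1 ⟨hT.toFinset, by simp⟩
  let i1 : Algebra (Algebra.adjoin K S) (Algebra.adjoin K T) :=
    (Subalgebra.inclusion (Algebra.adjoin_le hST)).toRingHom.toAlgebra
  let i2 : Algebra (IntermediateField.adjoin K S) (IntermediateField.adjoin K T) :=
    (IntermediateField.inclusion hle).toRingHom.toAlgebra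
  let i3 : Algebra (Algebra.adjoin K S) (IntermediateField.adjoin K T) :=
    ((algebraMap (Algebra.adjoin K T) (IntermediateField.adjoin K T)).comp
      (algebraMap (Algebra.adjoin K S) (Algebra.adjoin K T))).toAlgebra
  have : IsScalarTower K (Algebra.adjoin K S) (Algebra.adjoin K T) := .of_algebraMap_eq' rfl
  have : IsScalarTower (Algebra.adjoin K S) (Algebra.adjoin K T) (IntermediateField.adjoin K T) :=
    .of_algebraMap_eq' rfl
  have : IsScalarTower (Algebra.adjoin K S) (IntermediateField.adjoin K S)
    (IntermediateField.adjoin K T) := .of_algebraMap_eq' rfl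
  have hrel : relfinrank (IntermediateField.adjoin K S) (IntermediateField.adjoin K T) =
      Module.finrank (IntermediateField.adjoin K S) (IntermediateField.adjoin K T) := by
    rw [relfinrank_eq_finrank_of_le hle]
    rfl
  rw [hrel] at hpos ⊢
  have : FiniteDimensional (IntermediateField.adjoin K S) (IntermediateField.adjoin K T) :=
    Module.finite_of_finrank_pos hpos
  have : CharZero (IntermediateField.adjoin K S) := charZero_of_injective_algebraMap (algebraMap K _).injective
  exact lemB (K := K) (A := Algebra.adjoin K S) (B := Algebra.adjoin K T)
    (IntermediateField.adjoin K S) (IntermediateField.adjoin K T)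
end

theorem exists_algHom_ker_eq {K S : Type} [Field K] [IsAlgClosed K] [CommRing S] [Algebra K S]
    [Algebra.FiniteType K S] (m : Ideal S) [hm : m.IsMaximal] :
    ∃ ψ : S →ₐ[K] K, RingHom.ker ψ = m := by
  let : Field (S ⧸ m) := Ideal.Quotient.field m
  have : Module.Finite K (S ⧸ m) := finite_of_finite_type_of_isJacobsonRing K (S ⧸ m)
  have hb : Function.Bijective (algebraMap K (S ⧸ m)) :=
    IsAlgClosed.algebraMap_bijective_of_isIntegral
  let e : K ≃ₐ[K] (S ⧸ m) := AlgEquiv.ofBijective (Algebra.ofId K (S ⧸ m)) hb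
  refine ⟨(e.symm : (S ⧸ m) →ₐ[K] K).comp (Ideal.Quotient.mkₐ K m), ?_⟩
  ext x
  simp [RingHom.mem_ker, Ideal.Quotient.eq_zero_iff_mem]

theorem moduleFinite_of_finite_algHom {K S : Type} [Field K] [IsAlgClosed K] [CommRing S]
    [Algebra K S] [Algebra.FiniteType K S] [Finite (S →ₐ[K] K)] : Module.Finite K S := by
  have hM : Finite (MaximalSpectrum S) := by
    choose f hf using fun m : MaximalSpectrum S =>
      have := m.isMaximal
      exists_algHom_ker_eq (K := K) m.asIdeal
    refine Finite.of_injective f fun m m' h => ?_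
    ext1
    rw [← hf m, ← hf m', h]
  have : IsJacobsonRing S := isJacobsonRing_of_finiteType (A := K)
  have hP : Finite (PrimeSpectrum S) := by
    refine Finite.of_injective
      (fun p : PrimeSpectrum S => {m : MaximalSpectrum S | p.asIdeal ≤ m.asIdeal}) ?_
    have key : ∀ p q : PrimeSpectrum S, {m : MaximalSpectrum S | p.asIdeal ≤ m.asIdeal} =
      {m : MaximalSpectrum S | q.asIdeal ≤ m.asIdeal} → p.asIdeal ≤ q.asIdeal := by
      intro p q h
      have hq := IsJacobsonRing.out ‹IsJacobsonRing S› q.2.isRadical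
      rw [← hq, Ideal.jacobson]
      refine le_sInf fun m hm => ?_
      have : (⟨m, hm.2⟩ : MaximalSpectrum S) ∈ {m : MaximalSpectrum S | p.asIdeal ≤ m.asIdeal} := by
        rw [h]; exact hm.1
      exact this
    intro p q h
    ext1
    exact le_antisymm (key p q h) (key q p h.symm)
  have : Algebra.QuasiFinite K S := by
    rw [Algebra.QuasiFinite.iff_finite_comap_preimage_singleton]
    exact fun x => Set.toFinite _
  exact Module.Finite.of_quasiFinite

theorem lemA_zmt {K A B : Type} [Field K] [IsAlgClosed K] [CommRing A] [CommRing B]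
    [Algebra K A] [Algebra K B] [Algebra A B] [IsScalarTower K A B]
    [Algebra.FiniteType K B] (φ : A →ₐ[K] K)
    (hfin : {ψ : B →ₐ[K] K | ∀ x, ψ (algebraMap A B x) = φ x}.Finite)
    (ψ : B →ₐ[K] K) (hψ : ∀ x, ψ (algebraMap A B x) = φ x) :
    ∃ r : B, ψ r ≠ 0 ∧ ∀ x, ∃ m, IsIntegral A (r ^ m * x) := by
  let p : Ideal B := RingHom.ker ψ
  have hp : p.IsPrime := RingHom.ker_isPrime _
  have : Algebra.FiniteType A B := Algebra.FiniteType.of_restrictScalars_finiteType K A B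
  let J : Ideal B := (p.under A).map (algebraMap A B)
  have hJ : ∀ x : A, φ x = 0 → algebraMap A B x ∈ J := by
    intro x hx
    apply Ideal.mem_map_of_mem
    change ψ (algebraMap A B x) = 0
    rw [hψ, hx]
  have hF : Finite ((B ⧸ J) →ₐ[K] K) := by
    have : Finite {ψ : B →ₐ[K] K | ∀ x, ψ (algebraMap A B x) = φ x} := hfin
    refine Finite.of_injective (fun χ : (B ⧸ J) →ₐ[K] K =>
      (⟨χ.comp (Ideal.Quotient.mkₐ K J), fun x => ?_⟩ :
        {ψ : B →ₐ[K] K | ∀ x, ψ (algebraMap A B x) = φ x})) ?_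
    · have h1 := hJ (x - algebraMap K A (φ x)) (by simp)
      rw [map_sub, ← IsScalarTower.algebraMap_apply] at h1
      have h2 := (Ideal.Quotient.eq (I := J)).2 h1
      simp only [AlgHom.comp_apply, Ideal.Quotient.mkₐ_eq_mk, h2]
      exact χ.commutes _
    · intro χ χ' h
      simp only [Subtype.mk.injEq] at h
      exact AlgHom.cancel_right (Ideal.Quotient.mkₐ_surjective K J) |>.1 h
  have : Module.Finite K (B ⧸ J) := moduleFinite_of_finite_algHom
  have : IsScalarTower K A (B ⧸ J) := .of_algebraMap_eq fun x => by
    rw [IsScalarTower.algebraMap_apply K B (B ⧸ J), IsScalarTower.algebraMap_apply K A B]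
    rfl
  have : Module.Finite A (B ⧸ J) := Module.Finite.of_restrictScalars_finite K A (B ⧸ J)
  have hw : Algebra.WeaklyQuasiFiniteAt A p := by
    unfold Algebra.WeaklyQuasiFiniteAt Algebra.QuasiFiniteAt
    infer_instance
  have hz := Algebra.ZariskisMainProperty.of_finiteType_of_weaklyQuasiFiniteAt (R := A) p
  rw [Algebra.zariskisMainProperty_iff'] at hz
  exact hz

theorem lemA_isAlgebraic {K A B : Type} [Field K] [IsAlgClosed K] [CommRing A] [IsDomain A]
    [CommRing B] [IsDomain B]
    [Algebra K A] [Algebra K B] [Algebra A B] [IsScalarTower K A B]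
    [Algebra.FiniteType K B] (φ : A →ₐ[K] K)
    (hfin : {ψ : B →ₐ[K] K | ∀ x, ψ (algebraMap A B x) = φ x}.Finite)
    (hne : {ψ : B →ₐ[K] K | ∀ x, ψ (algebraMap A B x) = φ x}.Nonempty) :
    Algebra.IsAlgebraic A B := by
  obtain ⟨ψ, hψ⟩ := hne
  obtain ⟨r, hr, H⟩ := lemA_zmt φ hfin ψ hψ
  have hr0 : r ≠ 0 := by rintro rfl; simp at hr
  refine ⟨fun x => ?_⟩
  obtain ⟨m, hm⟩ := H x
  obtain ⟨m3, hm3⟩ := H r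
  have hr' : IsIntegral A r := by
    rw [← pow_succ] at hm3
    exact (IsIntegral.pow_iff (by simp)).mp hm3
  exact (hr'.pow m).isAlgebraic.of_mul (mem_nonZeroDivisors_of_ne_zero (pow_ne_zero _ hr0))
    hm.isAlgebraic

open Polynomial in
theorem lemA_bound {K A B : Type} [Field K] [IsAlgClosed K] [CommRing A] [IsDomain A]
    [IsIntegrallyClosed A] [CommRing B] [IsDomain B]
    [Algebra K A] [Algebra K B] [Algebra A B] [IsScalarTower K A B]
    [Algebra.FiniteType K B] (k l : Type) [Field k] [Field l]
    [Algebra A k] [IsFractionRing A k] [Algebra B l] [IsFractionRing B l]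
    [Algebra k l] [Algebra A l] [IsScalarTower A k l] [IsScalarTower A B l]
    [FiniteDimensional k l] (φ : A →ₐ[K] K)
    (hfin : {ψ : B →ₐ[K] K | ∀ x, ψ (algebraMap A B x) = φ x}.Finite) :
    {ψ : B →ₐ[K] K | ∀ x, ψ (algebraMap A B x) = φ x}.ncard ≤ Module.finrank k l := by
  classical
  set X := {ψ : B →ₐ[K] K | ∀ x, ψ (algebraMap A B x) = φ x} with hX
  have hAl : Function.Injective (algebraMap A l) := by
    rw [IsScalarTower.algebraMap_eq A k l]
    exact (algebraMap k l).injective.comp (IsFractionRing.injective A k)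
  have hAB : Function.Injective (algebraMap A B) := by
    rw [IsScalarTower.algebraMap_eq A B l] at hAl
    exact Function.Injective.of_comp hAl
  have : FaithfulSMul A B := (faithfulSMul_iff_algebraMap_injective _ _).2 hAB
  -- an integral element separating the points
  obtain ⟨z, hz, hinj⟩ : ∃ z : B, IsIntegral A z ∧ Set.InjOn (fun ψ : B →ₐ[K] K => ψ z) X := by
    let W : Submodule K B := ((integralClosure A B).restrictScalars K).toSubmodule
    let V : (B →ₐ[K] K) × (B →ₐ[K] K) → Submodule K W := fun q =>
      LinearMap.ker ((q.1.toLinearMap - q.2.toLinearMap).comp W.subtype)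
    let P : Set ((B →ₐ[K] K) × (B →ₐ[K] K)) := (X ×ˢ X) ∩ {q | q.1 ≠ q.2}
    have hPf : P.Finite := (hfin.prod hfin).subset Set.inter_subset_left
    have htop : ∀ q ∈ P, V q ≠ ⊤ := by
      rintro ⟨ψ, ψ'⟩ ⟨⟨h1, h2⟩, h3⟩ ht
      have hall : ∀ b : B, IsIntegral A b → ψ b = ψ' b := by
        intro b hb
        have : (⟨b, hb⟩ : W) ∈ V (ψ, ψ') := by rw [ht]; trivial
        simpa [V, sub_eq_zero] using this
      obtain ⟨r, hr, H⟩ := lemA_zmt φ hfin ψ h1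
      have hr' : IsIntegral A r := by
        obtain ⟨m3, hm3⟩ := H r
        rw [← pow_succ] at hm3
        exact (IsIntegral.pow_iff (by simp)).mp hm3
      apply h3
      ext b
      obtain ⟨m, hm⟩ := H b
      have e := hall _ hm
      rw [map_mul, map_mul, map_pow, map_pow, ← hall r hr'] at e
      exact mul_left_cancel₀ (pow_ne_zero _ hr) e
    have hne := Subspace.biUnion_ne_univ_of_top_notMem (s := hPf.toFinset.image V) (by
      classical
      simp only [Finset.mem_image, Set.Finite.mem_toFinset, not_exists, not_and]
      exact htop)
    obtain ⟨z, hz⟩ := (Set.ne_univ_iff_exists_notMem _).1 hne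
    refine ⟨z, z.2, fun ψ h1 ψ' h2 h => ?_⟩
    by_contra h3
    apply hz
    simp only [Set.mem_iUnion]
    refine ⟨V (ψ, ψ'), Finset.mem_image_of_mem _ (hPf.mem_toFinset.2 ⟨⟨h1, h2⟩, h3⟩), ?_⟩
    simpa [V, sub_eq_zero] using h
  have hmin := minpoly.isIntegrallyClosed_eq_field_fractions k l hz
  have hdeg : (minpoly A z).natDegree ≤ Module.finrank k l := by
    rw [← (minpoly.monic hz).natDegree_map (algebraMap A k), ← hmin]
    exact minpoly.natDegree_le _
  refine le_trans ?_ hdeg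
  rw [← hinj.ncard_image, ← (minpoly.monic hz).natDegree_map (φ : A →+* K)]
  set q := (minpoly A z).map (φ : A →+* K) with hq
  have hq0 : q ≠ 0 := ((minpoly.monic hz).map _).ne_zero
  refine le_trans ?_ (Polynomial.card_roots' q)
  refine le_trans ?_ (Multiset.toFinset_card_le q.roots)
  rw [← Set.ncard_coe_finset]
  refine Set.ncard_le_ncard ?_ (Finset.finite_toSet _)
  rintro _ ⟨ψ, hψ, rfl⟩
  rw [Finset.mem_coe, Multiset.mem_toFinset, Polynomial.mem_roots hq0, Polynomial.IsRoot.def,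
    hq, Polynomial.eval_map]
  have h1 := congrArg ψ (minpoly.aeval A z)
  rw [Polynomial.aeval_def, ← AlgHom.coe_toRingHom, Polynomial.hom_eval₂] at h1
  have h2 : (ψ : B →+* K).comp (algebraMap A B) = (φ : A →+* K) := by
    ext x; exact hψ x
  rw [← h2]
  simpa using h1

section
open IntermediateField IntermediateField.algebraAdjoinAdjoin

theorem lemA_ind {K M : Type} [Field K] [IsAlgClosed K] [Field M] [Algebra K M]
    {d : ℕ} (u : Fin d → M) (S : Set M) (hS : S = Set.range u) (T : Set M) (hT : T.Finite)
    (hST : S ⊆ Algebra.adjoin K T)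
    (htr : Algebra.trdeg K (Algebra.adjoin K T) = d)
    (φ : Algebra.adjoin K S →ₐ[K] K)
    (hfin : {ψ : Algebra.adjoin K T →ₐ[K] K | ∀ x : Algebra.adjoin K S,
        ψ (Subalgebra.inclusion (Algebra.adjoin_le hST) x) = φ x}.Finite)
    (hne : {ψ : Algebra.adjoin K T →ₐ[K] K | ∀ x : Algebra.adjoin K S,
        ψ (Subalgebra.inclusion (Algebra.adjoin_le hST) x) = φ x}.Nonempty) :
    AlgebraicIndependent K u := by
  have hfg : Algebra.FiniteType K (Algebra.adjoin K T) :=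
    (Subalgebra.fg_iff_finiteType _).1 ⟨hT.toFinset, by simp⟩
  let i1 : Algebra (Algebra.adjoin K S) (Algebra.adjoin K T) :=
    (Subalgebra.inclusion (Algebra.adjoin_le hST)).toRingHom.toAlgebra
  have : IsScalarTower K (Algebra.adjoin K S) (Algebra.adjoin K T) := .of_algebraMap_eq' rfl
  have halg : Algebra.IsAlgebraic (Algebra.adjoin K S) (Algebra.adjoin K T) :=
    lemA_isAlgebraic (K := K) φ hfin hne
  have hf : FaithfulSMul (Algebra.adjoin K S) (Algebra.adjoin K T) :=
    (faithfulSMul_iff_algebraMap_injective _ _).2 (Subalgebra.inclusion_injective _)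
  have h1 := trdeg_add_eq (R := K) (S := Algebra.adjoin K S) (A := Algebra.adjoin K T)
  rw [trdeg_eq_zero (A := Algebra.adjoin K T), add_zero, htr] at h1
  let u' : Fin d → Algebra.adjoin K S := fun i => ⟨u i, Algebra.subset_adjoin (hS ▸ ⟨i, rfl⟩)⟩
  have htop : Algebra.adjoin K (Set.range u') = ⊤ := by
    have := Algebra.adjoin_adjoin_coe_preimage (R := K) (s := S)
    rw [← this]
    congr 1
    ext x
    simp [u', hS, Subtype.ext_iff]
  have : Algebra.IsAlgebraic (Algebra.adjoin K (Set.range u')) (Algebra.adjoin K S) := by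
    refine ⟨fun x => ?_⟩
    have hx : x ∈ Algebra.adjoin K (Set.range u') := by rw [htop]; trivial
    exact isAlgebraic_algebraMap (⟨x, hx⟩ : Algebra.adjoin K (Set.range u'))
  have h2 := Algebra.IsAlgebraic.isTranscendenceBasis_of_le_trdeg_of_finite (R := K) u' (by simp [h1])
  exact h2.1.map' (f := (Algebra.adjoin K S).val) Subtype.val_injective

theorem lemA_sub {K M : Type} [Field K] [IsAlgClosed K] [CharZero K] [Field M] [Algebra K M]
    {d : ℕ} (u : Fin d → M) (S : Set M) (hS : S = Set.range u) (T : Set M) (hT : T.Finite) (hST : S ⊆ Algebra.adjoin K T)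
    (htr : Algebra.trdeg K (Algebra.adjoin K T) = d)
    (φ : Algebra.adjoin K (S) →ₐ[K] K)
    (hfin : {ψ : Algebra.adjoin K T →ₐ[K] K | ∀ x : Algebra.adjoin K (S),
        ψ (Subalgebra.inclusion (Algebra.adjoin_le hST) x) = φ x}.Finite) :
      {ψ : Algebra.adjoin K T →ₐ[K] K | ∀ x : Algebra.adjoin K (S),
        ψ (Subalgebra.inclusion (Algebra.adjoin_le hST) x) = φ x}.ncard ≤
      relfinrank (IntermediateField.adjoin K (S)) (IntermediateField.adjoin K T) := by
  rcases Set.eq_empty_or_nonempty {ψ : Algebra.adjoin K T →ₐ[K] K |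
    ∀ x : Algebra.adjoin K (S),
        ψ (Subalgebra.inclusion (Algebra.adjoin_le hST) x) = φ x} with he | hne
  · rw [he]; simp
  have hle := adjoin_field_le hST
  have hfg : Algebra.FiniteType K (Algebra.adjoin K T) :=
    (Subalgebra.fg_iff_finiteType _).1 ⟨hT.toFinset, by simp⟩
  let i1 : Algebra (Algebra.adjoin K S) (Algebra.adjoin K T) :=
    (Subalgebra.inclusion (Algebra.adjoin_le hST)).toRingHom.toAlgebra
  let i2 : Algebra (IntermediateField.adjoin K S) (IntermediateField.adjoin K T) :=
    (IntermediateField.inclusion hle).toRingHom.toAlgebra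
  let i3 : Algebra (Algebra.adjoin K S) (IntermediateField.adjoin K T) :=
    ((algebraMap (Algebra.adjoin K T) (IntermediateField.adjoin K T)).comp
      (algebraMap (Algebra.adjoin K S) (Algebra.adjoin K T))).toAlgebra
  have : IsScalarTower K (Algebra.adjoin K S) (Algebra.adjoin K T) := .of_algebraMap_eq' rfl
  have : IsScalarTower (Algebra.adjoin K S) (Algebra.adjoin K T) (IntermediateField.adjoin K T) :=
    .of_algebraMap_eq' rfl
  have : IsScalarTower (Algebra.adjoin K S) (IntermediateField.adjoin K S)
    (IntermediateField.adjoin K T) := .of_algebraMap_eq' rfl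
  have hrel : relfinrank (IntermediateField.adjoin K S) (IntermediateField.adjoin K T) =
      Module.finrank (IntermediateField.adjoin K S) (IntermediateField.adjoin K T) := by
    rw [relfinrank_eq_finrank_of_le hle]
    rfl
  rw [hrel]
  have halg : Algebra.IsAlgebraic (Algebra.adjoin K S) (Algebra.adjoin K T) :=
    lemA_isAlgebraic (K := K) φ hfin hne
  have hind : AlgebraicIndependent K u := lemA_ind u S hS T hT hST htr φ hfin hne
  have : IsIntegrallyClosed (Algebra.adjoin K S) :=
    hS ▸ IsIntegrallyClosed.of_equiv hind.aevalEquiv.toRingEquiv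
  have hl : Algebra.IsAlgebraic (IntermediateField.adjoin K S) (IntermediateField.adjoin K T) := by
    rw [← IsFractionRing.comap_isAlgebraic_iff (A := Algebra.adjoin K S)]
    have : Algebra.IsAlgebraic (Algebra.adjoin K T) (IntermediateField.adjoin K T) := inferInstance
    have : FaithfulSMul (Algebra.adjoin K S) (Algebra.adjoin K T) :=
      (faithfulSMul_iff_algebraMap_injective _ _).2 (Subalgebra.inclusion_injective _)
    exact Algebra.IsAlgebraic.trans (Algebra.adjoin K S) (Algebra.adjoin K T) _
  have : FiniteDimensional (IntermediateField.adjoin K S) (IntermediateField.adjoin K T) := by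
    have : IsScalarTower K (IntermediateField.adjoin K S) (IntermediateField.adjoin K T) :=
      .of_algebraMap_eq' rfl
    have e0 : Algebra.EssFiniteType (Algebra.adjoin K T) (IntermediateField.adjoin K T) :=
      Algebra.EssFiniteType.of_isLocalization _ (nonZeroDivisors (Algebra.adjoin K T))
    have e1 : Algebra.EssFiniteType K (IntermediateField.adjoin K T) :=
      Algebra.EssFiniteType.comp K (Algebra.adjoin K T) _
    have e2 : Algebra.EssFiniteType (IntermediateField.adjoin K S) (IntermediateField.adjoin K T) :=
      Algebra.EssFiniteType.of_comp K _ _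
    obtain ⟨s, hs⟩ := IntermediateField.fg_top (IntermediateField.adjoin K S) (IntermediateField.adjoin K T)
    have := IntermediateField.finiteDimensional_adjoin (K := IntermediateField.adjoin K S)
      (S := (s : Set (IntermediateField.adjoin K T))) fun x _ => hl.isIntegral.isIntegral x
    rw [hs] at this
    exact Module.Finite.equiv (IntermediateField.topEquiv (F := IntermediateField.adjoin K S)
      (E := IntermediateField.adjoin K T)).toLinearEquiv
  exact lemA_bound (K := K) (A := Algebra.adjoin K S) (B := Algebra.adjoin K T)
    (IntermediateField.adjoin K S) (IntermediateField.adjoin K T) φ hfin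
end

set_option linter.unusedSectionVars false

section ThmG
variable {K M : Type} [Field K] [IsAlgClosed K] [CharZero K] [Field M] [Algebra K M] {N : ℕ}

/-- the coordinate-ring isomorphism -/
noncomputable def coordEquiv (ξ : Fin N → M) (I : Ideal (MvPolynomial (Fin N) K))
    (hI : I = RingHom.ker (aeval ξ : MvPolynomial (Fin N) K →ₐ[K] M)) :
    (MvPolynomial (Fin N) K ⧸ I) ≃ₐ[K] Algebra.adjoin K (Set.range ξ) :=
  (Ideal.quotientEquivAlgOfEq K hI).trans
    ((Ideal.quotientKerEquivRange (aeval ξ : MvPolynomial (Fin N) K →ₐ[K] M)).trans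
      (Subalgebra.equivOfEq _ _ (Algebra.adjoin_range_eq_range_aeval K ξ).symm))

theorem coordEquiv_mk (ξ : Fin N → M) (I : Ideal (MvPolynomial (Fin N) K))
    (hI : I = RingHom.ker (aeval ξ : MvPolynomial (Fin N) K →ₐ[K] M)) (f : MvPolynomial (Fin N) K) :
    (coordEquiv ξ I hI (Ideal.Quotient.mk I f) : M) = aeval ξ f := rfl

/-- point attached to a homomorphism -/
def ptOf (ξ : Fin N → M) (ψ : Algebra.adjoin K (Set.range ξ) →ₐ[K] K) : Fin N → K :=
  fun i => ψ ⟨ξ i, Algebra.subset_adjoin ⟨i, rfl⟩⟩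

theorem ptOf_aeval (ξ : Fin N → M) (ψ : Algebra.adjoin K (Set.range ξ) →ₐ[K] K)
    (f : MvPolynomial (Fin N) K) (hf : aeval ξ f ∈ Algebra.adjoin K (Set.range ξ)) :
    ψ ⟨aeval ξ f, hf⟩ = aeval (ptOf ξ ψ) f := by
  have h : (⟨aeval ξ f, hf⟩ : Algebra.adjoin K (Set.range ξ)) =
      aeval (fun i => (⟨ξ i, Algebra.subset_adjoin ⟨i, rfl⟩⟩ : Algebra.adjoin K (Set.range ξ))) f := by
    ext
    change _ = (Algebra.adjoin K (Set.range ξ)).val _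
    rw [← AlgHom.comp_apply, comp_aeval]
    rfl
  rw [h, ← AlgHom.comp_apply, comp_aeval]
  rfl

theorem ptOf_injective (ξ : Fin N → M) :
    Function.Injective (ptOf (K := K) ξ) := by
  intro ψ ψ' h
  ext ⟨x, hx⟩
  have hx' := hx
  rw [Algebra.adjoin_range_eq_range_aeval] at hx'
  obtain ⟨f, rfl⟩ := hx'
  exact (ptOf_aeval ξ ψ f hx).trans (h ▸ (ptOf_aeval ξ ψ' f hx).symm)

theorem range_ptOf (W : Set (Fin N → K)) (ξ : Fin N → M)
    (hW : zeroLocus K (vanishingIdeal K W) = W)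
    (hI : vanishingIdeal K W = RingHom.ker (aeval ξ : MvPolynomial (Fin N) K →ₐ[K] M)) :
    Set.range (ptOf (K := K) ξ) = W := by
  apply Set.Subset.antisymm
  · rintro _ ⟨ψ, rfl⟩
    rw [← hW, mem_zeroLocus_iff]
    intro f hf
    rw [hI] at hf
    have h0 : aeval ξ f = 0 := hf
    have h := ptOf_aeval ξ ψ f (by rw [h0]; exact zero_mem _)
    rw [← h]
    have : (⟨aeval ξ f, by rw [h0]; exact zero_mem _⟩ : Algebra.adjoin K (Set.range ξ)) = 0 :=
      Subtype.ext h0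
    rw [this, map_zero]
  · intro p hp
    let e := coordEquiv ξ _ hI
    let χ : (MvPolynomial (Fin N) K ⧸ vanishingIdeal K W) →ₐ[K] K :=
      Ideal.Quotient.liftₐ _ (aeval p) (fun f hf => by
        rw [mem_vanishingIdeal_iff] at hf
        exact hf p hp)
    refine ⟨χ.comp (e.symm : _ →ₐ[K] _), ?_⟩
    ext i
    have h1 : (⟨ξ i, Algebra.subset_adjoin ⟨i, rfl⟩⟩ : Algebra.adjoin K (Set.range ξ)) =
        e (Ideal.Quotient.mk _ (X i)) := by
      ext
      change _ = aeval ξ (X i)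
      simp
    change χ (e.symm ⟨ξ i, Algebra.subset_adjoin ⟨i, rfl⟩⟩) = _
    rw [h1, AlgEquiv.symm_apply_apply]
    change (aeval p : MvPolynomial (Fin N) K →ₐ[K] K) (X i) = _
    rw [aeval_X]

theorem varDim_eq (W : Set (Fin N → K)) (ξ : Fin N → M)
    (hI : vanishingIdeal K W = RingHom.ker (aeval ξ : MvPolynomial (Fin N) K →ₐ[K] M)) {d : ℕ}
    (htr : Algebra.trdeg K (Algebra.adjoin K (Set.range ξ)) = d) : varDim W = d := by
  have hfg : Algebra.FiniteType K (Algebra.adjoin K (Set.range ξ)) :=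
    (Subalgebra.fg_iff_finiteType _).1 ⟨(Set.finite_range ξ).toFinset, by simp⟩
  have h := (ringKrullDim_eq_of_trdeg K (B := Algebra.adjoin K (Set.range ξ))).1 htr
  rw [varDim, ringKrullDim_eq_of_ringEquiv (coordEquiv ξ _ hI).toRingEquiv, h]
  rfl

theorem trdeg_of_varDim (W : Set (Fin N → K)) (ξ : Fin N → M)
    (hI : vanishingIdeal K W = RingHom.ker (aeval ξ : MvPolynomial (Fin N) K →ₐ[K] M)) :
    Algebra.trdeg K (Algebra.adjoin K (Set.range ξ)) = varDim W := by
  have hfg : Algebra.FiniteType K (Algebra.adjoin K (Set.range ξ)) :=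
    (Subalgebra.fg_iff_finiteType _).1 ⟨(Set.finite_range ξ).toFinset, by simp⟩
  have h0 := trdeg_lt_aleph0_of_finiteType (R := K) (S := Algebra.adjoin K (Set.range ξ))
  obtain ⟨d, hd⟩ := Cardinal.lt_aleph0.1 h0
  rw [varDim_eq W ξ hI hd, hd]

/-- linear combination -/
def lc (ξ : Fin N → M) (m : Fin N → K) : M := ∑ i, m i • ξ i

theorem lc_mem (ξ : Fin N → M) (m : Fin N → K) : lc ξ m ∈ Algebra.adjoin K (Set.range ξ) :=
  sum_mem fun i _ => Subalgebra.smul_mem _ (Algebra.subset_adjoin (Set.mem_range_self i)) _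

theorem range_lc_subset {d : ℕ} (ξ : Fin N → M) (ℓ : Fin d → Fin N → K) :
    Set.range (fun j => lc ξ (ℓ j)) ⊆ Algebra.adjoin K (Set.range ξ) := by
  rintro _ ⟨j, rfl⟩
  exact lc_mem ξ _

theorem ptOf_lc (ξ : Fin N → M) (m : Fin N → K) (ψ : Algebra.adjoin K (Set.range ξ) →ₐ[K] K) :
    ψ ⟨lc ξ m, lc_mem ξ m⟩ = ∑ i, m i * ptOf ξ ψ i := by
  have : (⟨lc ξ m, lc_mem ξ m⟩ : Algebra.adjoin K (Set.range ξ)) =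
      ∑ i, m i • (⟨ξ i, Algebra.subset_adjoin ⟨i, rfl⟩⟩ : Algebra.adjoin K (Set.range ξ)) := by
    ext
    simp [lc]
  rw [this, map_sum]
  exact Finset.sum_congr rfl fun i _ => by rw [map_smul, smul_eq_mul]; rfl

/-- The fibre of homomorphisms in terms of points. -/
theorem fibre_eq {d : ℕ} (W : Set (Fin N → K)) (ξ : Fin N → M)
    (hW : zeroLocus K (vanishingIdeal K W) = W)
    (hI : vanishingIdeal K W = RingHom.ker (aeval ξ : MvPolynomial (Fin N) K →ₐ[K] M))
    (ℓ : Fin d → Fin N → K)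
    (φ : Algebra.adjoin K (Set.range (fun j => lc ξ (ℓ j))) →ₐ[K] K) :
    ptOf ξ '' {ψ : Algebra.adjoin K (Set.range ξ) →ₐ[K] K |
        ∀ x : Algebra.adjoin K (Set.range (fun j => lc ξ (ℓ j))),
        ψ (Subalgebra.inclusion (Algebra.adjoin_le (range_lc_subset ξ ℓ)) x) = φ x} =
      W ∩ {p | ∀ j, ∑ i, ℓ j i * p i =
        φ ⟨lc ξ (ℓ j), Algebra.subset_adjoin ⟨j, rfl⟩⟩} := by
  ext p
  constructor
  · rintro ⟨ψ, hψ, rfl⟩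
    refine ⟨?_, fun j => ?_⟩
    · rw [← range_ptOf W ξ hW hI]; exact ⟨ψ, rfl⟩
    · rw [← ptOf_lc, ← hψ]; rfl
  · rintro ⟨hp, hj⟩
    rw [← range_ptOf W ξ hW hI] at hp
    obtain ⟨ψ, rfl⟩ := hp
    refine ⟨ψ, fun x => ?_, rfl⟩
    have h : (ψ.comp (Subalgebra.inclusion (Algebra.adjoin_le (range_lc_subset ξ ℓ)))) = φ := by
      refine AlgHom.adjoin_ext fun y hy => ?_
      obtain ⟨j, rfl⟩ := hy
      have := hj j
      rw [← ptOf_lc] at this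
      exact this
    rw [← h]; rfl


theorem exists_algHom_ne_zero (S : Type) [CommRing S] [IsDomain S] [Algebra K S]
    [Algebra.FiniteType K S] (a : S) (ha : a ≠ 0) : ∃ φ : S →ₐ[K] K, φ a ≠ 0 := by
  have hJ : IsJacobsonRing S := isJacobsonRing_of_finiteType (A := K)
  have h0 : (⊥ : Ideal S).jacobson = ⊥ :=
    IsJacobsonRing.out hJ (Ideal.isPrime_bot.isRadical)
  have h1 : a ∉ (⊥ : Ideal S).jacobson := by rw [h0]; simpa using ha
  rw [Ideal.jacobson, Ideal.mem_sInf] at h1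
  push Not at h1
  obtain ⟨m, ⟨-, hm⟩, ham⟩ := h1
  obtain ⟨ψ, hψ⟩ := exists_algHom_ker_eq (K := K) m
  exact ⟨ψ, fun h => ham (hψ ▸ h)⟩

theorem exists_funcs (V : Submodule K (Fin N → K)) {d : ℕ} (hd : d ≤ N)
    (hV : Module.finrank K V = N - d) :
    ∃ ℓ : Fin d → Fin N → K, ∀ p, p ∈ V ↔ ∀ j, ∑ i, ℓ j i * p i = 0 := by
  have h1 : Module.finrank K ((Fin N → K) ⧸ V) = d := by
    have := Submodule.finrank_quotient_add_finrank V
    rw [Module.finrank_fin_fun] at this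
    omega
  let e := (Module.finBasisOfFinrankEq K _ h1).equivFun
  refine ⟨fun j i => e (V.mkQ (Pi.single i 1)) j, fun p => ?_⟩
  have h2 : ∀ j, ∑ i, e (V.mkQ (Pi.single i 1)) j * p i = e (V.mkQ p) j := by
    intro j
    conv_rhs => rw [← Finset.univ_sum_single p]
    rw [map_sum, map_sum, Finset.sum_apply]
    refine Finset.sum_congr rfl fun i _ => ?_
    have : (Pi.single i (p i) : Fin N → K) = p i • Pi.single i 1 := by
      rw [← Pi.single_smul]; simp
    rw [this, map_smul, map_smul, Pi.smul_apply, smul_eq_mul, mul_comm]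
  simp only [h2]
  rw [← Submodule.Quotient.mk_eq_zero V, ← e.map_eq_zero_iff, funext_iff]
  rfl

theorem finrank_of_linInd {d : ℕ} (ℓ : Fin d → Fin N → K) (h : LinearIndependent K ℓ)
    (V : Submodule K (Fin N → K)) (hV : ∀ p, p ∈ V ↔ ∀ j, ∑ i, ℓ j i * p i = 0) :
    Module.finrank K V = N - d := by
  have h1 : V = LinearMap.ker (Matrix.mulVecLin (Matrix.of ℓ)) := by
    ext p
    rw [hV, LinearMap.mem_ker, funext_iff]
    rfl
  have h2 : (Matrix.of ℓ).rank = d := by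
    have := LinearIndependent.rank_matrix (M := Matrix.of ℓ) h
    simpa using this
  have h3 := LinearMap.finrank_range_add_finrank_ker (Matrix.mulVecLin (Matrix.of ℓ))
  rw [← h1, Module.finrank_fin_fun] at h3
  rw [Matrix.rank] at h2
  omega

theorem geomDegree_eq {d : ℕ} (W : Set (Fin N → K)) (ξ : Fin N → M)
    (hW : zeroLocus K (vanishingIdeal K W) = W)
    (hI : vanishingIdeal K W = RingHom.ker (aeval ξ : MvPolynomial (Fin N) K →ₐ[K] M))
    (htr : Algebra.trdeg K (Algebra.adjoin K (Set.range ξ)) = d) (D : ℕ)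
    (hub : ∀ ℓ : Fin d → Fin N → K,
      IntermediateField.relfinrank (IntermediateField.adjoin K (Set.range fun j => lc ξ (ℓ j)))
        (IntermediateField.adjoin K (Set.range ξ)) ≤ D)
    (hat : 0 < D → ∃ ℓ : Fin d → Fin N → K,
      IntermediateField.relfinrank (IntermediateField.adjoin K (Set.range fun j => lc ξ (ℓ j)))
        (IntermediateField.adjoin K (Set.range ξ)) = D) : geomDegree W = D := by
  have hdim : varDim W = d := varDim_eq W ξ hI htr
  have hdN : d ≤ N := by
    have h1 : Algebra.trdeg K (Algebra.adjoin K (Set.range ξ)) ≤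
        Algebra.trdeg K (MvPolynomial (Fin N) K) := by
      let e := coordEquiv (K := K) ξ _ rfl
      exact trdeg_le_of_surjective
        (e.toAlgHom.comp (Ideal.Quotient.mkₐ K _))
        (e.surjective.comp Ideal.Quotient.mk_surjective)
    rw [htr, MvPolynomial.trdeg_of_isDomain] at h1
    simpa using h1
  have hupper : ∀ m ∈ {m | ∃ L : AffineSubspace K (Fin N → K),
      Module.finrank K L.direction = N - varDim W ∧
      (W ∩ (L : Set (Fin N → K))).Finite ∧ (W ∩ (L : Set (Fin N → K))).ncard = m}, m ≤ D := by
    rintro m ⟨L, hL, hfin, rfl⟩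
    rcases Set.eq_empty_or_nonempty (W ∩ (L : Set (Fin N → K))) with h0 | ⟨p0, hp0, hp0L⟩
    · rw [h0]; simp
    rw [hdim] at hL
    obtain ⟨ℓ, hℓ⟩ := exists_funcs L.direction hdN hL
    have hp0' := hp0
    rw [← range_ptOf W ξ hW hI] at hp0'
    obtain ⟨ψ0, hψ0⟩ := hp0'
    let φ := ψ0.comp (Subalgebra.inclusion (Algebra.adjoin_le (range_lc_subset ξ ℓ)))
    have hfe := fibre_eq W ξ hW hI ℓ φ
    have hL' : W ∩ {p | ∀ j, ∑ i, ℓ j i * p i =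
        φ ⟨lc ξ (ℓ j), Algebra.subset_adjoin ⟨j, rfl⟩⟩} = W ∩ L := by
      ext p
      simp only [Set.mem_inter_iff, Set.mem_ofPred_eq]
      refine and_congr_right fun _ => ?_
      have : p ∈ (L : Set (Fin N → K)) ↔ p - p0 ∈ L.direction :=
        (AffineSubspace.vsub_right_mem_direction_iff_mem hp0L p).symm
      rw [this, hℓ]
      refine forall_congr' fun j => ?_
      have h2 : φ ⟨lc ξ (ℓ j), Algebra.subset_adjoin ⟨j, rfl⟩⟩ = ∑ i, ℓ j i * p0 i := by
        rw [← hψ0, ← ptOf_lc]; rfl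
      rw [h2, ← sub_eq_zero, ← Finset.sum_sub_distrib]
      simp [mul_sub]
    rw [hL'] at hfe
    rw [← hfe] at hfin ⊢
    rw [Set.ncard_image_of_injective _ (ptOf_injective ξ)]
    refine le_trans (lemA_sub _ _ rfl _ (Set.finite_range ξ) (range_lc_subset ξ ℓ) htr φ ?_) (hub ℓ)
    exact hfin.of_finite_image (ptOf_injective ξ).injOn
  apply le_antisymm
  · exact csSup_le' hupper
  rcases Nat.eq_zero_or_pos D with h0 | hpos
  · omega
  obtain ⟨ℓ, hℓ⟩ := hat hpos
  refine le_csSup ⟨D, hupper⟩ ?_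
  obtain ⟨a, ha, haφ⟩ := lemB_sub _ _ (Set.finite_range ξ) (range_lc_subset (K := K) ξ ℓ)
    (by rw [hℓ]; exact hpos)
  have hft : Algebra.FiniteType K (Algebra.adjoin K (Set.range fun j => lc ξ (ℓ j))) :=
    (Subalgebra.fg_iff_finiteType _).1 ⟨(Set.finite_range fun j => lc ξ (ℓ j)).toFinset, by simp⟩
  obtain ⟨φ, hφ⟩ := exists_algHom_ne_zero (K := K) _ a ha
  have hcard := haφ φ hφ
  rw [hℓ] at hcard
  have hne := Set.nonempty_of_ncard_ne_zero (by rw [hcard]; omega)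
  have hfin := Set.finite_of_ncard_ne_zero (by rw [hcard]; omega)
  have hind := lemA_ind _ _ rfl _ (Set.finite_range ξ) (range_lc_subset ξ ℓ) htr φ hfin hne
  have hlin : LinearIndependent K ℓ := by
    have h1 := hind.linearIndependent
    let g : (Fin N → K) →ₗ[K] M := Fintype.linearCombination K ξ
    exact LinearIndependent.of_comp g h1
  let V : Submodule K (Fin N → K) := LinearMap.ker (Matrix.mulVecLin (Matrix.of ℓ))
  have hV : ∀ p, p ∈ V ↔ ∀ j, ∑ i, ℓ j i * p i = 0 := fun p => by
    rw [LinearMap.mem_ker, funext_iff]; rfl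
  have hfe := fibre_eq W ξ hW hI ℓ φ
  obtain ⟨ψ0, hψ0⟩ := hne
  have hp0 : ptOf ξ ψ0 ∈ W ∩ {p | ∀ j, ∑ i, ℓ j i * p i =
        φ ⟨lc ξ (ℓ j), Algebra.subset_adjoin ⟨j, rfl⟩⟩} := by
    rw [← hfe]; exact ⟨ψ0, hψ0, rfl⟩
  have hL : W ∩ (AffineSubspace.mk' (ptOf ξ ψ0) V : Set (Fin N → K)) =
      W ∩ {p | ∀ j, ∑ i, ℓ j i * p i =
        φ ⟨lc ξ (ℓ j), Algebra.subset_adjoin ⟨j, rfl⟩⟩} := by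
    ext p
    simp only [Set.mem_inter_iff, Set.mem_ofPred_eq, SetLike.mem_coe, AffineSubspace.mem_mk']
    refine and_congr_right fun _ => ?_
    rw [hV]
    refine forall_congr' fun j => ?_
    rw [← hp0.2 j, ← sub_eq_zero (a := ∑ i, ℓ j i * p i), ← Finset.sum_sub_distrib]
    simp [mul_sub]
  refine ⟨AffineSubspace.mk' (ptOf ξ ψ0) V, ?_, ?_, ?_⟩
  · rw [AffineSubspace.direction_mk', hdim]
    exact finrank_of_linInd ℓ hlin V hV
  · rw [hL, ← hfe]; exact hfin.image _
  · rw [hL, ← hfe, Set.ncard_image_of_injective _ (ptOf_injective ξ), hcard]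

end ThmG

section Places
open WithZero

/-- Two discrete valuations, comparison. -/
theorem val_eq_of_le {F : Type} [Field F] (v w : Valuation F ℤᵐ⁰) (hv : Function.Surjective v)
    (hw : Function.Surjective w) (h : ∀ a, w a ≤ 1 → v a ≤ 1) : v = w := by
  obtain ⟨π, hπ⟩ := hw (exp (-1))
  have hπ0 : π ≠ 0 := by
    rintro rfl
    rw [map_zero] at hπ
    exact exp_ne_zero hπ.symm
  have hunit : ∀ u, w u = 1 → v u = 1 := by
    intro u hu
    apply le_antisymm (h u hu.le)
    have h1 := h u⁻¹ (by rw [map_inv₀, hu, inv_one])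
    have hu0 : u ≠ 0 := by rintro rfl; simp at hu
    have hvu : v u ≠ 0 := (Valuation.ne_zero_iff _).2 hu0
    rw [map_inv₀] at h1
    exact (inv_le_one₀ (zero_lt_iff.2 hvu)).1 h1
  have key : ∀ a, a ≠ 0 → ∃ k : ℤ, w a = exp (-k) ∧ v a = v π ^ k := by
    intro a ha
    have hwa : w a ≠ 0 := (Valuation.ne_zero_iff _).2 ha
    refine ⟨-log (w a), ?_, ?_⟩
    · rw [neg_neg, exp_log hwa]
    · have h2 : w (a * π ^ (log (w a))) = 1 := by
        rw [map_mul, map_zpow₀, hπ, ← exp_zsmul]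
        nth_rewrite 1 [← exp_log hwa]
        rw [← exp_add]
        simp
      have h3 := hunit _ h2
      rw [map_mul, map_zpow₀] at h3
      rw [zpow_neg]
      exact eq_inv_of_mul_eq_one_left h3
  have hvπ0 : v π ≠ 0 := (Valuation.ne_zero_iff _).2 hπ0
  have hvπ : v π = exp (-1) := by
    obtain ⟨a, ha⟩ := hv (exp (-1))
    have ha0 : a ≠ 0 := by
      rintro rfl
      rw [map_zero] at ha
      exact exp_ne_zero ha.symm
    obtain ⟨k, -, hk⟩ := key a ha0
    rw [ha, ← exp_log hvπ0, ← exp_zsmul, exp_inj, smul_eq_mul] at hk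
    have h4 : v π ≤ 1 := h π (by rw [hπ, ← exp_zero, exp_le_exp]; omega)
    rw [← exp_log hvπ0, ← exp_zero, exp_le_exp] at h4
    have h5 : log (v π) = -1 := by
      have : log (v π) ∣ 1 := ⟨-k, by linarith⟩
      rcases Int.isUnit_iff.1 (isUnit_of_dvd_one this) with h | h <;> omega
    rw [← exp_log hvπ0, h5]
  ext a
  rcases eq_or_ne a 0 with rfl | ha
  · simp
  obtain ⟨k, hk1, hk2⟩ := key a ha
  rw [hk1, hk2, hvπ, ← exp_zsmul]
  simp

/-- The set of places of a function field. -/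
def PlaceF (K F : Type) [Field K] [Field F] [Algebra K F] : Type :=
  {v : Valuation F ℤᵐ⁰ // Function.Surjective v ∧ ∀ c : K, c ≠ 0 → v (algebraMap K F c) = 1}

/-- Zeros of `w`, abstract version. -/
theorem zeros_abs {K A B K' F : Type} [Field K] [IsAlgClosed K] [CommRing A] [IsDomain A]
    [IsPrincipalIdealRing A] [Field K'] [CharZero K'] [Field F] [Algebra K A] [Algebra A K']
    [IsFractionRing A K'] [Algebra K' F] [Algebra A F] [IsScalarTower A K' F]
    [FiniteDimensional K' F] [CommRing B] [Algebra B F] [Algebra A B] [IsScalarTower A B F]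
    [IsIntegralClosure B A F] [IsDedekindDomain B] [IsFractionRing B F]
    (w : A) (hw : w ≠ 0) (hp : (Ideal.span {w}).IsMaximal)
    (hsurj : ∀ a : A, ∃ c : K, a - algebraMap K A c ∈ Ideal.span {w}) :
    ∃ T : Finset (IsDedekindDomain.HeightOneSpectrum B),
      (∀ P, P ∈ T ↔ P.valuation F (algebraMap A F w) < 1) ∧
      ∑ P ∈ T, -log (P.valuation F (algebraMap A F w)) = Module.finrank K' F := by
  have hfin : Module.Finite A B := IsIntegralClosure.finite A K' F B
  have htfAF : Module.IsTorsionFree A F := by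
    have : FaithfulSMul A F := by
      rw [faithfulSMul_iff_algebraMap_injective, IsScalarTower.algebraMap_eq A K' F]
      exact (algebraMap K' F).injective.comp (IsFractionRing.injective A K')
    infer_instance
  have hfree : Module.Free A B := IsIntegralClosure.module_free A K' F B
  have hinjAB : Function.Injective (algebraMap A B) := by
    have : Function.Injective (algebraMap A F) := FaithfulSMul.algebraMap_injective A F
    rw [IsScalarTower.algebraMap_eq A B F] at this
    exact Function.Injective.of_comp this
  have htfAB : Module.IsTorsionFree A B := by
    have : FaithfulSMul A B := (faithfulSMul_iff_algebraMap_injective A B).2 hinjAB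
    infer_instance
  set p : Ideal A := Ideal.span {w} with hpdef
  have hp0 : p ≠ ⊥ := by rw [hpdef, Ne, Ideal.span_singleton_eq_bot]; exact hw
  have hmap : p.map (algebraMap A B) = Ideal.span {algebraMap A B w} := by
    rw [hpdef, Ideal.map_span, Set.image_singleton]
  have hwB : algebraMap A B w ≠ 0 := by
    rw [Ne, ← map_zero (algebraMap A B)]; exact fun h => hw (hinjAB h)
  have hmap0 : p.map (algebraMap A B) ≠ ⊥ := by
    rw [hmap, Ne, Ideal.span_singleton_eq_bot]; exact hwB
  have hsum := Ideal.sum_ramification_inertia_eq_finrank (S := B) p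
  have hrank : Module.finrank A B = Module.finrank K' F := IsIntegralClosure.rank A K' F B
  have hbot : ∀ q : p.primesOver B, q.1 ≠ ⊥ := fun q => by
    have := q.2.2
    exact Ideal.ne_bot_of_liesOver_of_ne_bot hp0 q.1
  let f : p.primesOver B → IsDedekindDomain.HeightOneSpectrum B := fun q => ⟨q.1, q.2.1, hbot q⟩
  have hf : Function.Injective f := fun q q' h => by
    apply Subtype.ext
    exact congrArg (fun P => P.asIdeal) h
  have hwmap : algebraMap A F w = algebraMap B F (algebraMap A B w) :=
    IsScalarTower.algebraMap_apply A B F w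
  refine ⟨Finset.univ.map ⟨f, hf⟩, fun P => ?_, ?_⟩
  · rw [Finset.mem_map, hwmap, IsDedekindDomain.HeightOneSpectrum.valuation_lt_one_iff_mem]
    constructor
    · rintro ⟨q, -, rfl⟩
      have := q.2.2
      change algebraMap A B w ∈ q.1
      have h1 : w ∈ p := Ideal.mem_span_singleton_self w
      rw [this.over] at h1
      exact h1
    · intro h
      refine ⟨⟨P.asIdeal, P.isPrime, ⟨?_⟩⟩, Finset.mem_univ _, rfl⟩
      refine hp.eq_of_le (Ideal.comap_ne_top _ P.isPrime.ne_top) ?_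
      rw [hpdef, Ideal.span_singleton_le_iff_mem]
      exact h
  · rw [Finset.sum_map, ← hrank, ← hsum]
    push_cast
    refine Finset.sum_congr rfl fun q _ => ?_
    have hqp := q.2.1
    have hql := q.2.2
    have hqm : q.1.IsMaximal := hqp.isMaximal (hbot q)
    have h1 : q.1.inertiaDeg A = 1 := by
      rw [Ideal.inertiaDeg_eq_of_isMaximal p q.1]
      let : Field (A ⧸ p) := Ideal.Quotient.field p
      have hac : IsAlgClosed (A ⧸ p) := by
        refine IsAlgClosed.of_ringEquiv K (A ⧸ p) (RingEquiv.ofBijective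
          ((Ideal.Quotient.mk p).comp (algebraMap K A)) ⟨RingHom.injective _, fun a => ?_⟩)
        obtain ⟨a, rfl⟩ := Ideal.Quotient.mk_surjective a
        obtain ⟨c, hc⟩ := hsurj a
        exact ⟨c, (Ideal.Quotient.eq.2 hc).symm⟩
      have hbij := IsAlgClosed.algebraMap_bijective_of_isIntegral (k := A ⧸ p) (K := B ⧸ q.1)
      have e := LinearEquiv.ofBijective (Algebra.linearMap (A ⧸ p) (B ⧸ q.1)) hbij
      rw [← e.finrank_eq, Module.finrank_self]
    rw [h1, Ideal.IsDedekindDomain.ramificationIdx_eq_multiplicity p q.1 hmap0, hmap, hwmap]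
    change -log ((f q).valuation F _) = _
    rw [IsDedekindDomain.HeightOneSpectrum.valuation_of_algebraMap,
      IsDedekindDomain.HeightOneSpectrum.intValuation_eq_exp_neg_multiplicity _ hwB, log_exp]
    simp [f]



theorem finiteDim_of_transcendental {K F : Type} [Field K] [Field F] [Algebra K F]
    [Algebra.EssFiniteType K F] (htr : Algebra.trdeg K F = 1) (w : F) (hw : Transcendental K w) :
    FiniteDimensional (IntermediateField.adjoin K {w}) F := by
  have h1 : AlgebraicIndependent K (fun _ : Fin 1 => w) :=
    algebraicIndependent_unique_type_iff.2 hw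
  have h2 : IsTranscendenceBasis K (fun _ : Fin 1 => w) :=
    AlgebraicIndependent.isTranscendenceBasis_of_trdeg_le_of_finite h1 (by rw [htr]; simp)
  have h3 : Algebra.IsAlgebraic (IntermediateField.adjoin K {w}) F := by
    have := h2.isAlgebraic_field
    rwa [Set.range_const] at this
  have h4 : Algebra.EssFiniteType (IntermediateField.adjoin K {w}) F :=
    Algebra.EssFiniteType.of_comp K _ F
  exact Algebra.finite_of_essFiniteType_of_isAlgebraic

open scoped IntermediateField.algebraAdjoinAdjoin in
theorem zeros_sum {K F : Type} [Field K] [IsAlgClosed K] [CharZero K] [Field F] [Algebra K F]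
    [Algebra.EssFiniteType K F] (htr : Algebra.trdeg K F = 1) (w : F) (hw : Transcendental K w) :
    ∃ T : Finset (PlaceF K F), (∀ P, P ∈ T ↔ P.1 w < 1) ∧
      ∑ P ∈ T, -log (P.1 w) = Module.finrank (IntermediateField.adjoin K {w}) F := by
  have hfd := finiteDim_of_transcendental htr w hw
  have hcz : CharZero (IntermediateField.adjoin K {w}) :=
    charZero_of_injective_algebraMap (algebraMap K _).injective
  let e := Polynomial.algEquivOfTranscendental K w hw
  have hpid : IsPrincipalIdealRing (Algebra.adjoin K {w}) :=
    IsPrincipalIdealRing.of_surjective e.toRingEquiv.toRingHom e.surjective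
  have hDB : IsDedekindDomain (integralClosure (Algebra.adjoin K {w}) F) :=
    IsIntegralClosure.isDedekindDomain (Algebra.adjoin K {w}) (IntermediateField.adjoin K {w}) F _
  have hFB : IsFractionRing (integralClosure (Algebra.adjoin K {w}) F) F :=
    integralClosure.isFractionRing_of_finite_extension (IntermediateField.adjoin K {w}) F
  let w' : Algebra.adjoin K {w} := ⟨w, Algebra.self_mem_adjoin_singleton K w⟩
  have hsurj : ∀ a : Algebra.adjoin K {w}, ∃ c : K,
      a - algebraMap K (Algebra.adjoin K {w}) c ∈ Ideal.span {w'} := by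
    intro a
    obtain ⟨f, rfl⟩ := e.surjective a
    refine ⟨f.coeff 0, ?_⟩
    rw [Ideal.mem_span_singleton]
    obtain ⟨g, hg⟩ := Polynomial.X_dvd_sub_C (p := f)
    refine ⟨e g, ?_⟩
    have := congrArg e hg
    rw [map_sub, map_mul, Polynomial.algEquivOfTranscendental_apply_X] at this
    rw [← this]
    congr 1
    exact (e.commutes (f.coeff 0)).symm
  have hw0 : w ≠ 0 := by rintro rfl; exact hw isAlgebraic_zero
  have hw'0 : w' ≠ 0 := fun h => hw0 (congrArg Subtype.val h)
  have hmax : (Ideal.span {w'}).IsMaximal := by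
    have hX : Prime w' := by
      have := (MulEquiv.prime_iff e.toMulEquiv (p := Polynomial.X)).2 Polynomial.prime_X
      convert this
      exact (Polynomial.algEquivOfTranscendental_apply_X K w hw).symm
    exact PrincipalIdealRing.isMaximal_of_irreducible hX.irreducible
  obtain ⟨T, hT, hTs⟩ := zeros_abs (K := K) (A := Algebra.adjoin K {w})
    (B := integralClosure (Algebra.adjoin K {w}) F) (K' := IntermediateField.adjoin K {w}) (F := F)
    w' hw'0 hmax hsurj
  have hmapw : algebraMap (Algebra.adjoin K {w}) F w' = w := rfl
  rw [hmapw] at hTs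
  simp only [hmapw] at hT
  have hK : ∀ (P : IsDedekindDomain.HeightOneSpectrum (integralClosure (Algebra.adjoin K {w}) F))
      (c : K), c ≠ 0 → P.valuation F (algebraMap K F c) = 1 := by
    intro P c hc
    have hle : ∀ c : K, P.valuation F (algebraMap K F c) ≤ 1 := fun c =>
      P.valuation_le_one (algebraMap (Algebra.adjoin K {w}) _ (algebraMap K _ c))
    apply le_antisymm (hle c)
    have h1 := hle c⁻¹
    have hne : P.valuation F (algebraMap K F c) ≠ 0 := by
      rw [Valuation.ne_zero_iff]; simpa using hc
    rw [map_inv₀, map_inv₀] at h1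
    exact (inv_le_one₀ (zero_lt_iff.2 hne)).1 h1
  let g : IsDedekindDomain.HeightOneSpectrum (integralClosure (Algebra.adjoin K {w}) F) →
      PlaceF K F := fun P => ⟨P.valuation F, P.valuation_surjective F, hK P⟩
  have hg : Function.Injective g := by
    intro P Q h
    have h1 : P.valuation F = Q.valuation F := congrArg Subtype.val h
    apply IsDedekindDomain.HeightOneSpectrum.ext
    ext b
    rw [← P.valuation_lt_one_iff_mem (K := F), h1, Q.valuation_lt_one_iff_mem]
  refine ⟨T.map ⟨g, hg⟩, fun v => ?_, ?_⟩
  · rw [Finset.mem_map]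
    constructor
    · rintro ⟨P, hP, rfl⟩
      exact (hT P).1 hP
    · intro hv
      obtain ⟨v, hvs, hvK⟩ := v
      change v w < 1 at hv
      have hKle : ∀ c : K, v (algebraMap K F c) ≤ 1 := by
        intro c
        rcases eq_or_ne c 0 with rfl | hc
        · simp
        · exact (hvK c hc).le
      have hA : ∀ a ∈ Algebra.adjoin K {w}, v a ≤ 1 := by
        intro a ha
        induction ha using Algebra.adjoin_induction with
        | mem x hx => rw [Set.mem_singleton_iff.1 hx]; exact hv.le
        | algebraMap c => exact hKle c
        | add x y _ _ hx hy => exact (v.map_add x y).trans (max_le hx hy)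
        | mul x y _ _ hx hy => rw [map_mul]; exact mul_le_one' hx hy
      have hB : ∀ b ∈ integralClosure (Algebra.adjoin K {w}) F, v b ≤ 1 := by
        intro b hb
        have hb' : IsIntegral (Algebra.adjoin K {w}) b := hb
        have h2 : IsIntegral v.integer b := by
          let i : Algebra.adjoin K {w} →+* v.integer :=
            (algebraMap (Algebra.adjoin K {w}) F).codRestrict v.integer (fun a => hA a a.2)
          obtain ⟨f, hf, hfb⟩ := hb'
          refine ⟨f.map i, hf.map i, ?_⟩
          rw [Polynomial.eval₂_map]
          exact hfb
        exact Valuation.Integers.mem_of_integral (Valuation.integer.integers v) h2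
      let P : Ideal (integralClosure (Algebra.adjoin K {w}) F) :=
        { carrier := {b | v b < 1}
          add_mem' := fun {a b} ha hb => (v.map_add a b).trans_lt (max_lt ha hb)
          zero_mem' := by simp
          smul_mem' := fun c b hb => by
            change v ((c : F) * b) < 1
            rw [map_mul]
            exact mul_lt_one_of_nonneg_of_lt_one_right (hB c c.2) zero_le hb }
      have hPp : P.IsPrime := by
        refine ⟨fun h => ?_, fun {a b} hab => ?_⟩
        · have : (1 : integralClosure (Algebra.adjoin K {w}) F) ∈ P := by rw [h]; trivial
          change v (1 : F) < 1 at this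
          simp at this
        · change v ((a : F) * b) < 1 at hab
          change v (a : F) < 1 ∨ v (b : F) < 1
          by_contra! hcon
          rw [map_mul, (hB a a.2).antisymm hcon.1, (hB b b.2).antisymm hcon.2] at hab
          simp at hab
      have hwP : algebraMap (Algebra.adjoin K {w}) _ w' ∈ P := hv
      have hP0 : P ≠ ⊥ := by
        rintro h
        rw [h, Ideal.mem_bot] at hwP
        exact hw0 (congrArg Subtype.val hwP)
      let Q : IsDedekindDomain.HeightOneSpectrum (integralClosure (Algebra.adjoin K {w}) F) :=
        ⟨P, hPp, hP0⟩
      have hQ : v = Q.valuation F := by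
        refine val_eq_of_le _ _ hvs (Q.valuation_surjective F) fun a ha => ?_
        obtain ⟨n, s, hs⟩ := Q.exists_primeCompl_mul_eq_of_integer a ha
        have h1 : v (algebraMap _ F (s : integralClosure (Algebra.adjoin K {w}) F)) = 1 :=
          (hB _ s.1.2).antisymm (not_lt.1 s.2)
        have h2 := congrArg v hs
        rw [map_mul, h1, mul_one] at h2
        rw [h2]
        exact hB _ n.2
      refine ⟨Q, ?_, ?_⟩
      · rw [hT, ← hQ]; exact hv
      · exact Subtype.ext hQ.symm
  · rw [Finset.sum_map, ← hTs]
    rfl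



theorem mem_range_of_algebraic {K F : Type} [Field K] [IsAlgClosed K] [Field F] [Algebra K F]
    (z : F) (hz : ¬ Transcendental K z) : ∃ c : K, algebraMap K F c = z := by
  have h1 : IsAlgebraic K z := not_not.1 hz
  have h2 : Algebra.IsAlgebraic K (IntermediateField.adjoin K {z}) :=
    IntermediateField.isAlgebraic_adjoin_simple h1.isIntegral
  have h := IsAlgClosed.algebraMap_bijective_of_isIntegral (k := K)
    (K := IntermediateField.adjoin K {z})
  obtain ⟨c, hc⟩ := h.2 ⟨z, IntermediateField.mem_adjoin_simple_self K z⟩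
  exact ⟨c, congrArg Subtype.val hc⟩

theorem finrank_adjoin_const {K F : Type} [Field K] [Field F] [Algebra K F]
    (htr : Algebra.trdeg K F = 1) (c : K) :
    Module.finrank (IntermediateField.adjoin K {algebraMap K F c}) F = 0 := by
  have h1 : IntermediateField.adjoin K {algebraMap K F c} = ⊥ := by
    rw [IntermediateField.adjoin_simple_eq_bot_iff]
    exact algebraMap_mem _ c
  rw [h1, IntermediateField.finrank_bot']
  by_contra h
  have hfd : FiniteDimensional K F := Module.finite_of_finrank_pos (Nat.pos_of_ne_zero h)
  have : Algebra.IsAlgebraic K F := inferInstance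
  rw [trdeg_eq_zero] at htr
  exact zero_ne_one htr

theorem log_pos_iff' {a : ℤᵐ⁰} : 0 < log a ↔ 1 < a := by
  rcases eq_or_ne a 0 with rfl | ha
  · simp
  · conv_rhs => rw [← exp_log ha, ← exp_zero, exp_lt_exp]

theorem poles_sum {K F : Type} [Field K] [IsAlgClosed K] [CharZero K] [Field F] [Algebra K F]
    [Algebra.EssFiniteType K F] (htr : Algebra.trdeg K F = 1) (z : F) :
    (Function.support fun P : PlaceF K F => max 0 (log (P.1 z))).Finite ∧
    ∑ᶠ P : PlaceF K F, max 0 (log (P.1 z)) =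
      Module.finrank (IntermediateField.adjoin K {z}) F := by
  by_cases hz : Transcendental K z
  · have hw : Transcendental K z⁻¹ := fun h => hz (by simpa using h.inv)
    obtain ⟨T, hT, hs⟩ := zeros_sum htr z⁻¹ hw
    have hz0 : z ≠ 0 := by rintro rfl; exact hz isAlgebraic_zero
    have hT' : ∀ P : PlaceF K F, P ∈ T ↔ 0 < log (P.1 z) := by
      intro P
      rw [hT, log_pos_iff', map_inv₀]
      exact inv_lt_one₀ (zero_lt_iff.2 ((Valuation.ne_zero_iff _).2 hz0))
    have hsub : (Function.support fun P : PlaceF K F => max 0 (log (P.1 z))) ⊆ T := by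
      intro P hP
      rw [Finset.mem_coe, hT']
      by_contra h
      exact hP (max_eq_left (not_lt.1 h))
    refine ⟨T.finite_toSet.subset hsub, ?_⟩
    rw [finsum_eq_sum_of_support_subset _ hsub]
    have hadj : IntermediateField.adjoin K {z⁻¹} = IntermediateField.adjoin K {z} := by
      apply le_antisymm
      · rw [IntermediateField.adjoin_simple_le_iff]
        exact inv_mem (IntermediateField.mem_adjoin_simple_self K z)
      · rw [IntermediateField.adjoin_simple_le_iff]
        have := inv_mem (IntermediateField.mem_adjoin_simple_self K z⁻¹)
        rwa [inv_inv] at this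
    rw [hadj] at hs
    rw [← hs]
    refine Finset.sum_congr rfl fun P hP => ?_
    rw [map_inv₀, log_inv, neg_neg]
    exact max_eq_right ((hT' P).1 hP).le
  · obtain ⟨c, rfl⟩ := mem_range_of_algebraic z hz
    have h0 : (fun P : PlaceF K F => max 0 (log (P.1 (algebraMap K F c)))) = fun _ => 0 := by
      ext P
      rcases eq_or_ne c 0 with rfl | hc
      · simp
      · rw [P.2.2 c hc]; simp
    rw [finrank_adjoin_const htr, h0]
    simp

theorem product_formula {K F : Type} [Field K] [IsAlgClosed K] [CharZero K] [Field F] [Algebra K F]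
    [Algebra.EssFiniteType K F] (htr : Algebra.trdeg K F = 1) (a : F) :
    (Function.support fun P : PlaceF K F => log (P.1 a)).Finite ∧
    ∑ᶠ P : PlaceF K F, log (P.1 a) = 0 := by
  have hadj : IntermediateField.adjoin K {a⁻¹} = IntermediateField.adjoin K {a} := by
    apply le_antisymm
    · rw [IntermediateField.adjoin_simple_le_iff]
      exact inv_mem (IntermediateField.mem_adjoin_simple_self K a)
    · rw [IntermediateField.adjoin_simple_le_iff]
      have := inv_mem (IntermediateField.mem_adjoin_simple_self K a⁻¹)
      rwa [inv_inv] at this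
  obtain ⟨h1, h2⟩ := poles_sum htr a
  obtain ⟨h3, h4⟩ := poles_sum htr a⁻¹
  rw [hadj, ← h2] at h4
  have h5 : (fun P : PlaceF K F => log (P.1 a)) =
      fun P => max 0 (log (P.1 a)) - max 0 (log (P.1 a⁻¹)) := by
    ext P
    rw [map_inv₀, log_inv]
    omega
  rw [h5]
  refine ⟨(h1.union h3).subset (Function.support_sub _ _), ?_⟩
  rw [finsum_sub_distrib h1 h3, h4, sub_self]

/-- supremum of a tuple of valuations -/
noncomputable def supV {F : Type} [Field F] {n : ℕ} (v : Valuation F ℤᵐ⁰) (y : Fin n → F) : ℤᵐ⁰ :=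
  Finset.univ.sup fun j => v (y j)

theorem le_supV {F : Type} [Field F] {n : ℕ} (v : Valuation F ℤᵐ⁰) (y : Fin n → F) (j : Fin n) :
    v (y j) ≤ supV v y := Finset.le_sup (f := fun j => v (y j)) (Finset.mem_univ j)

theorem place_const_le {K F : Type} [Field K] [Field F] [Algebra K F] (P : PlaceF K F) (c : K) :
    P.1 (algebraMap K F c) ≤ 1 := by
  rcases eq_or_ne c 0 with rfl | hc
  · simp
  · exact (P.2.2 c hc).le

theorem place_lc_le {K F : Type} [Field K] [Field F] [Algebra K F] {n : ℕ} (P : PlaceF K F)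
    (y : Fin n → F) (m : Fin n → K) : P.1 (lc y m) ≤ supV P.1 y := by
  refine Valuation.map_sum_le _ fun i _ => ?_
  rw [Algebra.smul_def, map_mul]
  exact (mul_le_of_le_one_left zero_le (place_const_le P _)).trans (le_supV _ _ i)

theorem selection {K F : Type} [Field K] [Infinite K] [Field F] [Algebra K F] {n : ℕ}
    (y : Fin n → F) (T : Set (PlaceF K F)) (hT : T.Finite) :
    ∃ m : Fin n → K, ∀ P ∈ T, P.1 (lc y m) = supV P.1 y := by
  classical
  let S : PlaceF K F → Submodule K (Fin n → K) := fun P =>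
    if h : 0 < supV P.1 y then
      { carrier := {m | P.1 (lc y m) < supV P.1 y}
        add_mem' := fun {a b} ha hb => by
          have : lc y (a + b) = lc y a + lc y b := by
            simp [lc, add_smul, Finset.sum_add_distrib]
          change P.1 (lc y (a + b)) < _
          rw [this]
          exact (P.1.map_add _ _).trans_lt (max_lt ha hb)
        zero_mem' := by
          change P.1 (lc y 0) < _
          simpa [lc] using h
        smul_mem' := fun c b hb => by
          have : lc y (c • b) = algebraMap K F c * lc y b := by
            simp [lc, mul_smul, Finset.mul_sum, Algebra.smul_def, mul_assoc]
          change P.1 (lc y (c • b)) < _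
          rw [this, map_mul]
          exact (mul_le_of_le_one_left zero_le (place_const_le P _)).trans_lt hb }
    else ⊥
  have hT' : {P | P ∈ T ∧ 0 < supV P.1 y}.Finite := hT.subset fun P h => h.1
  have hS : ∀ P, 0 < supV P.1 y → ∀ m, m ∈ S P ↔ P.1 (lc y m) < supV P.1 y := by
    intro P h m
    simp only [S, dif_pos h]
    rfl
  have hne := Subspace.biUnion_ne_univ_of_top_notMem (s := hT'.toFinset.image S) (by
    simp only [Finset.mem_image, Set.Finite.mem_toFinset, not_exists, not_and]
    rintro P ⟨hP, h⟩ htop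
    have hn : Nonempty (Fin n) := by
      by_contra hn
      rw [not_nonempty_iff] at hn
      simp [supV, Finset.univ_eq_empty] at h
    obtain ⟨j, -, hj⟩ := Finset.exists_mem_eq_sup Finset.univ Finset.univ_nonempty
      (fun j => P.1 (y j))
    have h1 : (Pi.single j 1 : Fin n → K) ∈ S P := by rw [htop]; trivial
    rw [hS P h] at h1
    have h2 : lc y (Pi.single j 1 : Fin n → K) = y j := by
      simp [lc, Pi.single_apply]
    rw [h2] at h1
    exact h1.ne hj.symm)
  obtain ⟨m, hm⟩ := (Set.ne_univ_iff_exists_notMem _).1 hne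
  refine ⟨m, fun P hP => ?_⟩
  rcases eq_or_lt_of_le (zero_le (a := supV P.1 y)) with h0 | h0
  · exact le_antisymm (place_lc_le P y m) (h0 ▸ zero_le)
  · refine le_antisymm (place_lc_le P y m) (not_lt.1 fun hlt => hm ?_)
    rw [Set.mem_iUnion₂]
    exact ⟨S P, Finset.mem_image.2 ⟨P, hT'.mem_toFinset.2 ⟨hP, h0⟩, rfl⟩, (hS P h0 m).2 hlt⟩

end Places

set_option linter.unusedSectionVars false

section ThmH
open WithZero
variable {K F : Type} [Field K] [IsAlgClosed K] [CharZero K] [Field F] [Algebra K F]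
    [Algebra.EssFiniteType K F] {n : ℕ}

/-- the number `N1` -/
noncomputable def numOne (K : Type) {F : Type} [Field K] [Field F] [Algebra K F] {n : ℕ}
    (x : Fin n → F) : ℤ :=
  ∑ᶠ P : PlaceF K F, max 0 (log (supV P.1 x))

/-- the number `N2` -/
noncomputable def numTwo (K : Type) {F : Type} [Field K] [Field F] [Algebra K F] {n : ℕ}
    (y : Fin n → F) : ℤ :=
  ∑ᶠ P : PlaceF K F, log (supV P.1 y)

theorem log_le_log' {a b : ℤᵐ⁰} (ha : a ≠ 0) (h : a ≤ b) : log a ≤ log b := by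
  have hb : b ≠ 0 := (lt_of_lt_of_le (zero_lt_iff.2 ha) h).ne'
  rwa [← exp_le_exp, exp_log ha, exp_log hb]

theorem maxlog_mono {a b : ℤᵐ⁰} (h : a ≤ b) : max 0 (log a) ≤ max 0 (log b) := by
  rcases eq_or_ne a 0 with rfl | ha
  · simp
  · exact max_le_max le_rfl (log_le_log' ha h)

theorem supV_attained (v : Valuation F ℤᵐ⁰) (x : Fin n → F) (h : supV v x ≠ 0) :
    ∃ j, v (x j) = supV v x := by
  have hn : Nonempty (Fin n) := by
    by_contra hn
    rw [not_nonempty_iff] at hn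
    simp [supV, Finset.univ_eq_empty] at h
  obtain ⟨j, -, hj⟩ := Finset.exists_mem_eq_sup Finset.univ Finset.univ_nonempty
      (fun j => v (x j))
  exact ⟨j, hj.symm⟩

theorem supp_numOne (htr : Algebra.trdeg K F = 1) (x : Fin n → F) :
    (Function.support fun P : PlaceF K F => max 0 (log (supV P.1 x))).Finite := by
  refine (Set.finite_iUnion fun i => (poles_sum htr (x i)).1).subset fun P hP => ?_
  have h0 : supV P.1 x ≠ 0 := by
    intro h
    apply hP
    simp [h]
  obtain ⟨j, hj⟩ := supV_attained _ _ h0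
  rw [Set.mem_iUnion]
  refine ⟨j, ?_⟩
  rw [Function.mem_support, hj]
  exact hP

theorem supp_numTwo (htr : Algebra.trdeg K F = 1) (y : Fin n → F) :
    (Function.support fun P : PlaceF K F => log (supV P.1 y)).Finite := by
  refine (Set.finite_iUnion fun i => (product_formula htr (y i)).1).subset fun P hP => ?_
  have h0 : supV P.1 y ≠ 0 := by
    intro h
    apply hP
    simp [h]
  obtain ⟨j, hj⟩ := supV_attained _ _ h0
  rw [Set.mem_iUnion]
  refine ⟨j, ?_⟩
  rw [Function.mem_support, hj]
  exact hP

theorem fin_log_add_le {z g : F} (htr : Algebra.trdeg K F = 1) (φ : PlaceF K F → ℤ)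
    (hφ : (Function.support φ).Finite)
    (h : ∀ P : PlaceF K F, max 0 (log (P.1 z)) + log (P.1 g) ≤ φ P) :
    (Module.finrank (IntermediateField.adjoin K {z}) F : ℤ) ≤ ∑ᶠ P, φ P := by
  obtain ⟨h1, h2⟩ := poles_sum htr z
  obtain ⟨h3, h4⟩ := product_formula htr g
  have e := (finsum_add_distrib h1 h3).symm
  rw [h4, add_zero] at e
  rw [← h2, e]
  exact finsum_le_finsum' ((h1.union h3).subset (Function.support_add _ _)) hφ h

theorem fin_log_add_eq {z g : F} (htr : Algebra.trdeg K F = 1) (φ : PlaceF K F → ℤ)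
    (h : ∀ P : PlaceF K F, max 0 (log (P.1 z)) + log (P.1 g) = φ P) :
    (Module.finrank (IntermediateField.adjoin K {z}) F : ℤ) = ∑ᶠ P, φ P := by
  obtain ⟨h1, h2⟩ := poles_sum htr z
  obtain ⟨h3, h4⟩ := product_formula htr g
  have e := (finsum_add_distrib h1 h3).symm
  rw [h4, add_zero] at e
  rw [← h2, e]
  exact finsum_congr h

theorem numOne_nonneg (x : Fin n → F) : 0 ≤ numOne K x :=
  finsum_nonneg fun _ => le_max_left _ _

theorem H1_le (htr : Algebra.trdeg K F = 1) (x : Fin n → F) (m : Fin n → K) :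
    (Module.finrank (IntermediateField.adjoin K {lc x m}) F : ℤ) ≤ numOne K x := by
  refine fin_log_add_le (g := 1) htr _ (supp_numOne htr x) fun P => ?_
  rw [map_one, log_one, add_zero]
  exact maxlog_mono (place_lc_le P x m)

theorem H1_eq (htr : Algebra.trdeg K F = 1) (x : Fin n → F) :
    ∃ m : Fin n → K,
    (Module.finrank (IntermediateField.adjoin K {lc x m}) F : ℤ) = numOne K x := by
  obtain ⟨m, hm⟩ := selection (K := K) x _ (supp_numOne htr x)
  refine ⟨m, fin_log_add_eq (g := 1) htr _ fun P => ?_⟩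
  rw [map_one, log_one, add_zero]
  by_cases hP : P ∈ Function.support fun P : PlaceF K F => max 0 (log (supV P.1 x))
  · rw [hm P hP]
  · have h1 : max 0 (log (supV P.1 x)) = 0 := Function.notMem_support.1 hP
    apply le_antisymm (maxlog_mono (place_lc_le P x m))
    rw [h1]; exact le_max_left _ _

/-- from multiplicative to additive -/
theorem maxlog_add {a g V Y : ℤᵐ⁰} (hg : g ≠ 0) (hY : Y ≠ 0) (h1 : g ≤ max 1 V * Y)
    (h2 : a * g ≤ max 1 V * Y) : max 0 (log a) + log g ≤ max 0 (log V) + log Y := by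
  have hm : max 1 V ≠ 0 := (lt_of_lt_of_le zero_lt_one (le_max_left 1 V)).ne'
  have hlm : log (max 1 V) = max 0 (log V) := by
    rcases eq_or_ne V 0 with rfl | hV
    · simp
    rcases le_total 1 V with h | h
    · rw [max_eq_right h, max_eq_right]
      rw [← log_one (M := ℤ)]; exact log_le_log' one_ne_zero h
    · rw [max_eq_left h, max_eq_left, log_one]
      rw [← log_one (M := ℤ)]; exact log_le_log' hV h
  rw [← hlm, ← log_mul hm hY]
  rcases eq_or_ne a 0 with rfl | ha
  · simpa using log_le_log' hg h1
  rcases le_total 0 (log a) with h | h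
  · rw [max_eq_right h, ← log_mul ha hg]
    exact log_le_log' (mul_ne_zero ha hg) h2
  · rw [max_eq_left h, zero_add]
    exact log_le_log' hg h1

theorem H3_le (htr : Algebra.trdeg K F = 1) (x y : Fin n → F) (m1 m2 k1 k2 : Fin n → K)
    (hg : lc y k1 ≠ 0) (c : K) :
    (Module.finrank (IntermediateField.adjoin K
      {lc x m2 - lc x m1 * (lc y k2 / lc y k1) + algebraMap K F c * (lc y k2 / lc y k1)}) F : ℤ) ≤
      numOne K x + numTwo K y := by
  rw [numOne, numTwo, ← finsum_add_distrib (supp_numOne htr x) (supp_numTwo htr y)]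
  refine fin_log_add_le (g := lc y k1) htr _
    (((supp_numOne htr x).union (supp_numTwo htr y)).subset (Function.support_add _ _)) fun P => ?_
  have hg0 : P.1 (lc y k1) ≠ 0 := (Valuation.ne_zero_iff _).2 hg
  have hgY := place_lc_le P y k1
  have hg2Y := place_lc_le P y k2
  have hY : supV P.1 y ≠ 0 := (lt_of_lt_of_le (zero_lt_iff.2 hg0) hgY).ne'
  have h1 : P.1 (lc y k1) ≤ max 1 (supV P.1 x) * supV P.1 y :=
    hgY.trans (le_mul_of_one_le_left zero_le (le_max_left _ _))
  refine maxlog_add hg0 hY h1 ?_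
  rw [← map_mul]
  have h3 : (lc x m2 - lc x m1 * (lc y k2 / lc y k1) + algebraMap K F c * (lc y k2 / lc y k1)) *
      lc y k1 = lc x m2 * lc y k1 - lc x m1 * lc y k2 + algebraMap K F c * lc y k2 := by
    field_simp
  rw [h3]
  refine (P.1.map_add _ _).trans (max_le ((P.1.map_sub _ _).trans (max_le ?_ ?_)) ?_)
  · rw [map_mul]
    exact mul_le_mul' ((place_lc_le P x m2).trans (le_max_right _ _)) hgY
  · rw [map_mul]
    exact mul_le_mul' ((place_lc_le P x m1).trans (le_max_right _ _)) hg2Y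
  · rw [map_mul]
    exact mul_le_mul' ((place_const_le P c).trans (le_max_left _ _)) hg2Y

theorem H3_eq (htr : Algebra.trdeg K F = 1) (x y : Fin n → F) (hy : y ≠ 0) :
    ∃ m2 k1 k2 : Fin n → K, lc y k1 ≠ 0 ∧ ∀ c : K, c ≠ 0 →
    (Module.finrank (IntermediateField.adjoin K
      {lc x m2 + algebraMap K F c * (lc y k2 / lc y k1)}) F : ℤ) =
      numOne K x + numTwo K y := by
  obtain ⟨j0, hj0⟩ := Function.ne_iff.1 hy
  have hYne : ∀ P : PlaceF K F, supV P.1 y ≠ 0 := fun P =>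
    (lt_of_lt_of_le (zero_lt_iff.2 ((Valuation.ne_zero_iff _).2 hj0)) (le_supV P.1 y j0)).ne'
  obtain ⟨m2, hm2⟩ := selection (K := K) x _ (supp_numOne htr x)
  -- make sure that `lc y k1 ≠ 0`
  have hex : ∃ k1 : Fin n → K, lc y k1 ≠ 0 ∧
      ∀ P ∈ Function.support fun P : PlaceF K F => max 0 (log (supV P.1 x)),
      P.1 (lc y k1) = supV P.1 y := by
    by_cases hs : (Function.support fun P : PlaceF K F => max 0 (log (supV P.1 x))).Nonempty
    · obtain ⟨k1, hk1⟩ := selection (K := K) y _ (supp_numOne htr x)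
      obtain ⟨P, hP⟩ := hs
      refine ⟨k1, ?_, hk1⟩
      rw [← Valuation.ne_zero_iff P.1, hk1 P hP]
      exact hYne P
    · refine ⟨Pi.single j0 1, ?_, fun P hP => (hs ⟨P, hP⟩).elim⟩
      simpa [lc, Pi.single_apply] using hj0
  obtain ⟨k1, hg, hk1⟩ := hex
  have hfin : {P : PlaceF K F | P.1 (lc y k1) ≠ supV P.1 y}.Finite := by
    refine ((supp_numTwo htr y).union (product_formula htr (lc y k1)).1).subset fun P hP => ?_
    by_contra hcon
    rw [Set.mem_union, not_or, Function.notMem_support, Function.notMem_support] at hcon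
    apply hP
    rw [← exp_log ((Valuation.ne_zero_iff P.1).2 hg), hcon.2, ← exp_log (hYne P), hcon.1]
  obtain ⟨k2, hk2⟩ := selection (K := K) y _ hfin
  refine ⟨m2, k1, k2, hg, fun c hc => ?_⟩
  rw [numOne, numTwo, ← finsum_add_distrib (supp_numOne htr x) (supp_numTwo htr y)]
  refine fin_log_add_eq (g := lc y k1) htr _ fun P => ?_
  have hg0 : P.1 (lc y k1) ≠ 0 := (Valuation.ne_zero_iff _).2 hg
  have hgY := place_lc_le P y k1
  have hg2Y := place_lc_le P y k2
  have hcr : P.1 (algebraMap K F c * (lc y k2 / lc y k1)) = P.1 (lc y k2) / P.1 (lc y k1) := by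
    rw [map_mul, map_div₀, P.2.2 c hc, one_mul]
  by_cases hP : P ∈ Function.support fun P : PlaceF K F => max 0 (log (supV P.1 x))
  · have hV : 1 < supV P.1 x := by
      by_contra hcon
      rw [← log_pos_iff', not_lt] at hcon
      exact hP (max_eq_left hcon)
    have h1 := hk1 P hP
    have h2 := hm2 P hP
    have h3 : P.1 (algebraMap K F c * (lc y k2 / lc y k1)) ≤ 1 := by
      rw [hcr, h1]
      exact (div_le_one₀ (zero_lt_iff.2 (hYne P))).2 hg2Y
    rw [Valuation.map_add_eq_of_lt_left, h2, h1]
    rw [h2]; exact h3.trans_lt hV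
  · have h0 : max 0 (log (supV P.1 x)) = 0 := Function.notMem_support.1 hP
    have hV : supV P.1 x ≤ 1 := by
      rw [← not_lt, ← log_pos_iff']
      omega
    have hf := (place_lc_le P x m2).trans hV
    rw [h0, zero_add]
    by_cases hP2 : P.1 (lc y k1) = supV P.1 y
    · have h3 : P.1 (algebraMap K F c * (lc y k2 / lc y k1)) ≤ 1 := by
        rw [hcr, hP2]
        exact (div_le_one₀ (zero_lt_iff.2 (hYne P))).2 hg2Y
      have h4 := (P.1.map_add (lc x m2) (algebraMap K F c * (lc y k2 / lc y k1))).trans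
        (max_le hf h3)
      rw [hP2, max_eq_left, zero_add]
      rw [← not_lt, log_pos_iff', not_lt]
      exact h4
    · have h1 := hk2 P hP2
      have hlt : P.1 (lc y k1) < supV P.1 y := lt_of_le_of_ne hgY hP2
      have h3 : 1 < P.1 (algebraMap K F c * (lc y k2 / lc y k1)) := by
        rw [hcr, h1]
        exact (one_lt_div₀ (zero_lt_iff.2 hg0)).2 hlt
      rw [Valuation.map_add_eq_of_lt_right _ (hf.trans_lt h3), max_eq_right, hcr, h1,
        log_div (hYne P) hg0, sub_add_cancel]
      exact (log_pos_iff'.2 h3).le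

theorem numOne_zero : numOne K (fun _ : Fin n => (0 : F)) = 0 := by
  have : ∀ P : PlaceF K F, supV P.1 (fun _ : Fin n => (0 : F)) = 0 := fun P => by
    simp [supV]
  simp [numOne, this]

theorem lc_zero_fun (m : Fin n → K) : lc (fun _ : Fin n => (0 : F)) m = 0 := by
  simp [lc]

theorem H2_le (htr : Algebra.trdeg K F = 1) (y : Fin n → F) (k1 k2 : Fin n → K)
    (hg : lc y k1 ≠ 0) :
    (Module.finrank (IntermediateField.adjoin K {lc y k2 / lc y k1}) F : ℤ) ≤ numTwo K y := by
  have := H3_le htr (fun _ => (0 : F)) y 0 0 k1 k2 hg 1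
  rw [numOne_zero, zero_add] at this
  have e : lc (fun _ : Fin n => (0 : F)) (0 : Fin n → K) - lc (fun _ : Fin n => (0 : F)) (0 : Fin n → K)
      * (lc y k2 / lc y k1) + algebraMap K F 1 * (lc y k2 / lc y k1) = lc y k2 / lc y k1 := by
    simp only [lc_zero_fun, map_one, one_mul, zero_mul, sub_zero, zero_add]
  rw [e] at this
  exact this

theorem H2_eq (htr : Algebra.trdeg K F = 1) (y : Fin n → F) (hy : y ≠ 0) :
    ∃ k1 k2 : Fin n → K, lc y k1 ≠ 0 ∧
    (Module.finrank (IntermediateField.adjoin K {lc y k2 / lc y k1}) F : ℤ) = numTwo K y := by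
  obtain ⟨m, k1, k2, h1, h2⟩ := H3_eq htr (fun _ => (0 : F)) y hy
  refine ⟨k1, k2, h1, ?_⟩
  have := h2 1 one_ne_zero
  rw [numOne_zero, zero_add] at this
  have e : lc (fun _ : Fin n => (0 : F)) m + algebraMap K F 1 * (lc y k2 / lc y k1)
      = lc y k2 / lc y k1 := by
    simp only [lc_zero_fun, map_one, one_mul, zero_add]
  rw [e] at this
  exact this

theorem numTwo_nonneg (htr : Algebra.trdeg K F = 1) (y : Fin n → F) (hy : y ≠ 0) :
    0 ≤ numTwo K y := by
  obtain ⟨_, _, -, h⟩ := H2_eq htr y hy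
  rw [← h]; positivity

end ThmH

set_option linter.unusedSectionVars false

section LemD
variable {K F M : Type} [Field K] [IsAlgClosed K] [CharZero K] [Field F] [Algebra K F]
    [Field M] [Algebra K M] [Algebra F M] [IsScalarTower K F M]

theorem fib_gen {M : Type} [Field M] [Algebra K M] {S T : Set M} (hST : S ⊆ Algebra.adjoin K T)
    (ψ ψ' : Algebra.adjoin K T →ₐ[K] K) :
    (∀ x : Algebra.adjoin K S, ψ (Subalgebra.inclusion (Algebra.adjoin_le hST) x) =
      ψ'.comp (Subalgebra.inclusion (Algebra.adjoin_le hST)) x) ↔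
    ∀ s (hs : s ∈ S), ψ ⟨s, hST hs⟩ = ψ' ⟨s, hST hs⟩ := by
  constructor
  · intro h s hs
    exact h ⟨s, Algebra.subset_adjoin hs⟩
  · intro h x
    have : ψ.comp (Subalgebra.inclusion (Algebra.adjoin_le hST)) =
        ψ'.comp (Subalgebra.inclusion (Algebra.adjoin_le hST)) :=
      AlgHom.adjoin_ext fun s hs => h s hs
    exact DFunLike.congr_fun this x

/-- evaluation map `R0[X] → M` -/
noncomputable def polyToM (T : Set F) (u : M) :
    Polynomial (Algebra.adjoin K T) →ₐ[K] M :=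
  (((Polynomial.aeval u : Polynomial F →ₐ[F] M).restrictScalars K).comp
    (Polynomial.mapAlgHom (Algebra.adjoin K T).val))

theorem polyToM_C (T : Set F) (u : M) (r : Algebra.adjoin K T) :
    polyToM T u (Polynomial.C r) = algebraMap F M r := by
  simp [polyToM]

theorem polyToM_X (T : Set F) (u : M) :
    polyToM (K := K) T u Polynomial.X = u := by
  simp [polyToM]

theorem polyToM_inj (T : Set F) (u : M) (hu : Transcendental F u) :
    Function.Injective (polyToM (K := K) T u) := by
  have h1 : Function.Injective (Polynomial.aeval u : Polynomial F →ₐ[F] M) :=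
    transcendental_iff_injective.1 hu
  have h2 : Function.Injective (Polynomial.mapAlgHom (Algebra.adjoin K T).val) :=
    Polynomial.map_injective _ Subtype.val_injective
  exact h1.comp h2

theorem polyToM_range (T : Set F) (u : M) :
    (polyToM (K := K) T u).range = Algebra.adjoin K (insert u (algebraMap F M '' T)) := by
  apply le_antisymm
  · rintro _ ⟨p, rfl⟩
    change polyToM T u p ∈ _
    induction p using Polynomial.induction_on' with
    | add p q hp hq => rw [map_add]; exact add_mem hp hq
    | monomial k r =>
      rw [← Polynomial.C_mul_X_pow_eq_monomial, map_mul, map_pow, polyToM_C, polyToM_X]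
      refine mul_mem ?_ (pow_mem (Algebra.subset_adjoin (Set.mem_insert _ _)) _)
      have h : algebraMap F M r ∈ (Algebra.adjoin K T).map (IsScalarTower.toAlgHom K F M) :=
        ⟨r.1, r.2, rfl⟩
      rw [AlgHom.map_adjoin] at h
      exact Algebra.adjoin_mono (Set.subset_insert _ _) h
  · apply Algebra.adjoin_le
    rintro _ (rfl | ⟨t, ht, rfl⟩)
    · exact ⟨Polynomial.X, polyToM_X T _⟩
    · exact ⟨Polynomial.C ⟨t, Algebra.subset_adjoin ht⟩, polyToM_C T _ _⟩

/-- `R0[X] ≃ K[T ∪ {u}]` -/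
noncomputable def polyEquiv (T : Set F) (u : M) (hu : Transcendental F u) :
    Polynomial (Algebra.adjoin K T) ≃ₐ[K] Algebra.adjoin K (insert u (algebraMap F M '' T)) :=
  (AlgEquiv.ofInjective (polyToM (K := K) T u) (polyToM_inj T u hu)).trans
    (Subalgebra.equivOfEq _ _ (polyToM_range T u))

theorem polyEquiv_coe (T : Set F) (u : M) (hu : Transcendental F u)
    (p : Polynomial (Algebra.adjoin K T)) :
    (polyEquiv T u hu p : M) = polyToM T u p := rfl

theorem trdeg_insert (T : Set F) (u : M) (hu : Transcendental F u) {d : ℕ}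
    (htr : Algebra.trdeg K (Algebra.adjoin K T) = d) :
    Algebra.trdeg K (Algebra.adjoin K (insert u (algebraMap F M '' T))) = ((d + 1 : ℕ) : Cardinal) := by
  rw [← (polyEquiv (K := K) T u hu).trdeg_eq,
    ← trdeg_add_eq (R := K) (S := Algebra.adjoin K T), htr, Polynomial.trdeg_of_isDomain]
  simp

/-- specialisation `u ↦ c`, evaluated at a point -/
noncomputable def specAt (T : Set F) (u : M) (hu : Transcendental F u) (c : K)  :
    Algebra.adjoin K (insert u (algebraMap F M '' T)) →ₐ[K] Algebra.adjoin K T :=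
  ((Polynomial.aeval (algebraMap K (Algebra.adjoin K T) c)).restrictScalars K).comp
    (polyEquiv (K := K) T u hu).symm.toAlgHom

theorem specAt_apply (T : Set F) (u : M) (hu : Transcendental F u) (c : K)
    (p : Polynomial (Algebra.adjoin K T)) :
    specAt T u hu c (polyEquiv T u hu p) = Polynomial.eval (algebraMap K _ c) p := by
  simp [specAt]

theorem spec_fibre (T : Set F) (u : M) (hu : Transcendental F u) (c : K) (a b : F)
    (ha : a ∈ Algebra.adjoin K T) (hb : b ∈ Algebra.adjoin K T)
    (hST : ({a + algebraMap K F c * b} : Set F) ⊆ Algebra.adjoin K T)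
    (hST' : ({u, algebraMap F M a + u * algebraMap F M b} : Set M) ⊆
      Algebra.adjoin K (insert u (algebraMap F M '' T)))
    (ψ0 : Algebra.adjoin K T →ₐ[K] K) :
    {ψ : Algebra.adjoin K (insert u (algebraMap F M '' T)) →ₐ[K] K |
      ∀ x, ψ (Subalgebra.inclusion (Algebra.adjoin_le hST') x) =
      (ψ0.comp (specAt T u hu c)).comp (Subalgebra.inclusion (Algebra.adjoin_le hST')) x} =
    (fun ψ : Algebra.adjoin K T →ₐ[K] K => ψ.comp (specAt T u hu c)) ''
    {ψ : Algebra.adjoin K T →ₐ[K] K |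
      ∀ x, ψ (Subalgebra.inclusion (Algebra.adjoin_le hST) x) =
      ψ0.comp (Subalgebra.inclusion (Algebra.adjoin_le hST)) x} := by
  have eu : (⟨u, hST' (by simp)⟩ : Algebra.adjoin K (insert u (algebraMap F M '' T))) =
      polyEquiv T u hu Polynomial.X := Subtype.ext (by rw [polyEquiv_coe, polyToM_X])
  have ew : (⟨algebraMap F M a + u * algebraMap F M b, hST' (by simp)⟩ :
      Algebra.adjoin K (insert u (algebraMap F M '' T))) =
      polyEquiv T u hu (Polynomial.C ⟨a, ha⟩ + Polynomial.X * Polynomial.C ⟨b, hb⟩) :=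
    Subtype.ext (by rw [polyEquiv_coe, map_add, map_mul, polyToM_X, polyToM_C, polyToM_C])
  have ev : (⟨a + algebraMap K F c * b, hST rfl⟩ : Algebra.adjoin K T) =
      ⟨a, ha⟩ + algebraMap K _ c * ⟨b, hb⟩ := rfl
  ext ψ
  rw [Set.mem_image]
  have key : ∀ ψ' ψ'' : Algebra.adjoin K (insert u (algebraMap F M '' T)) →ₐ[K] K,
      (∀ x, ψ' (Subalgebra.inclusion (Algebra.adjoin_le hST') x) =
        ψ''.comp (Subalgebra.inclusion (Algebra.adjoin_le hST')) x) ↔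
      ψ' (polyEquiv T u hu Polynomial.X) = ψ'' (polyEquiv T u hu Polynomial.X) ∧
      ψ' (polyEquiv T u hu (Polynomial.C ⟨a, ha⟩ + Polynomial.X * Polynomial.C ⟨b, hb⟩)) =
      ψ'' (polyEquiv T u hu (Polynomial.C ⟨a, ha⟩ + Polynomial.X * Polynomial.C ⟨b, hb⟩)) := by
    intro ψ' ψ''
    rw [← eu, ← ew, fib_gen hST']
    constructor
    · exact fun h => ⟨h _ (by simp), h _ (by simp)⟩
    · rintro ⟨h1, h2⟩ s hs
      rcases id hs with hs' | hs'
      · have : (⟨s, hST' hs⟩ : Algebra.adjoin K (insert u (algebraMap F M '' T))) =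
          ⟨u, hST' (by simp)⟩ := Subtype.ext hs'
        rw [this]; exact h1
      · have : (⟨s, hST' hs⟩ : Algebra.adjoin K (insert u (algebraMap F M '' T))) =
          ⟨algebraMap F M a + u * algebraMap F M b, hST' (by simp)⟩ := Subtype.ext hs'
        rw [this]; exact h2
  have key2 : ∀ ψ' ψ'' : Algebra.adjoin K T →ₐ[K] K,
      (∀ x, ψ' (Subalgebra.inclusion (Algebra.adjoin_le hST) x) =
        ψ''.comp (Subalgebra.inclusion (Algebra.adjoin_le hST)) x) ↔
      ψ' (⟨a, ha⟩ + algebraMap K _ c * ⟨b, hb⟩) = ψ'' (⟨a, ha⟩ + algebraMap K _ c * ⟨b, hb⟩) := by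
    intro ψ' ψ''
    rw [← ev, fib_gen hST]
    constructor
    · exact fun h => h _ rfl
    · intro h s hs
      cases hs; exact h
  constructor
  · intro h0
    obtain ⟨h1, h2⟩ := (key _ _).1 h0
    have hX : ψ (polyEquiv T u hu Polynomial.X) = c := by
      rw [h1, AlgHom.comp_apply, specAt_apply]
      simp
    let j : Algebra.adjoin K T →ₐ[K] Algebra.adjoin K (insert u (algebraMap F M '' T)) :=
      (polyEquiv (K := K) T u hu).toAlgHom.comp (Polynomial.CAlgHom)
    have hc : (ψ.comp j).comp (specAt T u hu c) = ψ := by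
      have h3 : ((ψ.comp j).comp (specAt T u hu c)).comp (polyEquiv (K := K) T u hu).toAlgHom =
          ψ.comp (polyEquiv (K := K) T u hu).toAlgHom := by
        apply Polynomial.algHom_ext'
        · ext1 x
          change (ψ.comp j) (specAt T u hu c (polyEquiv T u hu (Polynomial.C x))) = 
            ψ (polyEquiv T u hu (Polynomial.C x))
          rw [specAt_apply, Polynomial.eval_C]
          rfl
        · change (ψ.comp j) (specAt T u hu c (polyEquiv T u hu Polynomial.X)) = 
            ψ (polyEquiv T u hu Polynomial.X)
          rw [specAt_apply, Polynomial.eval_X, hX, AlgHom.commutes]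
          rfl
      ext1 z
      obtain ⟨p, rfl⟩ := (polyEquiv (K := K) T u hu).surjective z
      exact DFunLike.congr_fun h3 p
    refine ⟨ψ.comp j, (key2 _ _).2 ?_, hc⟩
    have h4 := h2
    conv_lhs at h4 => rw [← hc]
    change (ψ.comp j) (specAt T u hu c _) = ψ0 (specAt T u hu c _) at h4
    rw [specAt_apply] at h4
    simpa only [Polynomial.eval_add, Polynomial.eval_mul, Polynomial.eval_C, Polynomial.eval_X]
      using h4
  · rintro ⟨ψ1, h0, rfl⟩
    have h1 := (key2 _ _).1 h0
    refine (key _ _).2 ⟨?_, ?_⟩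
    · rw [AlgHom.comp_apply, AlgHom.comp_apply, specAt_apply]
      simp
    · rw [AlgHom.comp_apply, AlgHom.comp_apply, specAt_apply]
      simpa only [Polynomial.eval_add, Polynomial.eval_mul, Polynomial.eval_C, Polynomial.eval_X]
        using h1

theorem specAt_surjective (T : Set F) (u : M) (hu : Transcendental F u) (c : K) :
    Function.Surjective (specAt (K := K) T u hu c) := fun x =>
  ⟨polyEquiv T u hu (Polynomial.C x), by rw [specAt_apply, Polynomial.eval_C]⟩

theorem spec_ncard (T : Set F) (u : M) (hu : Transcendental F u) (c : K) (a b : F)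
    (ha : a ∈ Algebra.adjoin K T) (hb : b ∈ Algebra.adjoin K T)
    (hST : ({a + algebraMap K F c * b} : Set F) ⊆ Algebra.adjoin K T)
    (hST' : ({u, algebraMap F M a + u * algebraMap F M b} : Set M) ⊆
      Algebra.adjoin K (insert u (algebraMap F M '' T)))
    (ψ0 : Algebra.adjoin K T →ₐ[K] K) :
    {ψ : Algebra.adjoin K (insert u (algebraMap F M '' T)) →ₐ[K] K |
      ∀ x, ψ (Subalgebra.inclusion (Algebra.adjoin_le hST') x) =
      (ψ0.comp (specAt T u hu c)).comp (Subalgebra.inclusion (Algebra.adjoin_le hST')) x}.ncard =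
    {ψ : Algebra.adjoin K T →ₐ[K] K |
      ∀ x, ψ (Subalgebra.inclusion (Algebra.adjoin_le hST) x) =
      ψ0.comp (Subalgebra.inclusion (Algebra.adjoin_le hST)) x}.ncard := by
  rw [spec_fibre T u hu c a b ha hb hST hST' ψ0]
  apply Set.ncard_image_of_injective
  intro ψ1 ψ2 h
  ext1 x
  obtain ⟨z, rfl⟩ := specAt_surjective T u hu c x
  exact DFunLike.congr_fun h z

theorem lemD (T : Set F) (hT : T.Finite) (htr : Algebra.trdeg K (Algebra.adjoin K T) = 1)
    (a b : F) (ha : a ∈ Algebra.adjoin K T) (hb : b ∈ Algebra.adjoin K T)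
    (u : M) (hu : Transcendental F u) :
    ∃ c : K, c ≠ 0 ∧
      IntermediateField.relfinrank
        (IntermediateField.adjoin K {u, algebraMap F M a + u * algebraMap F M b})
        (IntermediateField.adjoin K (insert u (algebraMap F M '' T))) =
      IntermediateField.relfinrank (IntermediateField.adjoin K {a + algebraMap K F c * b})
        (IntermediateField.adjoin K T) := by
  have hfg : Algebra.FiniteType K (Algebra.adjoin K T) :=
    (Subalgebra.fg_iff_finiteType _).1 ⟨hT.toFinset, by simp⟩
  have hT' : (insert u (algebraMap F M '' T)).Finite := (hT.image _).insert _
  have htr' := trdeg_insert (K := K) T u hu (d := 1) (by simpa using htr)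
  have himg : ∀ z ∈ Algebra.adjoin K T, algebraMap F M z ∈
      Algebra.adjoin K (insert u (algebraMap F M '' T)) := by
    intro z hz
    have h := (polyEquiv (K := K) T u hu (Polynomial.C ⟨z, hz⟩)).2
    rwa [polyEquiv_coe, polyToM_C] at h
  have hu0 : u ∈ Algebra.adjoin K (insert u (algebraMap F M '' T)) :=
    Algebra.subset_adjoin (Set.mem_insert _ _)
  have hST' : ({u, algebraMap F M a + u * algebraMap F M b} : Set M) ⊆
      Algebra.adjoin K (insert u (algebraMap F M '' T)) := by
    rintro _ (rfl | rfl)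
    · exact hu0
    · exact add_mem (himg _ ha) (mul_mem hu0 (himg _ hb))
  have hST : ∀ c : K, ({a + algebraMap K F c * b} : Set F) ⊆ Algebra.adjoin K T := by
    rintro c _ rfl
    exact add_mem ha (mul_mem (Subalgebra.algebraMap_mem _ c) hb)
  -- the two inequalities
  have hF : ∀ (c : K) (ψ0 : Algebra.adjoin K T →ₐ[K] K),
      0 < {ψ : Algebra.adjoin K T →ₐ[K] K |
        ∀ x, ψ (Subalgebra.inclusion (Algebra.adjoin_le (hST c)) x) =
        ψ0.comp (Subalgebra.inclusion (Algebra.adjoin_le (hST c))) x}.ncard →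
      0 < IntermediateField.relfinrank (IntermediateField.adjoin K {a + algebraMap K F c * b})
        (IntermediateField.adjoin K T) := by
    intro c ψ0 h
    exact lt_of_lt_of_le h (lemA_sub (d := 1) (fun _ => a + algebraMap K F c * b) _ (by simp) T hT
      (hST c) (by simpa using htr) _ (Set.finite_of_ncard_pos h))
  have hM : ∀ ψ0 : Algebra.adjoin K (insert u (algebraMap F M '' T)) →ₐ[K] K,
      0 < {ψ : Algebra.adjoin K (insert u (algebraMap F M '' T)) →ₐ[K] K |
        ∀ x, ψ (Subalgebra.inclusion (Algebra.adjoin_le hST') x) =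
        ψ0.comp (Subalgebra.inclusion (Algebra.adjoin_le hST')) x}.ncard →
      0 < IntermediateField.relfinrank
        (IntermediateField.adjoin K {u, algebraMap F M a + u * algebraMap F M b})
        (IntermediateField.adjoin K (insert u (algebraMap F M '' T))) := by
    intro ψ0 h
    exact lt_of_lt_of_le h (lemA_sub (d := 2) ![u, algebraMap F M a + u * algebraMap F M b] _
      (by ext z; simp [eq_comm, or_comm]) _ hT' hST' htr' _ (Set.finite_of_ncard_pos h))
  rcases Nat.eq_zero_or_pos (IntermediateField.relfinrank
        (IntermediateField.adjoin K {u, algebraMap F M a + u * algebraMap F M b})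
        (IntermediateField.adjoin K (insert u (algebraMap F M '' T)))) with h0 | hpos
  · refine ⟨1, one_ne_zero, ?_⟩
    rw [h0]
    by_contra hne
    have hpos := Nat.pos_of_ne_zero (Ne.symm hne)
    obtain ⟨p, hp, hp2⟩ := lemB_sub _ T hT (hST 1) hpos
    obtain ⟨ψ0, hψ0⟩ := exists_algHom_ne_zero (K := K) (Algebra.adjoin K T)
      (Subalgebra.inclusion (Algebra.adjoin_le (hST 1)) p) (by
        rw [Ne, map_eq_zero_iff _ (Subalgebra.inclusion_injective _)]; exact hp)
    have h1 := hp2 (ψ0.comp (Subalgebra.inclusion (Algebra.adjoin_le (hST 1)))) hψ0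
    have h2 := hM (ψ0.comp (specAt T u hu 1)) (by
      rw [spec_ncard T u hu 1 a b ha hb (hST 1) hST' ψ0, h1]; exact hpos)
    omega
  · obtain ⟨q, hq, hq2⟩ := lemB_sub _ _ hT' hST' hpos
    obtain ⟨Q, hQ⟩ := (polyEquiv (K := K) T u hu).surjective
      (Subalgebra.inclusion (Algebra.adjoin_le hST') q)
    have hQ0 : Q ≠ 0 := by
      rintro rfl
      rw [map_zero, eq_comm, map_eq_zero_iff _ (Subalgebra.inclusion_injective _)] at hQ
      exact hq hQ
    have hfin : {c : K | Polynomial.eval (algebraMap K (Algebra.adjoin K T) c) Q = 0}.Finite := by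
      refine Set.Finite.of_finite_image (f := algebraMap K (Algebra.adjoin K T))
        ((Polynomial.finite_setOfPred_isRoot hQ0).subset ?_)
        (FaithfulSMul.algebraMap_injective _ _).injOn
      rintro _ ⟨c, hc, rfl⟩
      exact hc
    obtain ⟨c, hc⟩ := (hfin.insert 0).exists_notMem
    rw [Set.mem_insert_iff, not_or] at hc
    refine ⟨c, hc.1, ?_⟩
    have hspec : specAt T u hu c (Subalgebra.inclusion (Algebra.adjoin_le hST') q) ≠ 0 := by
      rw [← hQ, specAt_apply]; exact hc.2
    have hposF : 0 < IntermediateField.relfinrank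
        (IntermediateField.adjoin K {a + algebraMap K F c * b})
        (IntermediateField.adjoin K T) := by
      obtain ⟨ψ0, hψ0⟩ := exists_algHom_ne_zero (K := K) (Algebra.adjoin K T) _ hspec
      have h1 := hq2 ((ψ0.comp (specAt T u hu c)).comp
        (Subalgebra.inclusion (Algebra.adjoin_le hST'))) hψ0
      rw [spec_ncard T u hu c a b ha hb (hST c) hST' ψ0] at h1
      exact hF c ψ0 (h1 ▸ hpos)
    obtain ⟨p, hp, hp2⟩ := lemB_sub _ T hT (hST c) hposF
    obtain ⟨ψ0, hψ0⟩ := exists_algHom_ne_zero (K := K) (Algebra.adjoin K T)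
      (Subalgebra.inclusion (Algebra.adjoin_le (hST c)) p * 
        specAt T u hu c (Subalgebra.inclusion (Algebra.adjoin_le hST') q)) (by
        refine mul_ne_zero ?_ hspec
        rw [Ne, map_eq_zero_iff _ (Subalgebra.inclusion_injective _)]; exact hp)
    rw [map_mul] at hψ0
    have h1 := hp2 (ψ0.comp (Subalgebra.inclusion (Algebra.adjoin_le (hST c))))
      (left_ne_zero_of_mul hψ0)
    have h2 := hq2 ((ψ0.comp (specAt T u hu c)).comp
        (Subalgebra.inclusion (Algebra.adjoin_le hST'))) (right_ne_zero_of_mul hψ0)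
    rw [← h1, ← h2, spec_ncard T u hu c a b ha hb (hST c) hST' ψ0]

end LemD

set_option linter.unusedSectionVars false

section Deg
variable {K F M : Type} [Field K] [IsAlgClosed K] [CharZero K] [Field F] [Algebra K F]
    [Field M] [Algebra K M] [Algebra F M] [IsScalarTower K F M]

open scoped IntermediateField.algebraAdjoinAdjoin in
theorem trdeg_adjoin_field {M : Type} [Field M] [Algebra K M] (T : Set M) :
    Algebra.trdeg K (Algebra.adjoin K T) = Algebra.trdeg K (IntermediateField.adjoin K T) := by
  have h : Algebra.IsAlgebraic (Algebra.adjoin K T) (IntermediateField.adjoin K T) :=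
    IsLocalization.isAlgebraic _ (nonZeroDivisors (Algebra.adjoin K T))
  have h0 : Algebra.trdeg (Algebra.adjoin K T) (IntermediateField.adjoin K T) = 0 := trdeg_eq_zero
  rw [← trdeg_add_eq (R := K) (S := Algebra.adjoin K T) (A := IntermediateField.adjoin K T), h0,
    add_zero]

theorem trdeg_adjoin_top (T : Set F) (hT : IntermediateField.adjoin K T = ⊤) :
    Algebra.trdeg K (Algebra.adjoin K T) = Algebra.trdeg K F := by
  rw [trdeg_adjoin_field, hT]
  exact IntermediateField.topEquiv.trdeg_eq

/-- positivity of the degree implies algebraic independence -/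
theorem algInd_of_relfinrank_pos {M : Type} [Field M] [Algebra K M] {d : ℕ} (u : Fin d → M)
    (T : Set M) (hT : T.Finite) (hST : Set.range u ⊆ Algebra.adjoin K T)
    (htr : Algebra.trdeg K (Algebra.adjoin K T) = d)
    (hpos : 0 < IntermediateField.relfinrank (IntermediateField.adjoin K (Set.range u))
      (IntermediateField.adjoin K T)) : AlgebraicIndependent K u := by
  have hfg : Algebra.FiniteType K (Algebra.adjoin K T) :=
    (Subalgebra.fg_iff_finiteType _).1 ⟨hT.toFinset, by simp⟩
  obtain ⟨p, hp, hp2⟩ := lemB_sub _ T hT hST hpos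
  obtain ⟨ψ0, hψ0⟩ := exists_algHom_ne_zero (K := K) (Algebra.adjoin K T)
      (Subalgebra.inclusion (Algebra.adjoin_le hST) p) (by
        rw [Ne, map_eq_zero_iff _ (Subalgebra.inclusion_injective _)]; exact hp)
  have h1 := hp2 (ψ0.comp (Subalgebra.inclusion (Algebra.adjoin_le hST))) hψ0
  rw [← h1] at hpos
  exact lemA_ind u _ rfl T hT hST htr _ (Set.finite_of_ncard_pos hpos)
    (Set.nonempty_of_ncard_ne_zero (Nat.ne_of_gt hpos))

/-- the field `F(s)` inside `M` -/
noncomputable def bigF (K : Type) {F M : Type} [Field K] [Field F]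
    [Field M] [Algebra K M] [Algebra F M] (s : M) : IntermediateField K M :=
  IntermediateField.adjoin K (insert s (Set.range (algebraMap F M)))

theorem bigF_F (s : M) (f : F) : algebraMap F M f ∈ bigF (F := F) K s :=
  IntermediateField.subset_adjoin _ _ (Set.mem_insert_of_mem _ ⟨f, rfl⟩)

theorem bigF_s (s : M) : s ∈ bigF (F := F) K s :=
  IntermediateField.subset_adjoin _ _ (Set.mem_insert _ _)

theorem algebraMap_mem_of_top (T : Set F) (hT : IntermediateField.adjoin K T = ⊤)
    (E : IntermediateField K M) (hE : algebraMap F M '' T ⊆ E) (f : F) : algebraMap F M f ∈ E := by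
  have h : algebraMap F M f ∈ (IntermediateField.adjoin K T).map (IsScalarTower.toAlgHom K F M) := by
    rw [hT]
    exact ⟨f, trivial, rfl⟩
  rw [IntermediateField.adjoin_map] at h
  exact (IntermediateField.adjoin_le_iff.2 hE) h

theorem bigF_eq (T : Set F) (hT : IntermediateField.adjoin K T = ⊤) (s : M) (f g : F)
    (hg : g ≠ 0) : IntermediateField.adjoin K
      (insert (algebraMap F M f + s * algebraMap F M g) (algebraMap F M '' T)) =
      bigF (F := F) K s := by
  have hg' : algebraMap F M g ≠ 0 := by simpa using hg
  apply le_antisymm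
  · rw [IntermediateField.adjoin_le_iff]
    rintro _ (rfl | ⟨t, -, rfl⟩)
    · exact add_mem (bigF_F s f) (mul_mem (bigF_s s) (bigF_F s g))
    · exact bigF_F s t
  · rw [bigF, IntermediateField.adjoin_le_iff]
    have h1 : ∀ t : F, algebraMap F M t ∈ IntermediateField.adjoin K
      (insert (algebraMap F M f + s * algebraMap F M g) (algebraMap F M '' T)) :=
      algebraMap_mem_of_top T hT _ ((Set.subset_insert _ _).trans
        (IntermediateField.subset_adjoin _ _))
    have h2 : algebraMap F M f + s * algebraMap F M g ∈ IntermediateField.adjoin K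
      (insert (algebraMap F M f + s * algebraMap F M g) (algebraMap F M '' T)) :=
      IntermediateField.subset_adjoin _ _ (Set.mem_insert _ _)
    rintro _ (h | ⟨t, rfl⟩)
    · rw [h]
      have h3 : s = (algebraMap F M f + s * algebraMap F M g - algebraMap F M f) / algebraMap F M g := by
        field_simp; ring
      have h4 := div_mem (sub_mem h2 (h1 f)) (h1 g)
      rwa [← h3] at h4
    · exact h1 t

theorem transcendental_affine (s : M) (hs : Transcendental F s) (f g : F) (hg : g ≠ 0) :
    Transcendental F (algebraMap F M f + s * algebraMap F M g) := by
  have hg' : algebraMap F M g ≠ 0 := by simpa using hg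
  intro h
  apply hs
  have h3 : s = (algebraMap F M f + s * algebraMap F M g - algebraMap F M f) * 
      algebraMap F M g⁻¹ := by
    rw [map_inv₀]; field_simp; ring
  rw [h3]
  exact (h.sub (isAlgebraic_algebraMap f)).mul (isAlgebraic_algebraMap _)

theorem lemU (T : Set F) (hT : T.Finite) (hTt : IntermediateField.adjoin K T = ⊤)
    (htr : Algebra.trdeg K F = 1) (s : M) (hs : Transcendental F s) (f1 g1 f2 g2 : F) 
    (hg : g1 ≠ 0) :
    ∃ c : K, c ≠ 0 ∧ IntermediateField.relfinrank (IntermediateField.adjoin K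
      {algebraMap F M f1 + s * algebraMap F M g1, algebraMap F M f2 + s * algebraMap F M g2})
      (bigF (F := F) K s) = Module.finrank (IntermediateField.adjoin K
        {f2 - f1 * (g2 / g1) + algebraMap K F c * (g2 / g1)}) F := by
  have hg' : algebraMap F M g1 ≠ 0 := by simpa using hg
  let a := f2 - f1 * (g2 / g1)
  let b := g2 / g1
  let T1 := insert a (insert b T)
  have hT1 : T1.Finite := (hT.insert _).insert _
  have hT1t : IntermediateField.adjoin K T1 = ⊤ := by
    rw [eq_top_iff, ← hTt]
    exact IntermediateField.adjoin.mono _ _ _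
      ((Set.subset_insert _ _).trans (Set.subset_insert _ _))
  obtain ⟨c, hc, h⟩ := lemD (K := K) T1 hT1 (by rw [trdeg_adjoin_top T1 hT1t, htr]) a b
    (Algebra.subset_adjoin (by simp [T1])) (Algebra.subset_adjoin (by simp [T1]))
    _ (transcendental_affine s hs f1 g1 hg)
  refine ⟨c, hc, ?_⟩
  rw [bigF_eq T1 hT1t s f1 g1 hg, hT1t, IntermediateField.relfinrank_top_right] at h
  have e : algebraMap F M f2 + s * algebraMap F M g2 =
      algebraMap F M a + (algebraMap F M f1 + s * algebraMap F M g1) * algebraMap F M b := by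
    simp only [a, b, map_sub, map_mul, map_div₀]
    field_simp
    ring
  rw [← h, e]

theorem trdeg_bigF (T : Set F) (hTt : IntermediateField.adjoin K T = ⊤)
    (htr : Algebra.trdeg K F = 1) (s : M) (hs : Transcendental F s) :
    Algebra.trdeg K (bigF (F := F) K s) = 2 := by
  rw [← bigF_eq T hTt s 0 1 one_ne_zero, ← trdeg_adjoin_field]
  have h := trdeg_insert (K := K) T s hs (d := 1) (by rw [trdeg_adjoin_top T hTt, htr]; simp)
  have e : algebraMap F M 0 + s * algebraMap F M 1 = s := by simp
  rw [e, h]; norm_num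

theorem lemU_zero (T : Set F) (hT : T.Finite) (hTt : IntermediateField.adjoin K T = ⊤)
    (htr : Algebra.trdeg K F = 1) (s : M) (hs : Transcendental F s) (f1 f2 : F) :
    IntermediateField.relfinrank (IntermediateField.adjoin K
      {algebraMap F M f1, algebraMap F M f2}) (bigF (F := F) K s) = 0 := by
  by_contra hne
  let T1 := insert f1 (insert f2 T)
  have hT1 : T1.Finite := (hT.insert _).insert _
  have hT1t : IntermediateField.adjoin K T1 = ⊤ := by
    rw [eq_top_iff, ← hTt]
    exact IntermediateField.adjoin.mono _ _ _
      ((Set.subset_insert _ _).trans (Set.subset_insert _ _))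
  have hr : ({algebraMap F M f1, algebraMap F M f2} : Set M) =
      Set.range (⇑(IsScalarTower.toAlgHom K F M) ∘ ![f1, f2]) := by
    ext z
    simp [Fin.exists_fin_two, eq_comm]
  have h2 := trdeg_bigF (K := K) T1 hT1t htr s hs
  rw [← bigF_eq T1 hT1t s 0 1 one_ne_zero] at hne h2
  rw [← trdeg_adjoin_field] at h2
  rw [hr] at hne
  have h1 := algInd_of_relfinrank_pos _ _ ((hT1.image _).insert _) (by
    rw [← hr]
    rintro _ (rfl | rfl)
    · exact Algebra.subset_adjoin (Set.mem_insert_of_mem _ ⟨f1, by simp [T1], rfl⟩)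
    · exact Algebra.subset_adjoin (Set.mem_insert_of_mem _ ⟨f2, by simp [T1], rfl⟩))
    (by rw [h2]; norm_num) (Nat.pos_of_ne_zero hne)
  rw [AlgHom.algebraicIndependent_iff _ (IsScalarTower.toAlgHom K F M).injective] at h1
  have h3 := h1.cardinalMk_le_trdeg
  rw [htr] at h3
  norm_num at h3

end Deg

set_option linter.unusedSectionVars false

section Deg2
variable {K F M : Type} [Field K] [IsAlgClosed K] [CharZero K] [Field F] [Algebra K F]
    [Field M] [Algebra K M] [Algebra F M] [IsScalarTower K F M] [Algebra.EssFiniteType K F] {n : ℕ}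

theorem range_fin_one {α : Type} (f : Fin 1 → α) : Set.range f = {f 0} := by
  ext z; simp [eq_comm]

theorem range_fin_two {α : Type} (f : Fin 2 → α) : Set.range f = {f 0, f 1} := by
  ext z; simp [Fin.exists_fin_two, eq_comm]

theorem deg_C (W : Set (Fin n → K)) (x : Fin n → F)
    (hW : zeroLocus K (vanishingIdeal K W) = W)
    (hI : vanishingIdeal K W = RingHom.ker (aeval x : MvPolynomial (Fin n) K →ₐ[K] F))
    (hx : IntermediateField.adjoin K (Set.range x) = ⊤) (htr : Algebra.trdeg K F = 1) :
    (geomDegree W : ℤ) = numOne K x := by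
  have h0 := numOne_nonneg (K := K) x
  have h := geomDegree_eq (d := 1) W x hW hI (by rw [trdeg_adjoin_top _ hx, htr]; simp)
    (numOne K x).toNat (fun ℓ => by
      rw [range_fin_one, hx, IntermediateField.relfinrank_top_right]
      have := H1_le htr x (ℓ 0)
      omega) (fun _ => by
      obtain ⟨m, hm⟩ := H1_eq htr x
      refine ⟨fun _ => m, ?_⟩
      rw [range_fin_one, hx, IntermediateField.relfinrank_top_right]
      change Module.finrank (IntermediateField.adjoin K {lc x m}) F = _
      omega)
  omega

/-- generic point of the tangent bundle -/
def xiT (s : M) (x y : Fin n → F) : Fin (n + n) → M :=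
  Fin.append (fun i => algebraMap F M (x i)) (fun i => s * algebraMap F M (y i))

/-- generic point of the tangential variety -/
def etaT (s : M) (y : Fin n → F) : Fin n → M := fun i => s * algebraMap F M (y i)

theorem algebraMap_lc (x : Fin n → F) (m : Fin n → K) :
    algebraMap F M (lc x m) = ∑ i, m i • algebraMap F M (x i) := by
  simp only [lc, map_sum, Algebra.smul_def, map_mul, ← IsScalarTower.algebraMap_apply]

theorem lc_etaT (s : M) (y : Fin n → F) (m : Fin n → K) :
    lc (etaT s y) m = s * algebraMap F M (lc y m) := by
  rw [algebraMap_lc, Finset.mul_sum]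
  exact Finset.sum_congr rfl fun i _ => by rw [etaT, mul_smul_comm]

theorem lc_xiT (s : M) (x y : Fin n → F) (m : Fin (n + n) → K) :
    lc (xiT s x y) m = algebraMap F M (lc x fun i => m (Fin.castAdd n i)) + 
      s * algebraMap F M (lc y fun i => m (Fin.natAdd n i)) := by
  rw [← lc_etaT, algebraMap_lc, lc, Fin.sum_univ_add]
  simp only [xiT, Fin.append_left, Fin.append_right]
  rfl

theorem adjoin_xiT (s : M) (x y : Fin n → F)
    (hx : IntermediateField.adjoin K (Set.range x) = ⊤) (hy : y ≠ 0) :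
    IntermediateField.adjoin K (Set.range (xiT s x y)) = bigF (F := F) K s := by
  apply le_antisymm
  · rw [IntermediateField.adjoin_le_iff]
    rintro _ ⟨i, rfl⟩
    refine Fin.addCases (fun i => ?_) (fun i => ?_) i
    · rw [xiT, Fin.append_left]; exact bigF_F s _
    · rw [xiT, Fin.append_right]; exact mul_mem (bigF_s s) (bigF_F s _)
  · obtain ⟨j, hj⟩ := Function.ne_iff.1 hy
    rw [← bigF_eq _ hx s 0 (y j) hj, IntermediateField.adjoin_le_iff]
    rintro _ (rfl | ⟨_, ⟨i, rfl⟩, rfl⟩)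
    · refine IntermediateField.subset_adjoin _ _ ⟨Fin.natAdd n j, ?_⟩
      rw [xiT, Fin.append_right]; simp
    · refine IntermediateField.subset_adjoin _ _ ⟨Fin.castAdd n i, ?_⟩
      rw [xiT, Fin.append_left]

theorem numTwo_nonneg' (htr : Algebra.trdeg K F = 1) (y : Fin n → F) (hy : y ≠ 0) : 
    0 ≤ numTwo K y := numTwo_nonneg htr y hy

theorem deg_TC (W : Set (Fin (n + n) → K)) (s : M) (hs : Transcendental F s) (x y : Fin n → F)
    (hW : zeroLocus K (vanishingIdeal K W) = W)
    (hI : vanishingIdeal K W = RingHom.ker (aeval (xiT s x y) : MvPolynomial (Fin (n + n)) K →ₐ[K] M))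
    (hx : IntermediateField.adjoin K (Set.range x) = ⊤) (hy : y ≠ 0)
    (htr : Algebra.trdeg K F = 1) :
    (geomDegree W : ℤ) = numOne K x + numTwo K y := by
  have h1 := numOne_nonneg (K := K) x
  have h2 := numTwo_nonneg htr y hy
  have hL := adjoin_xiT (K := K) s x y hx hy
  have h := geomDegree_eq (d := 2) W (xiT s x y) hW hI
    (by rw [trdeg_adjoin_field, hL, trdeg_bigF _ hx htr s hs]; simp)
    (numOne K x + numTwo K y).toNat (fun ℓ => by
      rw [range_fin_two, hL, lc_xiT, lc_xiT]
      by_cases hg : lc y (fun i => ℓ 0 (Fin.natAdd n i)) = 0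
      · by_cases hg2 : lc y (fun i => ℓ 1 (Fin.natAdd n i)) = 0
        · rw [hg, hg2, map_zero, mul_zero, add_zero, add_zero,
            lemU_zero _ (Set.finite_range x) hx htr s hs]
          exact Nat.zero_le _
        · rw [Set.pair_comm]
          obtain ⟨c, hc, h⟩ := lemU (K := K) _ (Set.finite_range x) hx htr s hs
            (lc x fun i => ℓ 1 (Fin.castAdd n i)) (lc y fun i => ℓ 1 (Fin.natAdd n i))
            (lc x fun i => ℓ 0 (Fin.castAdd n i)) (lc y fun i => ℓ 0 (Fin.natAdd n i)) hg2
          rw [h]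
          have := H3_le htr x y (fun i => ℓ 1 (Fin.castAdd n i)) (fun i => ℓ 0 (Fin.castAdd n i))
            (fun i => ℓ 1 (Fin.natAdd n i)) (fun i => ℓ 0 (Fin.natAdd n i)) hg2 c
          omega
      · obtain ⟨c, hc, h⟩ := lemU (K := K) _ (Set.finite_range x) hx htr s hs
            (lc x fun i => ℓ 0 (Fin.castAdd n i)) (lc y fun i => ℓ 0 (Fin.natAdd n i))
            (lc x fun i => ℓ 1 (Fin.castAdd n i)) (lc y fun i => ℓ 1 (Fin.natAdd n i)) hg
        rw [h]
        have := H3_le htr x y (fun i => ℓ 0 (Fin.castAdd n i)) (fun i => ℓ 1 (Fin.castAdd n i))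
            (fun i => ℓ 0 (Fin.natAdd n i)) (fun i => ℓ 1 (Fin.natAdd n i)) hg c
        omega)
    (fun _ => by
      obtain ⟨m2, k1, k2, hg, H⟩ := H3_eq htr x y hy
      refine ⟨![Fin.append 0 k1, Fin.append m2 k2], ?_⟩
      rw [range_fin_two, hL, lc_xiT, lc_xiT]
      simp only [Matrix.cons_val_zero, Matrix.cons_val_one, Fin.append_left, Fin.append_right,
        Pi.zero_apply]
      have e0 : lc x (fun _ => (0 : K)) = 0 := by simp [lc]
      obtain ⟨c, hc, h⟩ := lemU (K := K) _ (Set.finite_range x) hx htr s hs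
        0 (lc y k1) (lc x m2) (lc y k2) hg
      have e : lc x m2 - 0 * (lc y k2 / lc y k1) + algebraMap K F c * (lc y k2 / lc y k1) =
        lc x m2 + algebraMap K F c * (lc y k2 / lc y k1) := by ring
      have h3 := H c hc
      rw [e] at h
      rw [e0]
      change IntermediateField.relfinrank (IntermediateField.adjoin K
        {algebraMap F M 0 + s * algebraMap F M (lc y k1),
          algebraMap F M (lc x m2) + s * algebraMap F M (lc y k2)}) _ = _
      rw [h]
      omega)
  omega

theorem deg_aux (s : M) (hs : Transcendental F s) (x y : Fin n → F)
    (hx : IntermediateField.adjoin K (Set.range x) = ⊤) 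
    (htr : Algebra.trdeg K F = 1) (k1 k2 : Fin n → K) (hg : lc y k1 ≠ 0) :
    ∃ c : K, c ≠ 0 ∧ IntermediateField.relfinrank (IntermediateField.adjoin K
      {s * algebraMap F M (lc y k1), s * algebraMap F M (lc y k2)}) (bigF (F := F) K s) =
      Module.finrank (IntermediateField.adjoin K {lc (0 : Fin n → F) (0 : Fin n → K) + 
        algebraMap K F c * (lc y k2 / lc y k1)}) F := by
  obtain ⟨c, hc, h⟩ := lemU (K := K) _ (Set.finite_range x) hx htr s hs
        0 (lc y k1) 0 (lc y k2) hg
  refine ⟨c, hc, ?_⟩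
  have e : (0 : F) - 0 * (lc y k2 / lc y k1) + algebraMap K F c * (lc y k2 / lc y k1) =
        lc (0 : Fin n → F) (0 : Fin n → K) + algebraMap K F c * (lc y k2 / lc y k1) := by
    simp [lc]
  rw [e, map_zero, zero_add, zero_add] at h
  exact h

theorem deg_aux_le (s : M) (hs : Transcendental F s) (x y : Fin n → F)
    (hx : IntermediateField.adjoin K (Set.range x) = ⊤) 
    (htr : Algebra.trdeg K F = 1) (k1 k2 : Fin n → K) (hy : y ≠ 0) :
    (IntermediateField.relfinrank (IntermediateField.adjoin K
      {s * algebraMap F M (lc y k1), s * algebraMap F M (lc y k2)}) (bigF (F := F) K s) : ℤ) ≤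
      numTwo K y := by
  have key : ∀ k1 k2 : Fin n → K, lc y k1 ≠ 0 → 
    (IntermediateField.relfinrank (IntermediateField.adjoin K
      {s * algebraMap F M (lc y k1), s * algebraMap F M (lc y k2)}) (bigF (F := F) K s) : ℤ) ≤
      numTwo K y := by
    intro k1 k2 hg
    obtain ⟨c, hc, h⟩ := deg_aux (K := K) s hs x y hx htr k1 k2 hg
    rw [h]
    have h2 := H3_le htr (fun _ => (0 : F)) y 0 0 k1 k2 hg c
    have e : lc (fun _ : Fin n => (0 : F)) (0 : Fin n → K) - lc (fun _ : Fin n => (0 : F)) (0 : Fin n → K)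
      * (lc y k2 / lc y k1) + algebraMap K F c * (lc y k2 / lc y k1) = 
        lc (0 : Fin n → F) (0 : Fin n → K) + algebraMap K F c * (lc y k2 / lc y k1) := by
      simp [lc]
    rwa [numOne_zero, zero_add, e] at h2
  by_cases hg : lc y k1 = 0
  · by_cases hg2 : lc y k2 = 0
    · have h := lemU_zero (K := K) _ (Set.finite_range x) hx htr s hs 0 0
      rw [map_zero] at h
      rw [hg, hg2, map_zero, mul_zero, h]
      exact_mod_cast numTwo_nonneg htr y hy
    · rw [Set.pair_comm]; exact key _ _ hg2
  · exact key _ _ hg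

theorem deg_aux_eq (s : M) (hs : Transcendental F s) (x y : Fin n → F)
    (hx : IntermediateField.adjoin K (Set.range x) = ⊤) 
    (htr : Algebra.trdeg K F = 1) (hy : y ≠ 0) : ∃ k1 k2 : Fin n → K,
    (IntermediateField.relfinrank (IntermediateField.adjoin K
      {s * algebraMap F M (lc y k1), s * algebraMap F M (lc y k2)}) (bigF (F := F) K s) : ℤ) =
      numTwo K y := by
  obtain ⟨m2, k1, k2, hg, H⟩ := H3_eq htr (fun _ => (0 : F)) y hy
  refine ⟨k1, k2, ?_⟩
  obtain ⟨c, hc, h⟩ := deg_aux (K := K) s hs x y hx htr k1 k2 hg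
  rw [h]
  have h2 := H c hc
  have e : lc (fun _ : Fin n => (0 : F)) m2 + algebraMap K F c * (lc y k2 / lc y k1) = 
        lc (0 : Fin n → F) (0 : Fin n → K) + algebraMap K F c * (lc y k2 / lc y k1) := by
      simp [lc]
  rwa [numOne_zero, zero_add, e] at h2

/-- if `y` is proportional to a constant vector then `N2 = 0` -/
theorem numTwo_const (htr : Algebra.trdeg K F = 1) (y : Fin n → F) (hy : y ≠ 0) (g : F)
    (c : Fin n → K) (h : ∀ i, y i = algebraMap K F (c i) * g) : numTwo K y = 0 := by
  obtain ⟨k1, k2, hg, H⟩ := H2_eq htr y hy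
  have e : ∀ k : Fin n → K, lc y k = algebraMap K F (∑ i, k i * c i) * g := by
    intro k
    rw [lc, map_sum, Finset.sum_mul]
    exact Finset.sum_congr rfl fun i _ => by rw [h, Algebra.smul_def, map_mul, mul_assoc]
  have hg0 : g ≠ 0 := by
    rintro rfl
    rw [e, mul_zero] at hg; exact hg rfl
  have e2 : lc y k2 / lc y k1 = algebraMap K F ((∑ i, k2 i * c i) / ∑ i, k1 i * c i) := by
    rw [e, e, mul_div_mul_right _ _ hg0, map_div₀]
  rw [← H, e2, finrank_adjoin_const htr]
  rfl

theorem numTwo_pos (htr : Algebra.trdeg K F = 1) (y : Fin n → F) (i j : Fin n) (hj : y j ≠ 0)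
    (h : Transcendental K (y i / y j)) : 0 < numTwo K y := by
  have e : ∀ i, lc y (Pi.single i (1 : K)) = y i := by
    intro i
    simp [lc, Pi.single_apply]
  have h2 := H2_le htr y (Pi.single j (1 : K)) (Pi.single i 1) (by rw [e]; exact hj)
  rw [e, e] at h2
  have := finiteDim_of_transcendental htr _ h
  have h3 : 0 < Module.finrank (IntermediateField.adjoin K {y i / y j}) F := Module.finrank_pos
  omega

theorem adjoin_etaT_le (s : M) (y : Fin n → F) :
    IntermediateField.adjoin K (Set.range (etaT s y)) ≤ bigF (F := F) K s := by
  rw [IntermediateField.adjoin_le_iff]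
  rintro _ ⟨i, rfl⟩
  exact mul_mem (bigF_s s) (bigF_F s _)

theorem deg_Tan (W : Set (Fin n → K)) (s : M) (hs : Transcendental F s) (x y : Fin n → F)
    (hW : zeroLocus K (vanishingIdeal K W) = W)
    (hI : vanishingIdeal K W = RingHom.ker (aeval (etaT s y) : MvPolynomial (Fin n) K →ₐ[K] M))
    (hx : IntermediateField.adjoin K (Set.range x) = ⊤) (hy : y ≠ 0)
    (htr : Algebra.trdeg K F = 1) (hpos : 0 < numTwo K y) :
    0 < IntermediateField.relfinrank (IntermediateField.adjoin K (Set.range (etaT s y)))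
        (bigF (F := F) K s) ∧
    (IntermediateField.relfinrank (IntermediateField.adjoin K (Set.range (etaT s y)))
        (bigF (F := F) K s) : ℤ) * geomDegree W = numTwo K y := by
  obtain ⟨k1, k2, hk⟩ := deg_aux_eq (K := K) s hs x y hx htr hy
  have hL := adjoin_xiT (K := K) s x y hx hy
  have hr : ∀ ℓ : Fin 2 → Fin n → K, (Set.range fun j => lc (etaT s y) (ℓ j)) =
      {s * algebraMap F M (lc y (ℓ 0)), s * algebraMap F M (lc y (ℓ 1))} := by
    intro ℓ
    rw [range_fin_two, lc_etaT, lc_etaT]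
  have hmul : ∀ ℓ : Fin 2 → Fin n → K, 
      IntermediateField.relfinrank (IntermediateField.adjoin K
        (Set.range fun j => lc (etaT s y) (ℓ j))) 
        (IntermediateField.adjoin K (Set.range (etaT s y))) *
      IntermediateField.relfinrank (IntermediateField.adjoin K (Set.range (etaT s y)))
        (bigF (F := F) K s) = 
      IntermediateField.relfinrank (IntermediateField.adjoin K
        {s * algebraMap F M (lc y (ℓ 0)), s * algebraMap F M (lc y (ℓ 1))}) (bigF (F := F) K s) := by
    intro ℓ
    rw [← hr]
    exact IntermediateField.relfinrank_mul_relfinrank (adjoin_field_le (range_lc_subset _ ℓ))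
      (adjoin_etaT_le s y)
  have h0 := hmul ![k1, k2]
  simp only [Matrix.cons_val_zero, Matrix.cons_val_one] at h0
  have hw : 0 < IntermediateField.relfinrank
      (IntermediateField.adjoin K (Set.range (etaT s y))) (bigF (F := F) K s) := by
    rw [Nat.pos_iff_ne_zero]
    intro hw
    rw [hw, mul_zero] at h0
    rw [← h0] at hk
    simp only [Nat.cast_zero] at hk
    omega
  refine ⟨hw, ?_⟩
  have hai : AlgebraicIndependent K (fun j => lc (etaT s y) (![k1, k2] j)) := by
    refine algInd_of_relfinrank_pos _ (Set.range (xiT s x y)) (Set.finite_range _) ?_ ?_ ?_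
    · refine (range_lc_subset (etaT s y) ![k1, k2]).trans (Algebra.adjoin_mono ?_)
      rintro _ ⟨i, rfl⟩
      exact ⟨Fin.natAdd n i, by rw [xiT, Fin.append_right]; rfl⟩
    · rw [trdeg_adjoin_field, hL, trdeg_bigF _ hx htr s hs]; simp
    · rw [hr, hL]
      simp only [Matrix.cons_val_zero, Matrix.cons_val_one]
      omega
  have htr2 : Algebra.trdeg K (Algebra.adjoin K (Set.range (etaT s y))) = 2 := by
    apply le_antisymm
    · rw [trdeg_adjoin_field, ← trdeg_bigF (K := K) _ hx htr s hs]
      exact trdeg_le_of_injective (IntermediateField.inclusion (adjoin_etaT_le s y))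
        (IntermediateField.inclusion_injective _)
    · have h1 : AlgebraicIndependent K (fun j => (⟨lc (etaT s y) (![k1, k2] j), lc_mem _ _⟩ :
          Algebra.adjoin K (Set.range (etaT s y)))) :=
        (AlgHom.algebraicIndependent_iff (Algebra.adjoin K (Set.range (etaT s y))).val
          Subtype.val_injective).1 hai
      have h2 := h1.cardinalMk_le_trdeg
      simpa using h2
  have hg := geomDegree_eq (d := 2) W (etaT s y) hW hI (by simpa using htr2)
    ((numTwo K y).toNat / IntermediateField.relfinrank
      (IntermediateField.adjoin K (Set.range (etaT s y))) (bigF (F := F) K s))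
    (fun ℓ => by
      rw [Nat.le_div_iff_mul_le hw, hmul ℓ]
      have := deg_aux_le s hs x y hx htr (ℓ 0) (ℓ 1) hy
      omega)
    (fun _ => ⟨![k1, k2], by
      refine (Nat.div_eq_of_eq_mul_left hw ?_).symm
      rw [hmul]
      simp only [Matrix.cons_val_zero, Matrix.cons_val_one]
      omega⟩)
  rw [hg]
  have hdvd : IntermediateField.relfinrank
      (IntermediateField.adjoin K (Set.range (etaT s y))) (bigF (F := F) K s) ∣
      (numTwo K y).toNat := ⟨_, by rw [mul_comm]; exact (by omega : _ = _).trans h0.symm⟩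
  rw [← Nat.cast_mul, Nat.mul_div_cancel' hdvd]
  omega

end Deg2

set_option linter.unusedSectionVars false

section Der
variable {K F : Type} [Field K] [IsAlgClosed K] [CharZero K] [Field F] [Algebra K F] {n : ℕ}

theorem derivation_aeval (D : Derivation K F F) (x : Fin n → F) (f : MvPolynomial (Fin n) K) :
    D (aeval x f) = ∑ i, aeval x (pderiv i f) * D (x i) := by
  induction f using MvPolynomial.induction_on with
  | C a => simp [← MvPolynomial.algebraMap_eq]
  | add p q hp hq => 
    simp only [map_add, hp, hq, add_mul, Finset.sum_add_distrib]
  | mul_X p j hp =>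
    simp only [map_mul, aeval_X, Derivation.leibniz, hp, smul_eq_mul, map_add, add_mul,
      Finset.sum_add_distrib, pderiv_X, Finset.mul_sum]
    congr 1
    · rw [Finset.sum_eq_single j]
      · simp
      · intro b _ hb
        simp [hb.symm]
      · simp
    · exact Finset.sum_congr rfl fun i _ => by ring

/-- the field of constants of a derivation -/
def constField (D : Derivation K F F) : IntermediateField K F where
  carrier := {z | D z = 0}
  mul_mem' := by
    intro a b ha hb
    change D (a * b) = 0
    rw [D.leibniz, show D a = 0 from ha, show D b = 0 from hb]; simp
  add_mem' := by
    intro a b ha hb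
    change D (a + b) = 0
    rw [map_add, show D a = 0 from ha, show D b = 0 from hb, add_zero]
  algebraMap_mem' := fun r => D.map_algebraMap r
  inv_mem' := by
    intro a ha
    change D a⁻¹ = 0
    rw [D.leibniz_inv, show D a = 0 from ha, smul_zero]

theorem mem_constField (D : Derivation K F F) (z : F) : z ∈ constField D ↔ D z = 0 := Iff.rfl

theorem derivation_eq_zero_of_gen (D : Derivation K F F) (x : Fin n → F)
    (hx : IntermediateField.adjoin K (Set.range x) = ⊤) (h : ∀ i, D (x i) = 0) : D = 0 := by
  ext z
  have h1 : IntermediateField.adjoin K (Set.range x) ≤ constField D := by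
    rw [IntermediateField.adjoin_le_iff]
    rintro _ ⟨i, rfl⟩
    exact h i
  rw [hx] at h1
  exact h1 (IntermediateField.mem_top (x := z))

theorem constField_alg (D : Derivation K F F) (hD : D ≠ 0) :
    ¬ Algebra.IsAlgebraic (constField D) F := by
  intro halg
  apply hD
  have : Algebra.IsSeparable (constField D) F := inferInstance
  have hU : Algebra.FormallyUnramified (constField D) F :=
    Algebra.FormallyUnramified.of_isSeparable _ _
  let D' : Derivation (constField D) F F :=
    { toFun := D
      map_add' := map_add D
      map_smul' := by
        intro e z
        change D (e.1 * z) = e.1 * D z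
        rw [D.leibniz, show D e.1 = 0 from e.2]; simp
      map_one_eq_zero' := D.map_one_eq_zero
      leibniz' := D.leibniz }
  ext z
  change D' z = 0
  rw [← D'.liftKaehlerDifferential_comp_D, Subsingleton.elim (KaehlerDifferential.D (constField D) F z) 0,
    map_zero]

theorem const_of_derivation_zero [Algebra.EssFiniteType K F] (htr : Algebra.trdeg K F = 1)
    (D : Derivation K F F) (hD : D ≠ 0)
    (z : F) (hz : D z = 0) : ∃ c : K, algebraMap K F c = z := by
  apply mem_range_of_algebraic
  intro ht
  have hfd := finiteDim_of_transcendental htr z ht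
  apply constField_alg D hD
  have hle : IntermediateField.adjoin K {z} ≤ constField D := by
    rw [IntermediateField.adjoin_le_iff]
    rintro _ rfl
    exact hz
  constructor
  intro w
  have h1 : IsAlgebraic (IntermediateField.adjoin K {z}) w := Algebra.IsAlgebraic.isAlgebraic w
  let i1 : Algebra (IntermediateField.adjoin K {z}) (constField D) :=
    (IntermediateField.inclusion hle).toRingHom.toAlgebra
  have i2 : IsScalarTower (IntermediateField.adjoin K {z}) (constField D) F :=
    IsScalarTower.of_algebraMap_eq fun _ => rfl
  exact h1.tower_top _

theorem exists_derivation [Algebra.EssFiniteType K F] (htr : Algebra.trdeg K F = 1) :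
    ∃ D : Derivation K F F, D ≠ 0 := by
  by_contra! hcon
  have hU : Algebra.FormallyUnramified K F := by
    constructor
    rw [← not_nontrivial_iff_subsingleton]
    intro hn
    obtain ⟨ω, hω⟩ := exists_ne (0 : KaehlerDifferential K F)
    obtain ⟨φ, hφ⟩ := Module.Projective.exists_dual_ne_zero F hω
    apply hφ
    have h0 := hcon (φ.compDer (KaehlerDifferential.D K F))
    have h1 : φ = 0 := by
      apply Derivation.liftKaehlerDifferential_unique
      rw [h0]
      ext z
      simp
    rw [h1]; rfl
  have hs : Algebra.IsSeparable K F := Algebra.FormallyUnramified.isSeparable K F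
  have := trdeg_eq_zero (R := K) (A := F)
  rw [htr] at this
  exact one_ne_zero this

end Der

set_option linter.unusedSectionVars false

section LV

/-- generalized cross product of `m` vectors in dimension `m + 1` -/
noncomputable def crossV {R : Type} [CommRing R] {m : ℕ} (B : Fin m → Fin (m + 1) → R)
    (k : Fin (m + 1)) : R :=
  (Matrix.of (Fin.snoc (α := fun _ => Fin (m + 1) → R) B (Pi.single k 1))).det

theorem crossV_rel {R : Type} [CommRing R] {m : ℕ} (B : Fin m → Fin (m + 1) → R)
    (w : Fin (m + 1) → R) (h : ∀ j, ∑ i, B j i * w i = 0) (i k : Fin (m + 1)) :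
    crossV B i * w k = crossV B k * w i := by
  let A : Matrix (Fin (m + 1)) (Fin (m + 1)) R :=
    Matrix.of (Fin.snoc (α := fun _ => Fin (m + 1) → R) B (Pi.single i 1))
  have h1 : A.mulVec w = Pi.single (Fin.last m) (w i) := by
    funext j
    refine Fin.lastCases ?_ (fun j => ?_) j
    · simp only [A, Matrix.mulVec, dotProduct, Matrix.of_apply, Fin.snoc_last, Pi.single_eq_same]
      rw [Finset.sum_eq_single i]
      · simp
      · intro b _ hb
        simp [hb]
      · simp
    · simp [A, Matrix.mulVec, dotProduct, h j]
  have h2 : A.adjugate.mulVec (A.mulVec w) = A.det • w := by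
    rw [Matrix.mulVec_mulVec, Matrix.adjugate_mul, Matrix.smul_mulVec, Matrix.one_mulVec]
  have h3 : A.adjugate k (Fin.last m) = crossV B k := by
    rw [Matrix.adjugate_apply]
    unfold crossV
    congr 1
    ext a b
    refine Fin.lastCases ?_ (fun a => ?_) a
    · simp
    · rw [Matrix.updateRow_ne (Fin.castSucc_lt_last a).ne]
      simp [A]
  have h4 := congrFun h2 k
  rw [h1, Matrix.mulVec_single] at h4
  simp only [Pi.smul_apply, smul_eq_mul, Matrix.col_apply, MulOpposite.smul_eq_mul_unop,
    MulOpposite.unop_op, h3] at h4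
  exact h4.symm

theorem crossV_map {R S : Type} [CommRing R] [CommRing S] (φ : R →+* S) {m : ℕ}
    (B : Fin m → Fin (m + 1) → R) (k : Fin (m + 1)) :
    φ (crossV B k) = crossV (fun j i => φ (B j i)) k := by
  unfold crossV
  rw [RingHom.map_det]
  congr 1
  ext a b
  refine Fin.lastCases ?_ (fun a => ?_) a
  · by_cases hb : b = k
    · subst hb; simp
    · simp [hb]
  · simp

theorem crossV_ne {K : Type} [Field K] {m : ℕ} (B : Fin m → Fin (m + 1) → K)
    (hB : LinearIndependent K B) : ∃ k, crossV B k ≠ 0 := by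
  have h1 : ∃ k, (Pi.single k 1 : Fin (m + 1) → K) ∉ Submodule.span K (Set.range B) := by
    by_contra! hcon
    have h2 : Submodule.span K (Set.range B) = ⊤ := by
      rw [eq_top_iff, ← (Pi.basisFun K (Fin (m + 1))).span_eq, Submodule.span_le]
      rintro _ ⟨k, rfl⟩
      rw [Pi.basisFun_apply]
      exact hcon k
    have h3 := finrank_range_le_card (R := K) B
    rw [Set.finrank, h2, finrank_top, Module.finrank_fin_fun, Fintype.card_fin] at h3
    omega
  obtain ⟨k, hk⟩ := h1
  refine ⟨k, ?_⟩
  have h2 := linearIndependent_finSnoc.2 ⟨hB, hk⟩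
  have h3 := Matrix.linearIndependent_rows_iff_isUnit (K := K)
    (A := Matrix.of (Fin.snoc (α := fun _ => Fin (m + 1) → K) B (Pi.single k 1)))
  have h4 := h3.1 h2
  rw [Matrix.isUnit_iff_isUnit_det] at h4
  exact h4.ne_zero

variable {K F : Type} [Field K] [IsAlgClosed K] [CharZero K] [Field F] [Algebra K F] {n : ℕ}

theorem exists_vf (C : Set (Fin n → K)) (x : Fin n → F)
    (hI : vanishingIdeal K C = RingHom.ker (aeval x : MvPolynomial (Fin n) K →ₐ[K] F))
    (D : Derivation K F F) (y : Fin n → F) (hy : ∀ i, y i = D (x i)) (hy0 : y ≠ 0)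
    (p : Fin n → K) (hp : tangentDimAt C p = 1) :
    ∃ (v : Fin n → MvPolynomial (Fin n) K) (h : F),
      (∀ k, aeval x (v k) = h * y k) ∧ (∃ i, eval p (v i) ≠ 0) ∧
      ∀ w ∈ tangentSpaceAt C p, ∃ l : K, ∀ k, w k = l * eval p (v k) := by
  classical
  let G : Set (Fin n → K) := {g | ∃ f ∈ vanishingIdeal K C, g = fun i => eval p (pderiv i f)}
  let V : Submodule K (Fin n → K) :=
    { carrier := tangentSpaceAt C p
      zero_mem' := by intro f _; simp
      add_mem' := by
        intro a b ha hb f hf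
        simp only [Pi.add_apply, mul_add, Finset.sum_add_distrib, ha f hf, hb f hf, add_zero]
      smul_mem' := by
        intro c a ha f hf
        have : ∀ i, eval p (pderiv i f) * (c • a) i = c * (eval p (pderiv i f) * a i) := by
          intro i; simp only [Pi.smul_apply, smul_eq_mul]; ring
        simp only [this, ← Finset.mul_sum, ha f hf, mul_zero] }
  have hVd : Module.finrank K V = 1 := by
    rw [← hp, tangentDimAt]
    have h1 : Submodule.span K (tangentSpaceAt C p) = V := Submodule.span_eq V
    rw [h1]
  obtain ⟨B, hB1, hB2, hB3⟩ := Submodule.exists_fun_fin_finrank_span_eq K G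
  have hV : ∀ w, w ∈ V ↔ ∀ j, ∑ i, B j i * w i = 0 := by
    intro w
    constructor
    · intro hw j
      obtain ⟨f, hf, hfe⟩ := hB1 j
      rw [hfe]
      exact hw f hf
    · intro hw f hf
      have h1 : (fun i => eval p (pderiv i f)) ∈ Submodule.span K (Set.range B) := by
        rw [hB2]
        exact Submodule.subset_span ⟨f, hf, rfl⟩
      have h2 : ∀ g ∈ Submodule.span K (Set.range B), ∑ i, g i * w i = 0 := by
        intro g hg
        induction hg using Submodule.span_induction with
        | mem g hg => obtain ⟨j, rfl⟩ := hg; exact hw j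
        | zero => simp
        | add a b _ _ ha hb => simp only [Pi.add_apply, add_mul, Finset.sum_add_distrib, ha, hb, add_zero]
        | smul c a _ ha =>
          simp only [Pi.smul_apply, smul_eq_mul, mul_assoc, ← Finset.mul_sum, ha, mul_zero]
      exact h2 _ h1
  have hd := finrank_of_linInd B hB3 V hV
  rw [hVd] at hd
  generalize hm : Module.finrank K (Submodule.span K G) = m at *
  obtain rfl : n = m + 1 := by omega
  choose f hf hfe using hB1
  let BP : Fin m → Fin (m + 1) → MvPolynomial (Fin (m + 1)) K := fun j i => pderiv i (f j)
  have hev : ∀ k, eval p (crossV BP k) = crossV B k := by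
    intro k
    rw [crossV_map]
    congr 1
    funext j
    rw [hfe j]
  obtain ⟨k0, hk0⟩ := crossV_ne B hB3
  obtain ⟨j, hj⟩ : ∃ j, y j ≠ 0 := by
    by_contra! hcon; exact hy0 (funext hcon)
  refine ⟨crossV BP, aeval x (crossV BP j) / y j, ?_, ⟨k0, by rw [hev]; exact hk0⟩, ?_⟩
  · intro k
    have h1 : ∀ a, ∑ i, aeval x (BP a i) * y i = 0 := by
      intro a
      have h2 := derivation_aeval D x (f a)
      have h3 : aeval x (f a) = 0 := by
        have := hf a
        rw [hI] at this
        exact this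
      rw [h3, map_zero] at h2
      rw [h2]
      exact Finset.sum_congr rfl fun i _ => by rw [hy]
    have h4 := crossV_rel (fun a i => aeval x (BP a i)) y h1 j k
    have h5 : ∀ k, aeval x (crossV BP k) = crossV (fun a i => aeval x (BP a i)) k :=
      fun k => crossV_map (aeval x : MvPolynomial (Fin (m + 1)) K →ₐ[K] F).toRingHom BP k
    rw [h5, h5, div_mul_eq_mul_div, h4]
    field_simp
  · intro w hw
    refine ⟨w k0 / crossV B k0, fun k => ?_⟩
    rw [hev, div_mul_eq_mul_div, eq_div_iff hk0]
    have := crossV_rel B w ((hV w).1 hw) k0 k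
    rw [mul_comm, this, mul_comm]

end LV

set_option linter.unusedSectionVars false

section Ideals
variable {K F M : Type} [Field K] [IsAlgClosed K] [CharZero K] [Field F] [Algebra K F]
  [Field M] [Algebra K M] [Algebra F M] [IsScalarTower K F M] {n : ℕ}

theorem append_proj (z : Fin (n + n) → K) : Fin.append (fstProj z) (sndProj z) = z :=
  Fin.append_castAdd_natAdd

theorem fstProj_append (a b : Fin n → K) : fstProj (Fin.append a b) = a := by
  funext i; simp [fstProj]

theorem sndProj_append (a b : Fin n → K) : sndProj (Fin.append a b) = b := by
  funext i; simp [sndProj, -Fin.natAdd_eq_addNat]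

/-- the polynomial `P(x, τ y)` in `τ` -/
noncomputable def tauPoly (x y : Fin n → F) (P : MvPolynomial (Fin (n + n)) K) : Polynomial F :=
  aeval (Fin.append (fun i => Polynomial.C (x i)) (fun i => Polynomial.X * Polynomial.C (y i))) P

theorem tauPoly_s (s : M) (x y : Fin n → F) (P : MvPolynomial (Fin (n + n)) K) :
    Polynomial.aeval s (tauPoly x y P) = aeval (xiT s x y) P := by
  have h := comp_aeval_apply (R := K)
    (Fin.append (fun i => Polynomial.C (x i)) (fun i => Polynomial.X * Polynomial.C (y i)))
    ((Polynomial.aeval s : Polynomial F →ₐ[F] M).restrictScalars K) P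
  refine Eq.trans h ?_
  congr 1
  congr 1
  funext k
  refine Fin.addCases (fun i => ?_) (fun i => ?_) k
  · simp [xiT]
  · simp [xiT, -Fin.natAdd_eq_addNat]
    ring

theorem tauPoly_eval (t : F) (x y : Fin n → F) (P : MvPolynomial (Fin (n + n)) K) :
    Polynomial.eval t (tauPoly x y P) = aeval (Fin.append x (fun i => t * y i)) P := by
  have h := comp_aeval_apply (R := K)
    (Fin.append (fun i => Polynomial.C (x i)) (fun i => Polynomial.X * Polynomial.C (y i)))
    ((Polynomial.aeval t : Polynomial F →ₐ[F] F).restrictScalars K) P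
  rw [← Polynomial.coe_aeval_eq_eval]
  refine Eq.trans h ?_
  congr 1
  congr 1
  funext k
  refine Fin.addCases (fun i => ?_) (fun i => ?_) k
  · simp
  · simp [-Fin.natAdd_eq_addNat]
    ring

theorem tauPoly_zero (s : M) (hs : Transcendental F s) (x y : Fin n → F)
    (P : MvPolynomial (Fin (n + n)) K) :
    aeval (xiT s x y) P = 0 ↔ tauPoly x y P = 0 := by
  rw [← tauPoly_s]
  constructor
  · intro h
    by_contra hne
    exact hs ⟨_, hne, h⟩
  · intro h
    rw [h, map_zero]

/-- `P(X, l v(X))` -/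
noncomputable def specP (l : K) (v : Fin n → MvPolynomial (Fin n) K)
    (P : MvPolynomial (Fin (n + n)) K) : MvPolynomial (Fin n) K :=
  aeval (Fin.append X (fun i => MvPolynomial.C l * v i)) P

theorem specP_aeval {A : Type} [CommRing A] [Algebra K A] (l : K) (v : Fin n → MvPolynomial (Fin n) K)
    (P : MvPolynomial (Fin (n + n)) K) (a : Fin n → A) :
    aeval a (specP l v P) = aeval (Fin.append a (fun i => algebraMap K A l * aeval a (v i))) P := by
  have h := comp_aeval_apply (R := K)
    (Fin.append X (fun i => MvPolynomial.C l * v i))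
    (aeval a : MvPolynomial (Fin n) K →ₐ[K] A) P
  refine Eq.trans h ?_
  congr 1
  congr 1
  funext k
  refine Fin.addCases (fun i => ?_) (fun i => ?_) k <;> simp [-Fin.natAdd_eq_addNat]

theorem zeroLocus_vanishing_TC (C : Set (Fin n → K)) (hC : zeroLocus K (vanishingIdeal K C) = C) :
    zeroLocus K (vanishingIdeal K (tangentBundle C)) = tangentBundle C := by
  apply Set.Subset.antisymm _ (zeroLocus_vanishingIdeal_le _)
  intro z hz
  constructor
  · rw [← hC]
    intro f hf
    have h1 : rename (Fin.castAdd n) f ∈ vanishingIdeal K (tangentBundle C) := by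
      intro w hw
      rw [aeval_rename]
      exact hf _ hw.1
    have h2 := hz _ h1
    rw [aeval_rename] at h2
    exact h2
  · intro f hf
    have e : ∀ w : Fin (n + n) → K, aeval w (∑ i, rename (Fin.castAdd n) (pderiv i f) * X (Fin.natAdd n i) :
        MvPolynomial (Fin (n + n)) K) = ∑ i, eval (fstProj w) (pderiv i f) * sndProj w i := by
      intro w
      rw [map_sum]
      refine Finset.sum_congr rfl fun i _ => ?_
      rw [map_mul, aeval_rename, aeval_X]
      rfl
    have h1 : (∑ i, rename (Fin.castAdd n) (pderiv i f) * X (Fin.natAdd n i) :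
        MvPolynomial (Fin (n + n)) K) ∈ vanishingIdeal K (tangentBundle C) := by
      intro w hw
      rw [e]
      exact hw.2 f hf
    have h2 := hz _ h1
    rw [e] at h2
    exact h2

theorem ideal_TC (C : Set (Fin n → K)) (x : Fin n → F)
    (hI : vanishingIdeal K C = RingHom.ker (aeval x : MvPolynomial (Fin n) K →ₐ[K] F))
    (D : Derivation K F F) (y : Fin n → F) (hy : ∀ i, y i = D (x i)) (hy0 : y ≠ 0)
    (hsm : ∀ p ∈ C, tangentDimAt C p = 1) (hne : C.Nonempty) (s : M) (hs : Transcendental F s) :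
    vanishingIdeal K (tangentBundle C) =
      RingHom.ker (aeval (xiT s x y) : MvPolynomial (Fin (n + n)) K →ₐ[K] M) := by
  have hI' : ∀ f, f ∈ vanishingIdeal K C ↔ aeval x f = 0 := by
    intro f; rw [hI]; rfl
  have key : ∀ (v : Fin n → MvPolynomial (Fin n) K) (h : F), (∀ k, aeval x (v k) = h * y k) →
      ∀ (l : K) (P : MvPolynomial (Fin (n + n)) K),
      aeval x (specP l v P) = Polynomial.eval (algebraMap K F l * h) (tauPoly x y P) := by
    intro v h hv l P
    rw [specP_aeval, tauPoly_eval]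
    congr 3
    funext i
    rw [hv, mul_assoc]
  ext P
  rw [RingHom.mem_ker]
  rw [tauPoly_zero s hs]
  constructor
  · intro hP
    obtain ⟨p, hp⟩ := hne
    obtain ⟨v, h, hv, ⟨i, hi⟩, -⟩ := exists_vf C x hI D y hy hy0 p (hsm p hp)
    have hh : h ≠ 0 := by
      rintro rfl
      apply hi
      have h1 : v i ∈ vanishingIdeal K C := by rw [hI', hv, zero_mul]
      exact h1 p hp
    have hz : ∀ l : K, Polynomial.eval (algebraMap K F l * h) (tauPoly x y P) = 0 := by
      intro l
      rw [← key v h hv, ← hI']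
      intro q hq
      rw [specP_aeval]
      apply hP
      refine ⟨by rw [fstProj_append]; exact hq, ?_⟩
      rw [fstProj_append, sndProj_append]
      intro f hf
      have h2 : (∑ i, pderiv i f * v i) ∈ vanishingIdeal K C := by
        rw [hI', map_sum]
        have h3 := derivation_aeval D x f
        rw [(hI' f).1 hf, map_zero] at h3
        have h4 : ∑ i, aeval x (pderiv i f * v i) = h * ∑ i, aeval x (pderiv i f) * D (x i) := by
          rw [Finset.mul_sum]
          refine Finset.sum_congr rfl fun i _ => ?_
          rw [map_mul, hv, hy]; ring
        rw [h4, ← h3, mul_zero]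
      have h5 := h2 q hq
      rw [map_sum] at h5
      have h6 : ∑ i, eval q (pderiv i f) * (algebraMap K K l * aeval q (v i)) =
          l * ∑ i, aeval q (pderiv i f * v i) := by
        rw [Finset.mul_sum]
        refine Finset.sum_congr rfl fun i _ => ?_
        rw [map_mul]
        change eval q _ * (l * eval q _) = l * (eval q _ * eval q _)
        ring
      rw [h6, h5, mul_zero]
    apply Polynomial.eq_zero_of_infinite_isRoot
    have hinj : Function.Injective fun l : K => algebraMap K F l * h := by
      intro a b hab
      exact (algebraMap K F).injective (mul_right_cancel₀ hh hab)
    exact (Set.infinite_range_of_injective hinj).mono (by rintro _ ⟨l, rfl⟩; exact hz l)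
  · intro hP z hz
    obtain ⟨v, h, hv, -, hw⟩ := exists_vf C x hI D y hy hy0 _ (hsm _ hz.1)
    obtain ⟨l, hl⟩ := hw _ hz.2
    have h1 : specP l v P ∈ vanishingIdeal K C := by
      rw [hI', key v h hv, hP, Polynomial.eval_zero]
    have h2 := h1 _ hz.1
    rw [specP_aeval] at h2
    rw [← h2]
    congr 2
    rw [← append_proj z]
    congr 1
    · rw [append_proj]
    · funext k
      rw [append_proj, hl k]
      rfl

theorem vanishing_Tan (C : Set (Fin n → K)) (x y : Fin n → F) (s : M)
    (hT : vanishingIdeal K (tangentBundle C) =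
      RingHom.ker (aeval (xiT s x y) : MvPolynomial (Fin (n + n)) K →ₐ[K] M)) :
    vanishingIdeal K (tangentialVariety C) =
      RingHom.ker (aeval (etaT s y) : MvPolynomial (Fin n) K →ₐ[K] M) := by
  ext f
  have h1 : f ∈ vanishingIdeal K (tangentialVariety C) ↔
      rename (Fin.natAdd n) f ∈ vanishingIdeal K (tangentBundle C) := by
    constructor
    · intro h z hz
      rw [aeval_rename]
      apply h
      exact zeroLocus_vanishingIdeal_le _ ⟨z, hz, rfl⟩
    · intro h
      apply le_vanishingIdeal_zeroLocus
      rintro _ ⟨z, hz, rfl⟩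
      have := h z hz
      rw [aeval_rename] at this
      exact this
  rw [h1, hT, RingHom.mem_ker, RingHom.mem_ker]
  change aeval (xiT s x y) (rename (Fin.natAdd n) f) = 0 ↔ aeval (etaT s y) f = 0
  rw [aeval_rename]
  have : xiT s x y ∘ Fin.natAdd n = etaT s y := by
    funext i; simp [xiT, etaT, -Fin.natAdd_eq_addNat]
  rw [this]

theorem zeroLocus_vanishing_Tan (C : Set (Fin n → K)) :
    zeroLocus K (vanishingIdeal K (tangentialVariety C)) = tangentialVariety C := by
  apply Set.Subset.antisymm _ (zeroLocus_vanishingIdeal_le _)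
  exact zeroLocus_anti_mono (le_vanishingIdeal_zeroLocus _)

end Ideals

set_option linter.unusedSectionVars false

section Lines
variable {K F : Type} [Field K] [IsAlgClosed K] [CharZero K] [Field F] [Algebra K F]
  [Algebra.EssFiniteType K F] {n : ℕ}

theorem line_numTwo (C : Set (Fin n → K)) (hne : C.Nonempty) (x : Fin n → F)
    (hI : vanishingIdeal K C = RingHom.ker (aeval x : MvPolynomial (Fin n) K →ₐ[K] F))
    (htr : Algebra.trdeg K F = 1)
    (D : Derivation K F F) (y : Fin n → F) (hy : ∀ i, y i = D (x i)) (hy0 : y ≠ 0)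
    (hL : IsLine C) : numTwo K y = 0 := by
  obtain ⟨L, hCL, hd⟩ := hL
  obtain ⟨u, hu, hu2⟩ := finrank_eq_one_iff'.1 hd
  obtain ⟨j, hj⟩ : ∃ j, u.1 j ≠ 0 := by
    by_contra! hcon
    exact hu (Subtype.ext (funext hcon))
  obtain ⟨p0, hp0⟩ := hne
  refine numTwo_const htr y hy0 (y j) (fun i => u.1 i / u.1 j) fun i => ?_
  have h1 : (X i * MvPolynomial.C (u.1 j) - X j * MvPolynomial.C (u.1 i) -
      MvPolynomial.C (p0 i * u.1 j - p0 j * u.1 i) : MvPolynomial (Fin n) K) ∈ vanishingIdeal K C := by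
    intro p hp
    have h2 : p -ᵥ p0 ∈ L.direction := by
      rw [hCL] at hp hp0
      exact AffineSubspace.vsub_mem_direction hp hp0
    obtain ⟨c, hc⟩ := hu2 ⟨_, h2⟩
    have h3 : ∀ k, c * u.1 k = p k - p0 k := fun k => congrFun (congrArg Subtype.val hc) k
    simp only [map_sub, map_mul, aeval_X, aeval_C, Algebra.algebraMap_self, RingHom.id_apply]
    have h4 := h3 i
    have h5 := h3 j
    linear_combination u.1 i * h5 - u.1 j * h4
  rw [hI] at h1
  have h2 : x i * algebraMap K F (u.1 j) - x j * algebraMap K F (u.1 i) -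
      algebraMap K F (p0 i * u.1 j - p0 j * u.1 i) = 0 := by
    have h3 : aeval x _ = 0 := h1
    simpa only [map_sub, map_mul, aeval_X, aeval_C] using h3
  have h3 := congrArg D h2
  simp only [map_sub, Derivation.leibniz, Derivation.map_algebraMap, smul_eq_mul, mul_zero, zero_add,
    map_zero, sub_zero, ← hy] at h3
  have hj' : algebraMap K F (u.1 j) ≠ 0 := by
    rw [Ne, map_eq_zero]; exact hj
  rw [map_div₀]
  field_simp
  linear_combination h3

theorem not_line_numTwo (C : Set (Fin n → K)) (hC : zeroLocus K (vanishingIdeal K C) = C)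
    (x : Fin n → F)
    (hI : vanishingIdeal K C = RingHom.ker (aeval x : MvPolynomial (Fin n) K →ₐ[K] F))
    (htr : Algebra.trdeg K F = 1)
    (D : Derivation K F F) (hD : D ≠ 0) (y : Fin n → F) (hy : ∀ i, y i = D (x i)) (hy0 : y ≠ 0)
    (hL : ¬ IsLine C) : 0 < numTwo K y := by
  obtain ⟨j, hj⟩ : ∃ j, y j ≠ 0 := by
    by_contra! hcon
    exact hy0 (funext hcon)
  by_contra hpos
  apply hL
  have h1 : ∀ i, ∃ c : K, algebraMap K F c = y i / y j := by
    intro i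
    apply mem_range_of_algebraic
    intro ht
    exact hpos (numTwo_pos htr y i j hj ht)
  choose c hc using h1
  have h2 : ∀ i, ∃ d : K, algebraMap K F d = x i - algebraMap K F (c i) * x j := by
    intro i
    apply const_of_derivation_zero htr D hD
    rw [map_sub, D.leibniz, D.map_algebraMap, ← hy, ← hy, hc]
    simp only [smul_eq_mul]
    field_simp
    ring
  choose d hd using h2
  have hcj : c j = 1 := by
    apply (algebraMap K F).injective
    rw [hc, div_self hj, map_one]
  have hdj : d j = 0 := by
    apply (algebraMap K F).injective
    rw [hd, hcj, map_one, map_zero]; ring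
  have hxt : Transcendental K (x j) := by
    by_contra hcon
    obtain ⟨e, he⟩ := mem_range_of_algebraic (x j) hcon
    apply hj
    rw [hy, ← he, D.map_algebraMap]
  refine ⟨AffineSubspace.mk' d (Submodule.span K {c}), ?_, ?_⟩
  · ext q
    rw [SetLike.mem_coe, AffineSubspace.mem_mk', Submodule.mem_span_singleton]
    constructor
    · intro hq
      refine ⟨q j, ?_⟩
      funext i
      have h3 : (X i - MvPolynomial.C (c i) * X j - MvPolynomial.C (d i) : MvPolynomial (Fin n) K) ∈
          vanishingIdeal K C := by
        rw [hI]
        change aeval x _ = 0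
        simp only [map_sub, map_mul, aeval_X, aeval_C, hd]
        ring
      have h4 := h3 q hq
      simp only [map_sub, map_mul, aeval_X, aeval_C, Algebra.algebraMap_self, RingHom.id_apply] at h4
      change q j * c i = q i - d i
      linear_combination -h4
    · rintro ⟨t, ht⟩
      have hq : ∀ i, q i = d i + t * c i := by
        intro i
        have : t * c i = q i - d i := congrFun ht i
        rw [this]; ring
      rw [← hC]
      intro f hf
      rw [hI] at hf
      have hf0 : aeval x f = 0 := hf
      let P : Polynomial K := aeval (fun i => Polynomial.C (d i) + Polynomial.X * Polynomial.C (c i)) f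
      have h3 : Polynomial.aeval (x j) P = aeval x f := by
        refine Eq.trans (comp_aeval_apply (R := K) _ (Polynomial.aeval (x j) : Polynomial K →ₐ[K] F) f) ?_
        congr 2
        funext i
        simp only [map_add, map_mul, Polynomial.aeval_C, Polynomial.aeval_X, hd]
        ring
      have h4 : P = 0 := by
        by_contra hP
        exact hxt ⟨P, hP, h3.trans hf0⟩
      have h5 : Polynomial.aeval t P = aeval q f := by
        refine Eq.trans (comp_aeval_apply (R := K) _ (Polynomial.aeval t : Polynomial K →ₐ[K] K) f) ?_
        congr 2
        funext i
        simp only [map_add, map_mul, Polynomial.aeval_C, Polynomial.aeval_X, hq]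
        rfl
      rw [← h5, h4, map_zero]
  · rw [AffineSubspace.direction_mk']
    apply finrank_span_singleton
    intro h
    rw [h] at hcj
    exact zero_ne_one hcj

end Lines

section Omega
variable {K F M : Type} [Field K] [IsAlgClosed K] [CharZero K] [Field F] [Algebra K F]
  [Field M] [Algebra K M] [Algebra F M] [IsScalarTower K F M]
  [Algebra.EssFiniteType K F] {n : ℕ}

theorem omega_eq (C : Set (Fin n → K)) (x y : Fin n → F) (s : M)
    (hTC : zeroLocus K (vanishingIdeal K (tangentBundle C)) = tangentBundle C)
    (hT : vanishingIdeal K (tangentBundle C) =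
      RingHom.ker (aeval (xiT s x y) : MvPolynomial (Fin (n + n)) K →ₐ[K] M))
    (hx : IntermediateField.adjoin K (Set.range x) = ⊤) (hy : y ≠ 0)
    (hpos : 0 < IntermediateField.relfinrank (IntermediateField.adjoin K (Set.range (etaT s y)))
        (bigF (F := F) K s)) (hL : ¬ IsLine C) :
    omegaCurve C = IntermediateField.relfinrank (IntermediateField.adjoin K (Set.range (etaT s y)))
        (bigF (F := F) K s) := by
  have hTan := vanishing_Tan C x y s hT
  have hTanW := zeroLocus_vanishing_Tan C
  have hxe : ∀ i, xiT s x y (Fin.natAdd n i) = etaT s y i := by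
    intro i; simp [xiT, etaT, -Fin.natAdd_eq_addNat]
  have hSTT : Set.range (etaT s y) ⊆ Set.range (xiT s x y) := by
    rintro _ ⟨i, rfl⟩
    exact ⟨_, hxe i⟩
  have hST : Set.range (etaT s y) ⊆ Algebra.adjoin K (Set.range (xiT s x y)) :=
    hSTT.trans Algebra.subset_adjoin
  rw [← adjoin_xiT (K := K) s x y hx hy] at hpos ⊢
  obtain ⟨a, ha0, ha⟩ := lemB_sub (K := K) (Set.range (etaT s y)) (Set.range (xiT s x y))
    (Set.finite_range _) hST hpos
  generalize IntermediateField.relfinrank (IntermediateField.adjoin K (Set.range (etaT s y)))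
    (IntermediateField.adjoin K (Set.range (xiT s x y))) = w at *
  have ha1 : a.1 ∈ (aeval (etaT s y) : MvPolynomial (Fin n) K →ₐ[K] M).range :=
    (Algebra.adjoin_range_eq_range_aeval K (etaT s y)).le a.2
  obtain ⟨g, hg⟩ := ha1
  have hg' : aeval (etaT s y) g = a.1 := hg
  have hg0 : aeval (etaT s y) g ≠ 0 := by
    rw [hg']
    intro h
    exact ha0 (Subtype.ext h)
  -- fibre count
  have hfib : ∀ v ∈ tangentialVariety C, aeval v g ≠ 0 →
      {z ∈ tangentBundle C | sndProj z = v}.ncard = w := by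
    intro v hv hgv
    rw [← range_ptOf _ _ hTanW hTan] at hv
    obtain ⟨φ, rfl⟩ := hv
    have hφ : φ a ≠ 0 := by
      have h1 := ptOf_aeval (etaT s y) φ g (by rw [hg']; exact a.2)
      rw [← h1] at hgv
      convert hgv
      exact hg'.symm
    rw [← ha φ hφ, ← Set.ncard_image_of_injective _ (ptOf_injective (K := K) (xiT s x y))]
    congr 1
    ext z
    constructor
    · rintro ⟨hz, hzv⟩
      rw [← range_ptOf _ _ hTC hT] at hz
      obtain ⟨ψ, rfl⟩ := hz
      refine ⟨ψ, ?_, rfl⟩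
      have h2 : ψ.comp (Subalgebra.inclusion (Algebra.adjoin_le hST)) = φ := by
        apply ptOf_injective (etaT s y)
        rw [← hzv]
        funext i
        change ψ _ = ψ _
        congr 1
        exact Subtype.ext (hxe i).symm
      intro b
      exact congrArg (fun f : _ →ₐ[K] K => f b) h2
    · rintro ⟨ψ, hψ, rfl⟩
      refine ⟨?_, ?_⟩
      · have := Set.mem_range_self (f := ptOf (K := K) (xiT s x y)) ψ
        rw [range_ptOf _ _ hTC hT] at this
        exact this
      · funext i
        have h3 := hψ ⟨etaT s y i, Algebra.subset_adjoin ⟨i, rfl⟩⟩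
        change _ = φ _
        rw [← h3]
        change ψ _ = ψ _
        congr 1
        exact Subtype.ext (hxe i)
  have hset : {m | ∃ Z : Set (Fin n → K), IsAlgebraicSet Z ∧ ¬ tangentialVariety C ⊆ Z ∧
      ∀ v ∈ tangentialVariety C \ Z,
        {z ∈ tangentBundle C | sndProj z = v}.ncard = m} = {w} := by
    ext m
    constructor
    · rintro ⟨Z, ⟨J, rfl⟩, hZ, hm⟩
      have h4 : ∃ f ∈ J, f ∉ vanishingIdeal K (tangentialVariety C) := by
        by_contra! hcon
        apply hZ
        rw [← hTanW]
        exact zeroLocus_anti_mono hcon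
      obtain ⟨f, hfJ, hf⟩ := h4
      have h5 : f * g ∉ vanishingIdeal K (tangentialVariety C) := by
        rw [hTan] at hf ⊢
        intro h
        have h6 : aeval (etaT s y) (f * g) = 0 := h
        rw [map_mul] at h6
        rcases mul_eq_zero.1 h6 with h7 | h7
        · exact hf h7
        · exact hg0 h7
      have h6 : ∃ v ∈ tangentialVariety C, aeval v (f * g) ≠ 0 := by
        by_contra! hcon
        exact h5 hcon
      obtain ⟨v, hv, hv2⟩ := h6
      rw [map_mul] at hv2
      have h8 := hm v ⟨hv, fun h => left_ne_zero_of_mul hv2 (h f hfJ)⟩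
      rw [Set.mem_singleton_iff, ← h8]
      exact hfib v hv (right_ne_zero_of_mul hv2)
    · rintro rfl
      refine ⟨zeroLocus K (Ideal.span {g}), ⟨_, rfl⟩, ?_, ?_⟩
      · intro h
        have h5 : g ∈ vanishingIdeal K (tangentialVariety C) :=
          fun v hv => h hv g (Ideal.subset_span rfl)
        rw [hTan] at h5
        exact hg0 h5
      · rintro v ⟨hv, hvZ⟩
        apply hfib v hv
        intro h
        apply hvZ
        rw [zeroLocus_span]
        rintro _ rfl
        exact h
  rw [omegaCurve, if_neg hL, hset, csInf_singleton]

end Omega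

section Final

theorem degree_aux {K : Type} [Field K] [IsAlgClosed K]
    [CharZero K] {n : ℕ} (C : Set (Fin n → K)) (hC : IsSmoothCurve C) :
    geomDegree (tangentBundle C) =
      geomDegree C + omegaCurve C * geomDegree (tangentialVariety C) := by
  obtain ⟨⟨⟨J, hJ⟩, hprime⟩, hdim, hsm⟩ := hC
  have hCz : zeroLocus K (vanishingIdeal K C) = C := by
    apply Set.Subset.antisymm _ (zeroLocus_vanishingIdeal_le _)
    rw [hJ]
    exact zeroLocus_anti_mono (le_vanishingIdeal_zeroLocus _)
  have hne : C.Nonempty := by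
    by_contra h
    rw [Set.not_nonempty_iff_eq_empty] at h
    apply hprime.ne_top
    rw [h, vanishingIdeal_empty]
  let R := MvPolynomial (Fin n) K ⧸ vanishingIdeal K C
  let F := FractionRing R
  let x : Fin n → F := fun i => algebraMap R F (Ideal.Quotient.mk _ (X i))
  have hxa : ∀ f, aeval x f = algebraMap R F (Ideal.Quotient.mk _ f) := by
    intro f
    have h := comp_aeval_apply (R := K) (X : Fin n → MvPolynomial (Fin n) K)
      ((IsScalarTower.toAlgHom K R F).comp (Ideal.Quotient.mkₐ K (vanishingIdeal K C))) f
    rw [aeval_X_left_apply] at h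
    exact h.symm
  have hI : vanishingIdeal K C = RingHom.ker (aeval x : MvPolynomial (Fin n) K →ₐ[K] F) := by
    ext f
    rw [RingHom.mem_ker, hxa, FaithfulSMul.algebraMap_eq_zero_iff, Ideal.Quotient.eq_zero_iff_mem]
  have hx : IntermediateField.adjoin K (Set.range x) = ⊤ := by
    rw [eq_top_iff]
    rintro z -
    obtain ⟨a, b, hb, rfl⟩ := IsFractionRing.div_surjective (A := R) z
    have hmem : ∀ a : R, algebraMap R F a ∈ IntermediateField.adjoin K (Set.range x) := by
      intro a
      obtain ⟨f, rfl⟩ := Ideal.Quotient.mk_surjective a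
      rw [← hxa]
      apply IntermediateField.algebra_adjoin_le_adjoin
      rw [Algebra.adjoin_range_eq_range_aeval]
      exact ⟨f, rfl⟩
    exact div_mem (hmem a) (hmem b)
  have hess : Algebra.EssFiniteType K F := by
    have h1 : Algebra.EssFiniteType K R := inferInstance
    have h2 : Algebra.EssFiniteType R F := Algebra.EssFiniteType.of_isLocalization F (nonZeroDivisors R)
    exact Algebra.EssFiniteType.comp K R F
  have htr : Algebra.trdeg K F = 1 := by
    rw [← trdeg_adjoin_top _ hx, trdeg_of_varDim C x hI, hdim, Nat.cast_one]
  obtain ⟨D, hD⟩ := exists_derivation (K := K) (F := F) htr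
  let y : Fin n → F := fun i => D (x i)
  have hy : ∀ i, y i = D (x i) := fun _ => rfl
  have hy0 : y ≠ 0 := by
    intro h
    exact hD (derivation_eq_zero_of_gen D x hx fun i => congrFun h i)
  have hsm' : ∀ p ∈ C, tangentDimAt C p = 1 := fun p hp => (hsm p hp).trans hdim
  let M := FractionRing (Polynomial F)
  let s : M := algebraMap (Polynomial F) M Polynomial.X
  have hs : Transcendental F s := by
    rw [transcendental_algebraMap_iff (IsFractionRing.injective (Polynomial F) M)]
    exact Polynomial.transcendental_X F
  have hT := ideal_TC C x hI D y hy hy0 hsm' hne s hs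
  have hTC := zeroLocus_vanishing_TC C hCz
  have e1 := deg_C C x hCz hI hx htr
  have e2 := deg_TC (tangentBundle C) s hs x y hTC hT hx hy0 htr
  by_cases hL : IsLine C
  · have e3 := line_numTwo C hne x hI htr D y hy hy0 hL
    have e4 : omegaCurve C = 0 := by rw [omegaCurve, if_pos hL]
    rw [e4, zero_mul]
    omega
  · have e3 := not_line_numTwo C hCz x hI htr D hD y hy hy0 hL
    obtain ⟨hp, e4⟩ := deg_Tan (tangentialVariety C) s hs x y (zeroLocus_vanishing_Tan C)
      (vanishing_Tan C x y s hT) hx hy0 htr e3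
    have e5 := omega_eq C x y s hTC hT hx hy0 hp hL
    rw [← e5] at e4
    zify
    rw [e2, e1, e4]

end Final

/-- **Theorem A.** For a smooth irreducible algebraic curve `C ⊆ A^n`,
`deg(TC) = deg(C) + ω(C)·deg(Tan(C))`. -/
theorem degree_tangentBundle_of_smooth_curve {K : Type} [Field K] [IsAlgClosed K]
    [CharZero K] {n : ℕ} (C : Set (Fin n → K)) (hC : IsSmoothCurve C) :
    geomDegree (tangentBundle C) =
      geomDegree C + omegaCurve C * geomDegree (tangentialVariety C) := by
  exact degree_aux C hC
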